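/- Banach–Alaoglu property: every G-bounded subset of 𝓜 is relatively compact with respect to the weak topology of H^s(𝕋,ℝⁿ), with all weak limit points lying in 𝓜. In sequential form: every sequence (γ_k) contained in a G-bounded subset of 𝓜 has a subsequence that converges weakly in H^s(𝕋,ℝⁿ) to some γ ∈ 𝓜 (i.e., the weak limit is again an embedded curve). -/

import Mathlib

open MeasureTheory Real Filter Set
open scoped ENNReal Topology RealInnerProductSpace

noncomputable section

/-- Euclidean space `ℝⁿ`. -/
abbrev En (n : ℕ) : Type := EuclideanSpace ℝ (Fin n)

/-- A fundamental domain for the circle `𝕋 = ℝ/ℤ`. -/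
def I01 : Set ℝ := Set.Ico (0 : ℝ) 1

/-- The intrinsic distance on `𝕋 = ℝ/ℤ`, expressed for real representatives. -/
def dT (x y : ℝ) : ℝ := ⨅ k : ℤ, |x - y - (k : ℝ)|

/-- Supremum norm of a (periodic) function on the circle. -/
def supNorm {E : Type*} [NormedAddCommGroup E] (f : ℝ → E) : ℝ := ⨆ x : ℝ, ‖f x‖

/-- The squared Gagliardo seminorm `[v]_{H^σ}²` of a function on the circle, valued in `[0,∞]`. -/
def gagliardoSqE {E : Type*} [NormedAddCommGroup E] (σ : ℝ) (v : ℝ → E) : ℝ≥0∞ :=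
  ∫⁻ x in I01, ∫⁻ y in I01, ENNReal.ofReal (‖v y - v x‖ ^ 2 / dT x y ^ (2 * σ + 1))

/-- Membership in the Sobolev–Slobodeckij space `H^s(𝕋, ℝⁿ)`; for `s ∈ (3/2,2)` such
functions have a `C¹` representative, which we take as the defining data. -/
def InHs {n : ℕ} (s : ℝ) (u : ℝ → En n) : Prop :=
  Function.Periodic u 1 ∧ ContDiff ℝ 1 u ∧ gagliardoSqE (s - 1) (deriv u) < ⊤

/-- The squared `H^s` norm `‖u‖²_{L²} + ‖u'‖²_{L²} + [u']²_{H^{s-1}}`. -/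
def HsNormSq {n : ℕ} (s : ℝ) (u : ℝ → En n) : ℝ :=
  (∫ x in I01, ‖u x‖ ^ 2) + (∫ x in I01, ‖deriv u x‖ ^ 2) +
    (gagliardoSqE (s - 1) (deriv u)).toReal

/-- The `H^s` norm. -/
def HsNorm {n : ℕ} (s : ℝ) (u : ℝ → En n) : ℝ := Real.sqrt (HsNormSq s u)

/-- The `H^s` inner product. -/
def HsInner {n : ℕ} (s : ℝ) (u v : ℝ → En n) : ℝ :=
  (∫ x in I01, ⟪u x, v x⟫) + (∫ x in I01, ⟪deriv u x, deriv v x⟫) +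
    ∫ x in I01, ∫ y in I01,
      ⟪deriv u y - deriv u x, deriv v y - deriv v x⟫ / dT x y ^ (2 * (s - 1) + 1)

/-- The manifold `𝓜` of embedded closed curves of class `H^s`: injective (on the circle)
immersions. -/
def InM {n : ℕ} (s : ℝ) (γ : ℝ → En n) : Prop :=
  InHs s γ ∧ Set.InjOn γ I01 ∧ ∀ x, deriv γ x ≠ 0

/-- The length `L(γ)`. -/
def arcLen {n : ℕ} (γ : ℝ → En n) : ℝ := ∫ x in I01, ‖deriv γ x‖

/-- The arc-length distance `d_γ(x,y)`: the length of the shorter of the two arcs of `γ`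
between `x` and `y`. -/
def arcDist {n : ℕ} (γ : ℝ → En n) (x y : ℝ) : ℝ :=
  ⨅ k : ℤ, |∫ t in x..(y + (k : ℝ)), ‖deriv γ t‖|

/-- Derivative with respect to arc length, `D_γ u = u' / |γ'|`. -/
def Dg {n : ℕ} (γ u : ℝ → En n) (x : ℝ) : En n := ‖deriv γ x‖⁻¹ • deriv u x

/-- `𝒟_γ u (x)`, the pointwise linear map `w ↦ |γ'(x)|⁻² ⟪γ'(x), w⟫ u'(x)`. -/
def DDg {n : ℕ} (γ u : ℝ → En n) (x : ℝ) (w : En n) : En n :=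
  ((‖deriv γ x‖ ^ 2)⁻¹ * ⟪deriv γ x, w⟫) • deriv u x

/-- The operator `R^s_γ`. -/
def Rop {n : ℕ} (s : ℝ) (γ u : ℝ → En n) (x y : ℝ) : En n :=
  (‖γ y - γ x‖ ^ s)⁻¹ • (u y - u x - DDg γ u x (γ y - γ x))

/-- Density of the measure `μ_γ` with respect to `λ ⊗ λ` on `𝕋 × 𝕋`. -/
def muW {n : ℕ} (γ : ℝ → En n) (x y : ℝ) : ℝ :=
  ‖deriv γ x‖ * ‖deriv γ y‖ / ‖γ y - γ x‖

/-- Density of the measure `ν_γ` with respect to `λ ⊗ λ` on `𝕋 × 𝕋`. -/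
def nuW {n : ℕ} (γ : ℝ → En n) (x y : ℝ) : ℝ :=
  ‖deriv γ x‖ * ‖deriv γ y‖ / arcDist γ x y

/-- The tangent-point energy, valued in `[0,∞]`. -/
def EtpE {n : ℕ} (s : ℝ) (γ : ℝ → En n) : ℝ≥0∞ :=
  ∫⁻ x in I01, ∫⁻ y in I01, ENNReal.ofReal (‖Rop s γ γ x y‖ ^ 2 * muW γ x y)

/-- The tangent-point energy, real-valued (finite on `𝓜`). -/
def Etp {n : ℕ} (s : ℝ) (γ : ℝ → En n) : ℝ := (EtpE s γ).toReal

/-- `‖R^s_γ u‖²_{L²(ν_γ)}`, valued in `[0,∞]`. -/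
def RnuSqE {n : ℕ} (s : ℝ) (γ u : ℝ → En n) : ℝ≥0∞ :=
  ∫⁻ x in I01, ∫⁻ y in I01, ENNReal.ofReal (‖Rop s γ u x y‖ ^ 2 * nuW γ x y)

/-- `‖R^s_γ u‖²_{L²(ν_γ)}`, real-valued. -/
def RnuSq {n : ℕ} (s : ℝ) (γ u : ℝ → En n) : ℝ := (RnuSqE s γ u).toReal

/-- The squared `γ`-dependent seminorm `[u]²_{H^s(γ)}`, valued in `[0,∞]`. -/
def gagGammaSqE {n : ℕ} (s : ℝ) (γ u : ℝ → En n) : ℝ≥0∞ :=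
  ∫⁻ x in I01, ∫⁻ y in I01,
    ENNReal.ofReal (‖Dg γ u y - Dg γ u x‖ ^ 2 / arcDist γ x y ^ (2 * (s - 1)) * nuW γ x y)

/-- The squared `γ`-dependent seminorm `[u]²_{H^s(γ)}`, real-valued. -/
def gagGammaSq {n : ℕ} (s : ℝ) (γ u : ℝ → En n) : ℝ := (gagGammaSqE s γ u).toReal

/-- The inner product `⟨u,v⟩_{L²(γ)}`. -/
def innerL2g {n : ℕ} (γ u v : ℝ → En n) : ℝ := ∫ x in I01, ⟪u x, v x⟫ * ‖deriv γ x‖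

/-- The inner product `⟨u,v⟩_{H¹(γ)}`. -/
def innerH1g {n : ℕ} (γ u v : ℝ → En n) : ℝ :=
  ∫ x in I01, ⟪Dg γ u x, Dg γ v x⟫ * ‖deriv γ x‖

/-- The squared `γ`-dependent norm `‖u‖²_{H^s(γ)}`. -/
def HsGammaNormSq {n : ℕ} (s : ℝ) (γ u : ℝ → En n) : ℝ :=
  innerL2g γ u u + innerH1g γ u u + gagGammaSq s γ u

/-- The `γ`-dependent norm `‖u‖_{H^s(γ)}`. -/
def HsGammaNorm {n : ℕ} (s : ℝ) (γ u : ℝ → En n) : ℝ := Real.sqrt (HsGammaNormSq s γ u)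

/-- The bilinear form `B¹_γ`. -/
def B1 {n : ℕ} (s : ℝ) (γ u v : ℝ → En n) : ℝ :=
  ∫ x in I01, ∫ y in I01, ⟪Rop s γ u x y, Rop s γ v x y⟫ * muW γ x y

/-- The bilinear form `B²_γ`. -/
def B2 {n : ℕ} (s : ℝ) (γ u v : ℝ → En n) : ℝ :=
  ∫ x in I01, ∫ y in I01,
    ‖Rop s γ γ x y‖ ^ 2 * (⟪u y - u x, v y - v x⟫ / ‖γ y - γ x‖ ^ 2) * muW γ x y

/-- The bilinear form `B³_γ`. -/
def B3 {n : ℕ} (s : ℝ) (γ u v : ℝ → En n) : ℝ :=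
  ∫ x in I01, ∫ y in I01,
    ‖Rop s γ γ x y‖ ^ 2 * (⟪Dg γ u x, Dg γ v x⟫ + ⟪Dg γ u y, Dg γ v y⟫) * muW γ x y

/-- The Riemannian metric `G_γ(u,v)`. -/
def Gmet {n : ℕ} (s : ℝ) (γ u v : ℝ → En n) : ℝ :=
  2 * B1 s γ u v + (2 * s + 1) * B2 s γ u v + B3 s γ u v + innerH1g γ u v + innerL2g γ u v

/-- The distortion `distor(γ) = sup_{x ≠ y} d_γ(x,y)/|γ(y) − γ(x)|`, valued in `[0,∞]`. -/
def distorE {n : ℕ} (γ : ℝ → En n) : ℝ≥0∞ :=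
  ⨆ (x ∈ I01) (y ∈ I01) (_ : x ≠ y), ENNReal.ofReal (arcDist γ x y / ‖γ y - γ x‖)

/-- The distortion, real-valued. -/
def distor {n : ℕ} (γ : ℝ → En n) : ℝ := (distorE γ).toReal

/-- A `C¹` path `[0,1] → 𝓜 ⊂ H^s(𝕋,ℝⁿ)` (with respect to the `H^s` topology), recorded
together with its velocity field `V`. -/
structure C1Path (s : ℝ) (n : ℕ) where
  Γ : ℝ → ℝ → En n
  V : ℝ → ℝ → En n
  mem : ∀ t ∈ Set.Icc (0 : ℝ) 1, InM s (Γ t)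
  memV : ∀ t ∈ Set.Icc (0 : ℝ) 1, InHs s (V t)
  isDeriv : ∀ t ∈ Set.Icc (0 : ℝ) 1,
    Tendsto (fun h : ℝ => HsNorm s fun x => h⁻¹ • (Γ (t + h) x - Γ t x) - V t x)
      (𝓝[{h : ℝ | t + h ∈ Set.Icc (0 : ℝ) 1 ∧ h ≠ 0}] 0) (𝓝 0)
  contV : ∀ t ∈ Set.Icc (0 : ℝ) 1,
    Tendsto (fun τ : ℝ => HsNorm s fun x => V τ x - V t x) (𝓝[Set.Icc (0 : ℝ) 1] t) (𝓝 0)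

/-- Length of a path with respect to `G`. -/
def pathLen {s : ℝ} {n : ℕ} (P : C1Path s n) : ℝ :=
  ∫ t in (0 : ℝ)..1, Real.sqrt (Gmet s (P.Γ t) (P.V t) (P.V t))

/-- The path (Dirichlet) energy of a path with respect to `G`. -/
def pathEnergy {s : ℝ} {n : ℕ} (P : C1Path s n) : ℝ :=
  (1 / 2) * ∫ t in (0 : ℝ)..1, Gmet s (P.Γ t) (P.V t) (P.V t)

/-- The geodesic distance induced by `G`, valued in `[0,∞]` (`∞` if there is no path). -/
def geodDist (s : ℝ) {n : ℕ} (γ₀ γ₁ : ℝ → En n) : ℝ≥0∞ :=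
  ⨅ (P : C1Path s n) (_ : P.Γ 0 = γ₀ ∧ P.Γ 1 = γ₁), ENNReal.ofReal (pathLen P)

/-- `U ⊆ 𝓜` is bounded with respect to the geodesic distance `d_G`. -/
def GBounded (s : ℝ) {n : ℕ} (U : Set (ℝ → En n)) : Prop :=
  (∀ γ ∈ U, InM s γ) ∧
    ∃ γ₀, InM s γ₀ ∧ ∃ R : ℝ, ∀ γ ∈ U, geodDist s γ γ₀ ≤ ENNReal.ofReal R

/-- Weak convergence in the Hilbert space `H^s(𝕋,ℝⁿ)`. -/
def WeakHsTendsto {n : ℕ} (s : ℝ) (γk : ℕ → ℝ → En n) (γ : ℝ → En n) : Prop :=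
  ∀ v : ℝ → En n, InHs s v →
    Tendsto (fun k => HsInner s (γk k) v) atTop (𝓝 (HsInner s γ v))

/-- Directional derivative of `γ ↦ G_γ(u,v)` at `γ` in direction `w`. -/
def DGdir {n : ℕ} (s : ℝ) (γ w u v : ℝ → En n) : ℝ :=
  deriv (fun t : ℝ => Gmet s (fun x => γ x + t • w x) u v) 0

/-- `F'` is the derivative of the path `F` with respect to the `H^s` norm, on `S`. -/
def IsHsDerivOn {n : ℕ} (s : ℝ) (F F' : ℝ → ℝ → En n) (S : Set ℝ) : Prop :=
  ∀ t ∈ S,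
    Tendsto (fun h : ℝ => HsNorm s fun x => h⁻¹ • (F (t + h) x - F t x) - F' t x)
      (𝓝[{h : ℝ | t + h ∈ S ∧ h ≠ 0}] 0) (𝓝 0)

/-- The path `F` is continuous on `S` with respect to the `H^s` norm. -/
def HsContOn {n : ℕ} (s : ℝ) (F : ℝ → ℝ → En n) (S : Set ℝ) : Prop :=
  ∀ t ∈ S, Tendsto (fun τ : ℝ => HsNorm s fun x => F τ x - F t x) (𝓝[S] t) (𝓝 0)

/-- A solution of the geodesic initial value problem on `[0,∞)`, recorded as a triple
(position `Γ`, velocity `V`, acceleration `W`); the geodesic equation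
`Γ̈ + A_Γ(Γ̇)Γ̇ = 0` is expressed weakly via the Koszul formula for the
Christoffel operator `A`. -/
def GeodesicSol {n : ℕ} (s : ℝ) (γ₀ v₀ : ℝ → En n) (Γ V W : ℝ → ℝ → En n) : Prop :=
  (∀ t ∈ Set.Ici (0 : ℝ), InM s (Γ t) ∧ InHs s (V t) ∧ InHs s (W t)) ∧
  Γ 0 = γ₀ ∧ V 0 = v₀ ∧
  IsHsDerivOn s Γ V (Set.Ici 0) ∧ IsHsDerivOn s V W (Set.Ici 0) ∧
  HsContOn s V (Set.Ici 0) ∧ HsContOn s W (Set.Ici 0) ∧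
  ∀ t ∈ Set.Ici (0 : ℝ), ∀ w : ℝ → En n, InHs s w →
    Gmet s (Γ t) (W t) w + DGdir s (Γ t) (V t) (V t) w
      - (1 / 2) * DGdir s (Γ t) w (V t) (V t) = 0

lemma dT_eq (x y : ℝ) : dT x y = |x - y - round (x - y)| := by
  apply le_antisymm
  · exact ciInf_le ⟨0, by rintro _ ⟨k, rfl⟩; positivity⟩ (round (x - y))
  · exact le_ciInf fun k => round_le _ _

lemma dT_le (x y : ℝ) (k : ℤ) : dT x y ≤ |x - y - k| :=
  ciInf_le ⟨0, by rintro _ ⟨k, rfl⟩; positivity⟩ k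

lemma dT_nonneg (x y : ℝ) : 0 ≤ dT x y := by rw [dT_eq]; positivity

lemma dT_le_half (x y : ℝ) : dT x y ≤ 1 / 2 := by rw [dT_eq]; exact abs_sub_round _

lemma dT_of_le {x y : ℝ} (h : |x - y| ≤ 1 / 2) : dT x y = |x - y| := by
  apply le_antisymm
  · simpa using dT_le x y 0
  · refine le_ciInf fun k => ?_
    rcases eq_or_ne k 0 with rfl | hk
    · simp
    · have h1 : (1 : ℝ) ≤ |(k : ℝ)| := by exact_mod_cast Int.one_le_abs hk
      have h2 := abs_sub_abs_le_abs_sub (k : ℝ) (x - y)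
      have h3 := abs_sub_comm (k : ℝ) (x - y)
      linarith

lemma dT_add_left (x y : ℝ) : dT (x + 1) y = dT x y := by
  rw [dT_eq, dT_eq]
  have : x + 1 - y = (x - y) + 1 := by ring
  rw [this, round_add_one]; push_cast; congr 1; ring

lemma dT_add_right (x y : ℝ) : dT x (y + 1) = dT x y := by
  rw [dT_eq, dT_eq]
  have : x - (y + 1) = (x - y) - 1 := by ring
  rw [this, round_sub_one]; push_cast; congr 1; ring

lemma dT_comm (x y : ℝ) : dT x y = dT y x := by
  apply le_antisymm
  · rw [dT_eq y x]
    refine (dT_le x y (- round (y - x))).trans_eq ?_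
    rw [← abs_neg]; push_cast; congr 1; ring
  · rw [dT_eq x y]
    refine (dT_le y x (- round (x - y))).trans_eq ?_
    rw [← abs_neg]; push_cast; congr 1; ring

lemma dT_meas : Measurable fun p : ℝ × ℝ => dT p.1 p.2 := by
  have : (fun p : ℝ × ℝ => dT p.1 p.2) = fun p : ℝ × ℝ => ‖((p.1 - p.2 : ℝ) : UnitAddCircle)‖ := by
    ext p; rw [dT_eq, UnitAddCircle.norm_eq]
  rw [this]
  apply Continuous.measurable
  exact continuous_norm.comp ((AddCircle.continuous_mk' 1).comp (by fun_prop))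

lemma dT_pos {x y : ℝ} (hx : x ∈ I01) (hy : y ∈ I01) (h : x ≠ y) : 0 < dT x y := by
  rcases (dT_nonneg x y).lt_or_eq with h1 | h1
  · exact h1
  · exfalso
    rw [dT_eq, eq_comm, abs_eq_zero] at h1
    obtain ⟨a, b⟩ := hx
    obtain ⟨c, d⟩ := hy
    have h2 : ((round (x - y) : ℤ) : ℝ) < 1 := by linarith
    have h3 : (-1 : ℝ) < ((round (x - y) : ℤ) : ℝ) := by linarith
    have h4 : round (x - y) < 1 := by exact_mod_cast h2
    have h5 : -1 < round (x - y) := by exact_mod_cast h3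
    have h6 : round (x - y) = 0 := by omega
    rw [h6] at h1; simp at h1; exact h (by linarith)

lemma lint_per (F : ℝ → ℝ≥0∞) (hF : ∀ x, F (x + 1) = F x) (a : ℝ) :
    ∫⁻ x in Ico a (a + 1), F x = ∫⁻ x in I01, F x := by
  have h := (isAddFundamentalDomain_Ioc (T := (1 : ℝ)) one_pos a).setLIntegral_eq
    (isAddFundamentalDomain_Ioc (T := (1 : ℝ)) one_pos 0) F (by
      rintro ⟨g, hg⟩ x
      obtain ⟨k, rfl⟩ := AddSubgroup.mem_zmultiples_iff.1 hg
      have : Function.Periodic F 1 := hF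
      simpa [AddSubgroup.vadd_def, add_comm] using (this.int_mul k) x)
  rw [zero_add] at h
  unfold I01
  rw [setLIntegral_congr (Ico_ae_eq_Ioc (a := a)), setLIntegral_congr (Ico_ae_eq_Ioc (a := (0 : ℝ))), h]

lemma lint2_sub_le (F : ℝ → ℝ → ℝ≥0∞) (h1 : ∀ x y, F (x + 1) y = F x y)
    (h2 : ∀ x y, F x (y + 1) = F x y) {A B : Set ℝ} {a b : ℝ} (hA : A ⊆ Ico a (a + 1))
    (hB : B ⊆ Ico b (b + 1)) :
    ∫⁻ x in A, ∫⁻ y in B, F x y ≤ ∫⁻ x in I01, ∫⁻ y in I01, F x y := by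
  calc ∫⁻ x in A, ∫⁻ y in B, F x y ≤ ∫⁻ x in A, ∫⁻ y in I01, F x y := by
        refine lintegral_mono fun x => ?_
        rw [← lint_per (F x) (h2 x) b]
        exact lintegral_mono_set hB
    _ ≤ ∫⁻ x in I01, ∫⁻ y in I01, F x y := by
        rw [← lint_per (fun x => ∫⁻ y in I01, F x y) (fun x => by simp_rw [h1]) a]
        exact lintegral_mono_set hA

lemma lint2_shift (F : ℝ → ℝ → ℝ≥0∞) (h2 : ∀ x y, F x (y + 1) = F x y) :
    ∫⁻ x in I01, ∫⁻ y in I01, F x y =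
      ∫⁻ x in I01, ∫⁻ h in Ico (-1/2 : ℝ) (1/2), F x (x + h) := by
  refine lintegral_congr fun x => ?_
  rw [← lint_per (F x) (h2 x) (x - 1/2)]
  have := (measurePreserving_add_left (volume : Measure ℝ) x).setLIntegral_comp_emb
    (measurableEmbedding_addLeft x) (F x) (Ico (-1/2 : ℝ) (1/2))
  rw [this]
  congr 2
  simp only [Set.image_const_add_Ico]
  congr 1 <;> ring

def morC (α : ℝ) : ℝ := 2 / (1 - (2 : ℝ) ^ (-α))

lemma two_rpow_neg_lt {α : ℝ} (hα : 0 < α) : (2 : ℝ) ^ (-α) < 1 :=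
  Real.rpow_lt_one_of_one_lt_of_neg (by norm_num) (by linarith)

lemma morC_pos {α : ℝ} (hα : 0 < α) : 0 < morC α := by
  have := two_rpow_neg_lt hα
  unfold morC; apply div_pos (by norm_num); linarith

lemma morrey_abs {E : Type*} [NormedAddCommGroup E] (ω : Measure ℝ) [SFinite ω]
    (f : ℝ → E) (hf : Continuous f)
    (J : ℕ → Set ℝ) (hJ : Antitone J) (p : E) {ρ B α : ℝ} (hρ : 0 < ρ)
    (hB : 0 < B) (hα : 0 < α) (hω : ∀ k, ω (J k) = ENNReal.ofReal (ρ / 2 ^ k))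
    (hI : ∀ k, ∫⁻ x in J k, ∫⁻ y in J k, ENNReal.ofReal (‖f y - f x‖ ^ 2) ∂ω ∂ω
      ≤ ENNReal.ofReal (B ^ 2 * (ρ / 2 ^ k) ^ (2 * α + 2)))
    (hJm : ∀ k, MeasurableSet (J k))
    (hc : ∀ ε > 0, ∃ k, ∀ x ∈ J k, ‖f x - p‖ ≤ ε) :
    ∫⁻ x in J 0, ENNReal.ofReal ‖f x - p‖ ∂ω ≤ ENNReal.ofReal (ρ * (morC α * B * ρ ^ α)) := by
  have hfm : ∀ x, Measurable fun y => ‖f y - f x‖ := fun x => by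
    apply Continuous.measurable; fun_prop
  set a : ℕ → ℝ≥0∞ := fun k => ENNReal.ofReal (2 ^ k / ρ) * ∫⁻ x in J k, ENNReal.ofReal ‖f x - p‖ ∂ω
  have hcc : ∀ k, ENNReal.ofReal (2 ^ k / ρ) * ENNReal.ofReal (ρ / 2 ^ k) = 1 := fun k => by
    rw [← ENNReal.ofReal_mul (by positivity)]
    rw [show (2 : ℝ) ^ k / ρ * (ρ / 2 ^ k) = 1 by field_simp]; simp
  have step : ∀ k, a k ≤ a (k + 1) + ENNReal.ofReal (2 * B * (ρ / 2 ^ k) ^ α) := by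
    intro k
    set r := ρ / 2 ^ k with hr
    have hr0 : 0 < r := by positivity
    set η := 2 * B * r ^ α with hη
    have hη0 : 0 < η := by positivity
    have pt : ∀ x, ENNReal.ofReal ‖f x - p‖ ≤ (a (k+1) + ENNReal.ofReal (η / 2)) +
        ENNReal.ofReal (2 ^ (k+1) / ρ / (2 * η)) *
          ∫⁻ y in J k, ENNReal.ofReal (‖f y - f x‖ ^ 2) ∂ω := by
      intro x
      calc ENNReal.ofReal ‖f x - p‖
          = ENNReal.ofReal (2 ^ (k+1) / ρ) * ∫⁻ y in J (k+1), ENNReal.ofReal ‖f x - p‖ ∂ω := by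
            rw [setLIntegral_const, hω, mul_comm (ENNReal.ofReal ‖_‖), ← mul_assoc, hcc, one_mul]
        _ ≤ ENNReal.ofReal (2 ^ (k+1) / ρ) * ∫⁻ y in J (k+1), ((ENNReal.ofReal ‖f y - p‖
              + ENNReal.ofReal (η / 2)) + ENNReal.ofReal (1 / (2 * η)) *
              ENNReal.ofReal (‖f y - f x‖ ^ 2)) ∂ω := by
            gcongr with y
            rw [← ENNReal.ofReal_mul (by positivity), ← ENNReal.ofReal_add (by positivity) (by positivity),
              ← ENNReal.ofReal_add (by positivity) (by positivity)]
            apply ENNReal.ofReal_le_ofReal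
            have h1 : ‖f x - p‖ ≤ ‖f y - p‖ + ‖f y - f x‖ := by
              have := norm_sub_le (f y - p) (f y - f x)
              simpa using this
            have h2 : ‖f y - f x‖ ≤ η / 2 + 1 / (2 * η) * ‖f y - f x‖ ^ 2 := by
              have : η / 2 + 1 / (2 * η) * ‖f y - f x‖ ^ 2 - ‖f y - f x‖
                = (η - ‖f y - f x‖) ^ 2 / (2 * η) := by field_simp; ring
              have h3 : 0 ≤ (η - ‖f y - f x‖) ^ 2 / (2 * η) := by positivity
              linarith
            linarith
        _ = (a (k+1) + ENNReal.ofReal (η / 2)) + ENNReal.ofReal (2 ^ (k+1) / ρ / (2 * η)) *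
          ∫⁻ y in J (k+1), ENNReal.ofReal (‖f y - f x‖ ^ 2) ∂ω := by
            rw [lintegral_add_right _ (((hfm x).pow_const 2).ennreal_ofReal.const_mul _),
              lintegral_add_right _ measurable_const, lintegral_const_mul _
              ((hfm x).pow_const 2).ennreal_ofReal, setLIntegral_const, hω, mul_add, mul_add,
              mul_left_comm _ (ENNReal.ofReal (η / 2)), hcc, mul_one, ← mul_assoc,
              ← ENNReal.ofReal_mul (by positivity)]
            congr 3
            ring_nf
        _ ≤ _ := by
            gcongr
            exact hJ (Nat.le_succ k)
    have hmm : Measurable fun x => ∫⁻ y in J k, ENNReal.ofReal (‖f y - f x‖ ^ 2) ∂ω := by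
      apply Measurable.lintegral_prod_right' (f := fun q : ℝ × ℝ => ENNReal.ofReal (‖f q.2 - f q.1‖ ^ 2))
      apply Measurable.ennreal_ofReal
      apply Continuous.measurable; fun_prop
    calc a k ≤ ENNReal.ofReal (2 ^ k / ρ) * ∫⁻ x in J k, ((a (k+1) + ENNReal.ofReal (η / 2)) +
        ENNReal.ofReal (2 ^ (k+1) / ρ / (2 * η)) *
          ∫⁻ y in J k, ENNReal.ofReal (‖f y - f x‖ ^ 2) ∂ω) ∂ω := by
          show ENNReal.ofReal (2 ^ k / ρ) * _ ≤ _
          gcongr with x; exact pt x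
      _ = (a (k+1) + ENNReal.ofReal (η / 2)) + ENNReal.ofReal (2 ^ k / ρ) * (
            ENNReal.ofReal (2 ^ (k+1) / ρ / (2 * η)) *
          ∫⁻ x in J k, ∫⁻ y in J k, ENNReal.ofReal (‖f y - f x‖ ^ 2) ∂ω ∂ω) := by
          rw [lintegral_add_left measurable_const, lintegral_const_mul _ hmm, setLIntegral_const,
            hω, mul_add, mul_left_comm, hcc, mul_one]
      _ ≤ (a (k+1) + ENNReal.ofReal (η / 2)) + ENNReal.ofReal (2 ^ k / ρ) * (
            ENNReal.ofReal (2 ^ (k+1) / ρ / (2 * η)) *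
            ENNReal.ofReal (B ^ 2 * r ^ (2 * α + 2))) := by
          gcongr; exact hI k
      _ ≤ (a (k+1) + ENNReal.ofReal (η / 2)) + ENNReal.ofReal (η / 2) := by
          gcongr
          rw [← ENNReal.ofReal_mul (by positivity), ← ENNReal.ofReal_mul (by positivity)]
          apply ENNReal.ofReal_le_ofReal
          have e1 : r ^ (2 * α + 2) = (r ^ α) ^ 2 * r ^ 2 := by
            rw [Real.rpow_add hr0, mul_comm 2 α, Real.rpow_mul hr0.le]; norm_cast
          have e2 : (2 : ℝ) ^ k / ρ = 1 / r := by rw [hr]; field_simp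
          have e3 : (2 : ℝ) ^ (k+1) / ρ = 2 / r := by rw [hr, pow_succ]; field_simp
          rw [e1, e2, e3, hη]
          have : 0 < r ^ α := by positivity
          apply le_of_sub_nonneg
          have : 2 * B * r ^ α / 2 - 1 / r * (2 / r / (2 * (2 * B * r ^ α)) * (B ^ 2 * ((r ^ α) ^ 2 * r ^ 2)))
            = B * r ^ α / 2 := by field_simp; ring
          rw [this]; positivity
      _ = _ := by
          rw [add_assoc, ← ENNReal.ofReal_add (by positivity) (by positivity)]; congr 2; ring
  set q := (2 : ℝ) ^ (-α) with hq
  have hq0 : 0 < q := by positivity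
  have hq1 : q < 1 := two_rpow_neg_lt hα
  have hpow : ∀ k : ℕ, (ρ / 2 ^ k) ^ α = ρ ^ α * q ^ k := fun k => by
    rw [Real.div_rpow hρ.le (by positivity), hq, ← Real.rpow_natCast, ← Real.rpow_natCast,
      ← Real.rpow_mul (by norm_num), ← Real.rpow_mul (by norm_num), div_eq_mul_inv,
      ← Real.rpow_neg (by norm_num)]
    congr 2; ring
  have iter : ∀ k, a 0 ≤ a k + ENNReal.ofReal (2 * B * ρ ^ α * ∑ j ∈ Finset.range k, q ^ j) := by
    intro k
    induction k with
    | zero => simp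
    | succ k ih =>
      refine ih.trans ?_
      rw [Finset.sum_range_succ, mul_add, ENNReal.ofReal_add (by positivity) (by positivity),
        add_comm (ENNReal.ofReal (2 * B * ρ ^ α * ∑ j ∈ Finset.range k, q ^ j)), ← add_assoc]
      gcongr
      have := step k
      rwa [hpow, ← mul_assoc] at this
  have fin : a 0 ≤ ENNReal.ofReal (morC α * B * ρ ^ α) := by
    apply ENNReal.le_of_forall_pos_le_add
    intro ε hε _
    obtain ⟨k, hk⟩ := hc ε (by exact_mod_cast hε)
    refine (iter k).trans ?_
    rw [add_comm]
    apply add_le_add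
    · apply ENNReal.ofReal_le_ofReal
      have : ∑ j ∈ Finset.range k, q ^ j ≤ 1 / (1 - q) := by
        rw [geom_sum_eq hq1.ne, ← neg_div_neg_eq]
        have : 0 < q ^ k := by positivity
        gcongr
        · linarith
        · linarith
      calc 2 * B * ρ ^ α * ∑ j ∈ Finset.range k, q ^ j ≤ 2 * B * ρ ^ α * (1 / (1 - q)) := by gcongr
        _ = _ := by unfold morC; ring
    · calc a k ≤ ENNReal.ofReal (2 ^ k / ρ) * ∫⁻ x in J k, (ε : ℝ≥0∞) ∂ω := by
            show ENNReal.ofReal (2 ^ k / ρ) * _ ≤ _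
            gcongr 1
            refine setLIntegral_mono measurable_const fun x hx => ?_
            rw [← ENNReal.ofReal_coe_nnreal]
            exact ENNReal.ofReal_le_ofReal (hk x hx)
        _ = ε := by
            rw [setLIntegral_const, hω, mul_left_comm, hcc, mul_one]
  calc ∫⁻ x in J 0, ENNReal.ofReal ‖f x - p‖ ∂ω
      = ENNReal.ofReal ρ * a 0 := by
        show _ = ENNReal.ofReal ρ * (ENNReal.ofReal (2 ^ 0 / ρ) * _)
        have h := hcc 0
        rw [← mul_assoc, mul_comm (ENNReal.ofReal ρ)]
        simp only [pow_zero, div_one] at h ⊢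
        rw [h, one_mul]
    _ ≤ _ := by
        rw [ENNReal.ofReal_mul hρ.le]; gcongr

lemma wint_pos {w : ℝ → ℝ} (hw : Continuous w) (hp : ∀ x, 0 < w x) {a b : ℝ} (h : a < b) :
    0 < ∫ t in a..b, w t :=
  intervalIntegral.intervalIntegral_pos_of_pos (hw.intervalIntegrable _ _) hp h

lemma wint_nonneg {w : ℝ → ℝ} (hp : ∀ x, 0 < w x) {a b : ℝ} (h : a ≤ b) :
    0 ≤ ∫ t in a..b, w t :=
  intervalIntegral.integral_nonneg h fun x _ => (hp x).le

lemma wint_mono {w : ℝ → ℝ} (hw : Continuous w) (hp : ∀ x, 0 < w x) {a b c d : ℝ} (h : c ≤ a)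
    (h1 : a ≤ b) (h2 : b ≤ d) : ∫ t in a..b, w t ≤ ∫ t in c..d, w t := by
  have i := fun x y => hw.intervalIntegrable (μ := volume) x y
  have e : ∫ t in c..d, w t = (∫ t in c..a, w t) + (∫ t in a..b, w t) + ∫ t in b..d, w t := by
    rw [intervalIntegral.integral_add_adjacent_intervals (i _ _) (i _ _),
      intervalIntegral.integral_add_adjacent_intervals (i _ _) (i _ _)]
  have := wint_nonneg hp h
  have := wint_nonneg hp h2
  linarith

lemma wint_abs_le {w : ℝ → ℝ} (hw : Continuous w) (hp : ∀ x, 0 < w x) {a b x y : ℝ}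
    (hx : x ∈ Icc a b) (hy : y ∈ Icc a b) : |∫ t in x..y, w t| ≤ ∫ t in a..b, w t := by
  rcases le_total x y with h | h
  · rw [abs_of_nonneg (wint_nonneg hp h)]
    exact wint_mono hw hp hx.1 h hy.2
  · rw [intervalIntegral.integral_symm, abs_neg, abs_of_nonneg (wint_nonneg hp h)]
    exact wint_mono hw hp hy.1 h hx.2

lemma wint_ne {w : ℝ → ℝ} (hw : Continuous w) (hp : ∀ x, 0 < w x) {x y : ℝ} (h : x ≠ y) :
    0 < |∫ t in x..y, w t| := by
  rcases lt_or_gt_of_ne h with h | h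
  · exact abs_pos.2 (wint_pos hw hp h).ne'
  · rw [intervalIntegral.integral_symm, abs_neg]
    exact abs_pos.2 (wint_pos hw hp h).ne'

lemma lint_w {w : ℝ → ℝ} (hw : Continuous w) (hp : ∀ x, 0 < w x) {a b : ℝ} (h : a ≤ b) :
    ∫⁻ x in Ico a b, ENNReal.ofReal (w x) = ENNReal.ofReal (∫ t in a..b, w t) := by
  rw [intervalIntegral.integral_of_le h, setLIntegral_congr Ico_ae_eq_Ioc,
    ofReal_integral_eq_lintegral_ofReal]
  · exact (hw.integrableOn_Icc (a := a) (b := b)).mono_set Ioc_subset_Icc_self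
  · exact ae_of_all _ fun x => (hp x).le

lemma morrey_w0 {E : Type*} [NormedAddCommGroup E] {α : ℝ} (hα : 0 < α) {w : ℝ → ℝ}
    (hw : Continuous w) (hp : ∀ x, 0 < w x) {f : ℝ → E} (hf : Continuous f) {a b B : ℝ} (hab : a < b)
    (hB : 0 < B) (hI : ∫⁻ x in Ico a b, ∫⁻ y in Ico a b, ENNReal.ofReal
      (‖f y - f x‖ ^ 2 / |∫ t in x..y, w t| ^ (2 * α + 2) * (w x * w y)) ≤ ENNReal.ofReal (B ^ 2))
    (l r : ℕ → ℝ) (hl : Monotone l) (hr : Antitone r) (hl0 : l 0 = a) (hr0 : r 0 = b)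
    (hlr : ∀ k, ∫ t in l k..r k, w t = (∫ t in a..b, w t) / 2 ^ k) (hle : ∀ k, l k ≤ r k)
    (p : ℝ) (hpl : ∀ k, l k ≤ p ∧ p ≤ r k) :
    ∫⁻ x in Ico a b, ENNReal.ofReal (‖f x - f p‖ * w x) ≤
      ENNReal.ofReal ((∫ t in a..b, w t) * (morC α * B * (∫ t in a..b, w t) ^ α)) := by
  set ρ := ∫ t in a..b, w t with hρ
  have hρ0 : 0 < ρ := wint_pos hw hp hab
  have hwm : Measurable fun x => ENNReal.ofReal (w x) := hw.measurable.ennreal_ofReal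
  set ω : Measure ℝ := volume.withDensity fun x => ENNReal.ofReal (w x) with hωd
  have hsub : ∀ k, Ico (l k) (r k) ⊆ Ico a b := fun k => by
    apply Ico_subset_Ico
    · rw [← hl0]; exact hl (Nat.zero_le k)
    · rw [← hr0]; exact hr (Nat.zero_le k)
  have key := morrey_abs ω f hf (fun k => Ico (l k) (r k))
    (fun i j hij => Ico_subset_Ico (hl hij) (hr hij)) (f p) hρ0 hB hα (fun k => by
      rw [hωd, withDensity_apply _ measurableSet_Ico, lint_w hw hp (hle k), hlr]) (fun k => by
      have mq : Measurable fun q : ℝ × ℝ => ENNReal.ofReal (‖f q.2 - f q.1‖ ^ 2) :=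
        Measurable.ennreal_ofReal (Continuous.measurable (by fun_prop))
      have m1 : ∀ x, Measurable fun y => ENNReal.ofReal (‖f y - f x‖ ^ 2) := fun x =>
        Measurable.ennreal_ofReal (Continuous.measurable (by fun_prop))
      rw [hωd, setLIntegral_withDensity_eq_setLIntegral_mul _ hwm
        (by rw [← hωd]; exact mq.lintegral_prod_right') measurableSet_Ico]
      simp_rw [setLIntegral_withDensity_eq_setLIntegral_mul _ hwm (m1 _) measurableSet_Ico]
      simp only [Pi.mul_apply]
      have hrk : 0 < ρ / 2 ^ k := by positivity
      calc _ ≤ ∫⁻ x in Ico (l k) (r k), ENNReal.ofReal ((ρ / 2 ^ k) ^ (2 * α + 2)) *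
            ∫⁻ y in Ico (l k) (r k), ENNReal.ofReal
              (‖f y - f x‖ ^ 2 / |∫ t in x..y, w t| ^ (2 * α + 2) * (w x * w y)) := by
            refine setLIntegral_mono' measurableSet_Ico fun x hx => ?_
            rw [← lintegral_const_mul' _ _ ENNReal.ofReal_ne_top,
              ← lintegral_const_mul' _ _ ENNReal.ofReal_ne_top]
            refine setLIntegral_mono' measurableSet_Ico fun y hy => ?_
            rw [← ENNReal.ofReal_mul (hp _).le, ← ENNReal.ofReal_mul (hp _).le,
              ← ENNReal.ofReal_mul (by positivity)]
            apply ENNReal.ofReal_le_ofReal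
            have hx0 := hp x
            have hy0 := hp y
            rcases eq_or_ne x y with rfl | hxy
            · simp
            have h1 : 0 < |∫ t in x..y, w t| := wint_ne hw hp hxy
            have h2 : |∫ t in x..y, w t| ≤ ρ / 2 ^ k := by
              rw [← hlr]
              exact wint_abs_le hw hp ⟨hx.1, hx.2.le⟩ ⟨hy.1, hy.2.le⟩
            have h3 : |∫ t in x..y, w t| ^ (2 * α + 2) ≤ (ρ / 2 ^ k) ^ (2 * α + 2) :=
              Real.rpow_le_rpow h1.le h2 (by linarith)
            have h4 : 0 < |∫ t in x..y, w t| ^ (2 * α + 2) := by positivity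
            rw [show (ρ / 2 ^ k) ^ (2 * α + 2) * (‖f y - f x‖ ^ 2 /
              |∫ t in x..y, w t| ^ (2 * α + 2) * (w x * w y)) = w x * (w y * ‖f y - f x‖ ^ 2) *
              ((ρ / 2 ^ k) ^ (2 * α + 2) / |∫ t in x..y, w t| ^ (2 * α + 2)) by ring]
            apply le_mul_of_one_le_right (by positivity)
            rwa [one_le_div h4]
        _ ≤ ENNReal.ofReal ((ρ / 2 ^ k) ^ (2 * α + 2)) * ENNReal.ofReal (B ^ 2) := by
            rw [lintegral_const_mul' _ _ ENNReal.ofReal_ne_top]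
            gcongr
            refine le_trans ?_ hI
            refine (lintegral_mono_set (hsub k)).trans (lintegral_mono fun x => lintegral_mono_set (hsub k))
        _ = _ := by rw [← ENNReal.ofReal_mul (by positivity), mul_comm]) (fun k => measurableSet_Ico) (by
      intro ε hε
      obtain ⟨x₀, hx₀, hmin⟩ := isCompact_Icc.exists_isMinOn (nonempty_Icc.2 hab.le) hw.continuousOn
      have hm := hp x₀
      obtain ⟨δ, hδ, hfd⟩ := Metric.continuous_iff.1 hf p ε hε
      obtain ⟨k, hk⟩ := exists_pow_lt_of_lt_one (show 0 < δ * w x₀ / ρ by positivity)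
        (show (1 / 2 : ℝ) < 1 by norm_num)
      refine ⟨k, fun x hx => ?_⟩
      have h1 : (r k - l k) * w x₀ ≤ ρ / 2 ^ k := by
        rw [← hlr]
        have : ∫ t in l k..r k, w x₀ ≤ ∫ t in l k..r k, w t := by
          apply intervalIntegral.integral_mono_on (hle k) (by simp) (hw.intervalIntegrable _ _)
          intro t ht
          apply hmin
          refine ⟨?_, ?_⟩
          · rw [← hl0]; exact (hl (Nat.zero_le k)).trans ht.1
          · rw [← hr0]; exact ht.2.trans (hr (Nat.zero_le k))
        simpa using this
      have h2 : (r k - l k) * w x₀ < δ * w x₀ := by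
        refine h1.trans_lt ?_
        rw [one_div, inv_pow] at hk
        rw [lt_div_iff₀ hρ0] at hk
        rwa [div_eq_mul_inv, mul_comm]
      have h3 : r k - l k < δ := lt_of_mul_lt_mul_right h2 hm.le
      rw [← dist_eq_norm]
      refine (hfd x ?_).le
      have := hpl k
      rw [Real.dist_eq, abs_lt]; constructor <;> linarith [hx.1, hx.2])
  simp only [hl0, hr0] at key
  rw [hωd, setLIntegral_withDensity_eq_setLIntegral_mul _ hwm
    (Measurable.ennreal_ofReal (Continuous.measurable (by fun_prop))) measurableSet_Ico] at key
  refine le_trans (le_of_eq ?_) key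
  refine lintegral_congr fun x => ?_
  rw [Pi.mul_apply, ← ENNReal.ofReal_mul (hp x).le, mul_comm]

lemma exists_wint {w : ℝ → ℝ} (hw : Continuous w) {a b : ℝ} (hab : a ≤ b) {v : ℝ}
    (hv : v ∈ Icc 0 (∫ t in a..b, w t)) : ∃ c ∈ Icc a b, ∫ t in a..c, w t = v := by
  have hc : ContinuousOn (fun c => ∫ t in a..c, w t) (Icc a b) :=
    (intervalIntegral.continuous_primitive (fun x y => hw.intervalIntegrable x y) a).continuousOn
  have := intermediate_value_Icc hab hc
  simp only [intervalIntegral.integral_same] at this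
  exact this hv

lemma exists_wint' {w : ℝ → ℝ} (hw : Continuous w) {a b : ℝ} (hab : a ≤ b) {v : ℝ}
    (hv : v ∈ Icc 0 (∫ t in a..b, w t)) : ∃ c ∈ Icc a b, ∫ t in c..b, w t = v := by
  obtain ⟨c, hc, h⟩ := exists_wint hw hab (v := (∫ t in a..b, w t) - v)
    ⟨by linarith [hv.2], by linarith [hv.1]⟩
  refine ⟨c, hc, ?_⟩
  have := intervalIntegral.integral_add_adjacent_intervals (hw.intervalIntegrable (μ := volume) a c)
    (hw.intervalIntegrable c b)
  linarith

lemma morrey_w {E : Type*} [NormedAddCommGroup E] {α : ℝ} (hα : 0 < α) {w : ℝ → ℝ}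
    (hw : Continuous w) (hp : ∀ x, 0 < w x) {f : ℝ → E} (hf : Continuous f) {a b B : ℝ} (hab : a < b)
    (hB : 0 < B) (hI : ∫⁻ x in Ico a b, ∫⁻ y in Ico a b, ENNReal.ofReal
      (‖f y - f x‖ ^ 2 / |∫ t in x..y, w t| ^ (2 * α + 2) * (w x * w y)) ≤ ENNReal.ofReal (B ^ 2)) :
    ∫⁻ x in Ico a b, ENNReal.ofReal (‖f x - f a‖ * w x) ≤
      ENNReal.ofReal ((∫ t in a..b, w t) * (morC α * B * (∫ t in a..b, w t) ^ α)) ∧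
    ‖f b - f a‖ ≤ 2 * morC α * B * (∫ t in a..b, w t) ^ α := by
  set ρ := ∫ t in a..b, w t with hρ
  have hρ0 : 0 < ρ := wint_pos hw hp hab
  have hmem : ∀ k : ℕ, ρ / 2 ^ k ∈ Icc 0 ρ := fun k =>
    ⟨by positivity, div_le_self hρ0.le (one_le_pow₀ (by norm_num))⟩
  have hanti : ∀ i j : ℕ, i ≤ j → ρ / 2 ^ j ≤ ρ / 2 ^ i := fun i j hij => by
    gcongr; norm_num
  have A1 : ∫⁻ x in Ico a b, ENNReal.ofReal (‖f x - f a‖ * w x) ≤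
      ENNReal.ofReal (ρ * (morC α * B * ρ ^ α)) := by
    choose c hc1 hc2 using fun k => exists_wint hw hab.le (hmem k)
    refine morrey_w0 hα hw hp hf hab hB hI (fun _ => a) c monotone_const ?_ rfl ?_ hc2
      (fun k => (hc1 k).1) a (fun k => ⟨le_rfl, (hc1 k).1⟩)
    · intro i j hij
      by_contra hlt
      push Not at hlt
      have h1 := hanti i j hij
      rw [← hc2, ← hc2] at h1
      have := wint_pos hw hp hlt
      have := intervalIntegral.integral_add_adjacent_intervals
        (hw.intervalIntegrable (μ := volume) a (c i)) (hw.intervalIntegrable (c i) (c j))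
      linarith
    · by_contra hne
      have hlt : c 0 < b := lt_of_le_of_ne (hc1 0).2 hne
      have h1 := hc2 0
      have := wint_pos hw hp hlt
      have := intervalIntegral.integral_add_adjacent_intervals
        (hw.intervalIntegrable (μ := volume) a (c 0)) (hw.intervalIntegrable (c 0) b)
      simp only [pow_zero, div_one] at h1
      linarith
  have A2 : ∫⁻ x in Ico a b, ENNReal.ofReal (‖f x - f b‖ * w x) ≤
      ENNReal.ofReal (ρ * (morC α * B * ρ ^ α)) := by
    choose c hc1 hc2 using fun k => exists_wint' hw hab.le (hmem k)
    refine morrey_w0 hα hw hp hf hab hB hI c (fun _ => b) ?_ antitone_const ?_ rfl hc2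
      (fun k => (hc1 k).2) b (fun k => ⟨(hc1 k).2, le_rfl⟩)
    · intro i j hij
      by_contra hlt
      push Not at hlt
      have h1 := hanti i j hij
      rw [← hc2, ← hc2] at h1
      have := wint_pos hw hp hlt
      have := intervalIntegral.integral_add_adjacent_intervals
        (hw.intervalIntegrable (μ := volume) (c j) (c i)) (hw.intervalIntegrable (c i) b)
      linarith
    · by_contra hne
      have hlt : a < c 0 := lt_of_le_of_ne (hc1 0).1 (Ne.symm hne)
      have h1 := hc2 0
      have := wint_pos hw hp hlt
      have := intervalIntegral.integral_add_adjacent_intervals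
        (hw.intervalIntegrable (μ := volume) a (c 0)) (hw.intervalIntegrable (c 0) b)
      simp only [pow_zero, div_one] at h1
      linarith
  refine ⟨A1, ?_⟩
  have hC := morC_pos hα
  have h : ENNReal.ofReal (‖f b - f a‖ * ρ) ≤ ENNReal.ofReal (2 * morC α * B * ρ ^ α * ρ) := by
    calc ENNReal.ofReal (‖f b - f a‖ * ρ)
        = ∫⁻ x in Ico a b, ENNReal.ofReal ‖f b - f a‖ * ENNReal.ofReal (w x) := by
          rw [lintegral_const_mul' _ _ ENNReal.ofReal_ne_top, lint_w hw hp hab.le,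
            ENNReal.ofReal_mul (norm_nonneg _)]
      _ ≤ ∫⁻ x in Ico a b, (ENNReal.ofReal (‖f x - f a‖ * w x) + ENNReal.ofReal (‖f x - f b‖ * w x)) := by
          refine lintegral_mono fun x => ?_
          have := hp x
          rw [← ENNReal.ofReal_mul (norm_nonneg _), ← ENNReal.ofReal_add (by positivity) (by positivity),
            ← add_mul]
          apply ENNReal.ofReal_le_ofReal
          gcongr
          have := norm_sub_le (f x - f a) (f x - f b)
          simpa using this
      _ ≤ ENNReal.ofReal (ρ * (morC α * B * ρ ^ α)) + ENNReal.ofReal (ρ * (morC α * B * ρ ^ α)) := by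
          rw [lintegral_add_left (Measurable.ennreal_ofReal (Continuous.measurable (by fun_prop)))]
          gcongr
      _ = _ := by
          rw [← ENNReal.ofReal_add (by positivity) (by positivity)]; congr 1; ring
  rw [ENNReal.ofReal_le_ofReal_iff (by positivity)] at h
  exact le_of_mul_le_mul_right h hρ0

def Reg {n : ℕ} (A : ℝ → ℝ → En n) : Prop :=
  Continuous (fun p : ℝ × ℝ => A p.1 p.2) ∧ Continuous (fun p : ℝ × ℝ => deriv (A p.1) p.2)

lemma reg_const {n : ℕ} {γ : ℝ → En n} (h : ContDiff ℝ 1 γ) : Reg (fun _ => γ) :=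
  ⟨h.continuous.comp continuous_snd, (h.continuous_deriv le_rfl).comp continuous_snd⟩

section meas
variable {n : ℕ} {A U : ℝ → ℝ → En n}

lemma Reg.mx (h : Reg A) : Measurable fun q : ℝ × ℝ × ℝ => A q.1 q.2.1 :=
  (h.1.comp (by fun_prop : Continuous fun q : ℝ × ℝ × ℝ => (q.1, q.2.1))).measurable
lemma Reg.my (h : Reg A) : Measurable fun q : ℝ × ℝ × ℝ => A q.1 q.2.2 :=
  (h.1.comp (by fun_prop : Continuous fun q : ℝ × ℝ × ℝ => (q.1, q.2.2))).measurable
lemma Reg.mdx (h : Reg A) : Measurable fun q : ℝ × ℝ × ℝ => deriv (A q.1) q.2.1 :=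
  (h.2.comp (by fun_prop : Continuous fun q : ℝ × ℝ × ℝ => (q.1, q.2.1))).measurable
lemma Reg.mdy (h : Reg A) : Measurable fun q : ℝ × ℝ × ℝ => deriv (A q.1) q.2.2 :=
  (h.2.comp (by fun_prop : Continuous fun q : ℝ × ℝ × ℝ => (q.1, q.2.2))).measurable

lemma meas_Rop (s : ℝ) (hA : Reg A) (hU : Reg U) :
    Measurable fun q : ℝ × ℝ × ℝ => Rop s (A q.1) (U q.1) q.2.1 q.2.2 := by
  have a1 := hA.mx
  have a2 := hA.my
  have a3 := hA.mdx
  have a4 := hU.mx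
  have a5 := hU.my
  have a6 := hU.mdx
  unfold Rop DDg
  exact (((a2.sub a1).norm.pow_const s).inv).smul ((a5.sub a4).sub
    ((((a3.norm.pow_const 2).inv).mul (a3.inner (a2.sub a1))).smul a6))

lemma meas_muW (hA : Reg A) : Measurable fun q : ℝ × ℝ × ℝ => muW (A q.1) q.2.1 q.2.2 :=
  ((hA.mdx.norm).mul hA.mdy.norm).div (hA.my.sub hA.mx).norm

lemma meas_Dgx (hA : Reg A) (hU : Reg U) :
    Measurable fun q : ℝ × ℝ × ℝ => Dg (A q.1) (U q.1) q.2.1 :=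
  (hA.mdx.norm.inv).smul hU.mdx
lemma meas_Dgy (hA : Reg A) (hU : Reg U) :
    Measurable fun q : ℝ × ℝ × ℝ => Dg (A q.1) (U q.1) q.2.2 :=
  (hA.mdy.norm.inv).smul hU.mdy
end meas

section defs
variable {n : ℕ}
def b1 (s : ℝ) (γ u : ℝ → En n) (x y : ℝ) : ℝ := ‖Rop s γ u x y‖ ^ 2 * muW γ x y
def b2 (s : ℝ) (γ u : ℝ → En n) (x y : ℝ) : ℝ :=
  ‖Rop s γ γ x y‖ ^ 2 * (‖u y - u x‖ ^ 2 / ‖γ y - γ x‖ ^ 2) * muW γ x y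
def b3 (s : ℝ) (γ u : ℝ → En n) (x y : ℝ) : ℝ :=
  ‖Rop s γ γ x y‖ ^ 2 * (‖Dg γ u x‖ ^ 2 + ‖Dg γ u y‖ ^ 2) * muW γ x y
def lint2 (f : ℝ → ℝ → ℝ) : ℝ≥0∞ := ∫⁻ x in I01, ∫⁻ y in I01, ENNReal.ofReal (f x y)
def h1E (γ u : ℝ → En n) : ℝ≥0∞ := ∫⁻ x in I01, ENNReal.ofReal (‖Dg γ u x‖ ^ 2 * ‖deriv γ x‖)
def l2E (γ u : ℝ → En n) : ℝ≥0∞ := ∫⁻ x in I01, ENNReal.ofReal (‖u x‖ ^ 2 * ‖deriv γ x‖)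
def GE (s : ℝ) (γ u : ℝ → En n) : ℝ≥0∞ :=
  ENNReal.ofReal 2 * lint2 (b1 s γ u) + ENNReal.ofReal (2 * s + 1) * lint2 (b2 s γ u)
    + lint2 (b3 s γ u) + h1E γ u + l2E γ u

lemma muW_nonneg (γ : ℝ → En n) (x y : ℝ) : 0 ≤ muW γ x y := by unfold muW; positivity
lemma b1_nonneg (s : ℝ) (γ u : ℝ → En n) (x y : ℝ) : 0 ≤ b1 s γ u x y :=
  mul_nonneg (by positivity) (muW_nonneg _ _ _)
lemma b2_nonneg (s : ℝ) (γ u : ℝ → En n) (x y : ℝ) : 0 ≤ b2 s γ u x y :=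
  mul_nonneg (by positivity) (muW_nonneg _ _ _)
lemma b3_nonneg (s : ℝ) (γ u : ℝ → En n) (x y : ℝ) : 0 ≤ b3 s γ u x y :=
  mul_nonneg (by positivity) (muW_nonneg _ _ _)

lemma muW_comm (γ : ℝ → En n) (x y : ℝ) : muW γ x y = muW γ y x := by
  unfold muW; rw [norm_sub_rev, mul_comm ‖deriv γ x‖]

variable {A U : ℝ → ℝ → En n}
lemma meas_b1 (s : ℝ) (hA : Reg A) (hU : Reg U) :
    Measurable fun q : ℝ × ℝ × ℝ => b1 s (A q.1) (U q.1) q.2.1 q.2.2 :=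
  ((meas_Rop s hA hU).norm.pow_const 2).mul (meas_muW hA)
lemma meas_b2 (s : ℝ) (hA : Reg A) (hU : Reg U) :
    Measurable fun q : ℝ × ℝ × ℝ => b2 s (A q.1) (U q.1) q.2.1 q.2.2 :=
  (((meas_Rop s hA hA).norm.pow_const 2).mul (((hU.my.sub hU.mx).norm.pow_const 2).div
    ((hA.my.sub hA.mx).norm.pow_const 2))).mul (meas_muW hA)
lemma meas_b3 (s : ℝ) (hA : Reg A) (hU : Reg U) :
    Measurable fun q : ℝ × ℝ × ℝ => b3 s (A q.1) (U q.1) q.2.1 q.2.2 :=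
  (((meas_Rop s hA hA).norm.pow_const 2).mul (((meas_Dgx hA hU).norm.pow_const 2).add
    ((meas_Dgy hA hU).norm.pow_const 2))).mul (meas_muW hA)

/-- static slices -/
lemma slice {β : Type*} [MeasurableSpace β] {f : ℝ × ℝ × ℝ → β} (h : Measurable f) :
    Measurable fun p : ℝ × ℝ => f (0, p.1, p.2) :=
  h.comp (by fun_prop : Measurable fun p : ℝ × ℝ => ((0 : ℝ), p.1, p.2))

lemma meas_lint2 {F : ℝ → ℝ → ℝ → ℝ} (h : Measurable fun q : ℝ × ℝ × ℝ => F q.1 q.2.1 q.2.2) :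
    Measurable fun t => lint2 (F t) := by
  unfold lint2
  have h1 : Measurable fun p : ℝ × ℝ => ∫⁻ y in I01, ENNReal.ofReal (F p.1 p.2 y) := by
    apply Measurable.lintegral_prod_right' (f := fun r : (ℝ × ℝ) × ℝ => ENNReal.ofReal (F r.1.1 r.1.2 r.2))
    exact (h.comp (by fun_prop : Measurable fun r : (ℝ × ℝ) × ℝ => (r.1.1, r.1.2, r.2))).ennreal_ofReal
  exact h1.lintegral_prod_right'

lemma meas_inner {F : ℝ → ℝ → ℝ} (h : Measurable fun p : ℝ × ℝ => F p.1 p.2) :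
    Measurable fun x => ∫⁻ y in I01, ENNReal.ofReal (F x y) :=
  Measurable.lintegral_prod_right' (f := fun p : ℝ × ℝ => ENNReal.ofReal (F p.1 p.2)) h.ennreal_ofReal

lemma lint2_add {F G : ℝ → ℝ → ℝ} (hF : Measurable fun p : ℝ × ℝ => F p.1 p.2)
    (hF0 : ∀ x y, 0 ≤ F x y) (hG0 : ∀ x y, 0 ≤ G x y) :
    lint2 (fun x y => F x y + G x y) = lint2 F + lint2 G := by
  unfold lint2
  rw [← lintegral_add_left (meas_inner hF)]
  refine lintegral_congr fun x => ?_
  have hx : Measurable fun y => ENNReal.ofReal (F x y) :=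
    (hF.comp (by fun_prop : Measurable fun y : ℝ => (x, y))).ennreal_ofReal
  rw [← lintegral_add_left hx]
  refine lintegral_congr fun y => ?_
  rw [ENNReal.ofReal_add (hF0 _ _) (hG0 _ _)]

lemma lint2_mul {F : ℝ → ℝ → ℝ} {c : ℝ} (hc : 0 ≤ c) :
    lint2 (fun x y => c * F x y) = ENNReal.ofReal c * lint2 F := by
  unfold lint2
  rw [← lintegral_const_mul' _ _ ENNReal.ofReal_ne_top]
  refine lintegral_congr fun x => ?_
  rw [← lintegral_const_mul' _ _ ENNReal.ofReal_ne_top]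
  refine lintegral_congr fun y => ?_
  rw [ENNReal.ofReal_mul hc]

lemma lint2_swap {F : ℝ → ℝ → ℝ} (hF : Measurable fun p : ℝ × ℝ => F p.1 p.2) :
    lint2 (fun x y => F y x) = lint2 F := by
  unfold lint2
  rw [lintegral_lintegral_swap]
  exact (hF.comp measurable_swap).ennreal_ofReal.aemeasurable

lemma lint2_mono {F G : ℝ → ℝ → ℝ} (h : ∀ x ∈ I01, ∀ y ∈ I01, F x y ≤ G x y) :
    lint2 F ≤ lint2 G := by
  refine setLIntegral_mono' measurableSet_Ico fun x hx => ?_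
  refine setLIntegral_mono' measurableSet_Ico fun y hy => ?_
  exact ENNReal.ofReal_le_ofReal (h x hx y hy)

lemma lint2_const {c : ℝ} : lint2 (fun _ _ => c) = ENNReal.ofReal c := by
  simp [lint2, I01]

/-- mono off the diagonal -/
lemma lint2_mono_ne {F G : ℝ → ℝ → ℝ} (h : ∀ x ∈ I01, ∀ y ∈ I01, x ≠ y → F x y ≤ G x y) :
    lint2 F ≤ lint2 G := by
  refine setLIntegral_mono' measurableSet_Ico fun x hx => ?_
  refine setLIntegral_mono_ae' measurableSet_Ico ?_
  have : ∀ᵐ y : ℝ, y ≠ x := by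
    rw [ae_iff]; simp
  filter_upwards [this] with y hy hy1
  exact ENNReal.ofReal_le_ofReal (h x hx y hy1 hy.symm)

lemma iter_eq {f : ℝ → ℝ → ℝ} (hf : Measurable fun p : ℝ × ℝ => f p.1 p.2)
    (h0 : ∀ x y, 0 ≤ f x y) (hfin : lint2 f ≠ ⊤) :
    ENNReal.ofReal (∫ x in I01, ∫ y in I01, f x y) = lint2 f := by
  have hm := meas_inner hf
  have h1 : ∀ x, ∫ y in I01, f x y = (∫⁻ y in I01, ENNReal.ofReal (f x y)).toReal := fun x => by
    rw [integral_eq_lintegral_of_nonneg_ae (ae_of_all _ (h0 x))]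
    exact (hf.comp (by fun_prop : Measurable fun y : ℝ => (x, y))).aestronglyMeasurable
  simp_rw [h1]
  rw [integral_toReal hm.aemeasurable (ae_lt_top hm hfin)]
  exact ENNReal.ofReal_toReal hfin

lemma Gmet_eq {s : ℝ} (hs : 0 < s) {γ u : ℝ → En n} (hγ : ContDiff ℝ 1 γ) (hu : ContDiff ℝ 1 u)
    (hfin : GE s γ u ≠ ⊤) : ENNReal.ofReal (Gmet s γ u u) = GE s γ u := by
  have rγ := reg_const hγ
  have ru := reg_const hu
  have cγ := hγ.continuous_deriv le_rfl
  have cu := hu.continuous_deriv le_rfl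
  unfold GE at hfin
  simp only [ne_eq, ENNReal.add_eq_top, not_or] at hfin
  obtain ⟨⟨⟨⟨f1, f2⟩, f3⟩, f4⟩, f5⟩ := hfin
  have g1 : lint2 (b1 s γ u) ≠ ⊤ := fun h => f1 (by rw [h, ENNReal.mul_top]; simp)
  have g2 : lint2 (b2 s γ u) ≠ ⊤ := fun h => f2 (by
    rw [h, ENNReal.mul_top]; simp; linarith)
  have e1 : ENNReal.ofReal (B1 s γ u u) = lint2 (b1 s γ u) := by
    rw [← iter_eq (slice (meas_b1 s rγ ru)) (b1_nonneg s γ u) g1]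
    simp only [B1, b1, real_inner_self_eq_norm_sq]
  have e2 : ENNReal.ofReal (B2 s γ u u) = lint2 (b2 s γ u) := by
    rw [← iter_eq (slice (meas_b2 s rγ ru)) (b2_nonneg s γ u) g2]
    simp only [B2, b2, real_inner_self_eq_norm_sq]
  have e3 : ENNReal.ofReal (B3 s γ u u) = lint2 (b3 s γ u) := by
    rw [← iter_eq (slice (meas_b3 s rγ ru)) (b3_nonneg s γ u) f3]
    simp only [B3, b3, real_inner_self_eq_norm_sq]
  have mD : Measurable fun x => ‖Dg γ u x‖ ^ 2 * ‖deriv γ x‖ :=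
    (((cγ.measurable.norm.inv).smul cu.measurable).norm.pow_const 2).mul cγ.measurable.norm
  have mL : Measurable fun x => ‖u x‖ ^ 2 * ‖deriv γ x‖ :=
    (hu.continuous.measurable.norm.pow_const 2).mul cγ.measurable.norm
  have e4 : ENNReal.ofReal (innerH1g γ u u) = h1E γ u := by
    simp only [innerH1g, h1E, real_inner_self_eq_norm_sq]
    rw [integral_eq_lintegral_of_nonneg_ae (ae_of_all _ fun x => by positivity) mD.aestronglyMeasurable]
    exact ENNReal.ofReal_toReal f4
  have e5 : ENNReal.ofReal (innerL2g γ u u) = l2E γ u := by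
    simp only [innerL2g, l2E, real_inner_self_eq_norm_sq]
    rw [integral_eq_lintegral_of_nonneg_ae (ae_of_all _ fun x => by positivity) mL.aestronglyMeasurable]
    exact ENNReal.ofReal_toReal f5
  have p1 : 0 ≤ B1 s γ u u := by
    unfold B1; simp only [real_inner_self_eq_norm_sq]
    exact integral_nonneg fun x => integral_nonneg fun y => b1_nonneg s γ u x y
  have p2 : 0 ≤ B2 s γ u u := by
    unfold B2; simp only [real_inner_self_eq_norm_sq]
    exact integral_nonneg fun x => integral_nonneg fun y => b2_nonneg s γ u x y
  have p3 : 0 ≤ B3 s γ u u := by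
    unfold B3; simp only [real_inner_self_eq_norm_sq]
    exact integral_nonneg fun x => integral_nonneg fun y => b3_nonneg s γ u x y
  have p4 : 0 ≤ innerH1g γ u u := by
    unfold innerH1g; simp only [real_inner_self_eq_norm_sq]
    exact integral_nonneg fun x => by positivity
  have p5 : 0 ≤ innerL2g γ u u := by
    unfold innerL2g; simp only [real_inner_self_eq_norm_sq]
    exact integral_nonneg fun x => by positivity
  unfold Gmet GE
  rw [ENNReal.ofReal_add (by positivity) p5, ENNReal.ofReal_add (by positivity) p4,
    ENNReal.ofReal_add (by positivity) p3, ENNReal.ofReal_add (by positivity) (by positivity),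
    ENNReal.ofReal_mul (by norm_num), ENNReal.ofReal_mul (by linarith), e1, e2, e3, e4, e5]
end defs

section static
variable {n : ℕ}

def Nop (γ u : ℝ → En n) (x y : ℝ) : En n :=
  u y - u x - ⟪Dg γ γ x, γ y - γ x⟫ • Dg γ u x

lemma DDg_eq (γ u : ℝ → En n) (x : ℝ) (w : En n) : DDg γ u x w = ⟪Dg γ γ x, w⟫ • Dg γ u x := by
  unfold DDg Dg
  rw [real_inner_smul_left, smul_smul]
  congr 1; rw [pow_two, mul_inv]; ring

lemma Rop_eq (s : ℝ) (γ u : ℝ → En n) (x y : ℝ) :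
    Rop s γ u x y = (‖γ y - γ x‖ ^ s)⁻¹ • Nop γ u x y := by
  unfold Rop Nop; rw [DDg_eq]

lemma Rop_normsq (s : ℝ) (γ u : ℝ → En n) (x y : ℝ) :
    ‖Rop s γ u x y‖ ^ 2 = ‖Nop γ u x y‖ ^ 2 / (‖γ y - γ x‖ ^ s) ^ 2 := by
  rw [Rop_eq, norm_smul, norm_inv, Real.norm_of_nonneg (by positivity)]
  rw [mul_pow, inv_pow, div_eq_inv_mul]

lemma Dg_unit {γ : ℝ → En n} {x : ℝ} (h : deriv γ x ≠ 0) : ‖Dg γ γ x‖ = 1 := by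
  unfold Dg; rw [norm_smul, norm_inv, norm_norm, inv_mul_cancel₀]; simpa using h

lemma norm_Dg_mul {γ u : ℝ → En n} {x : ℝ} (h : deriv γ x ≠ 0) :
    ‖Dg γ u x‖ * ‖deriv γ x‖ = ‖deriv u x‖ := by
  have : ‖deriv γ x‖ ≠ 0 := by simpa using h
  unfold Dg; rw [norm_smul, norm_inv, norm_norm]; field_simp

lemma Nop_aux {γ : ℝ → En n} {x y : ℝ} (h : deriv γ x ≠ 0) :
    ‖γ y - γ x‖ - |⟪Dg γ γ x, γ y - γ x⟫| ≤ ‖Nop γ γ x y‖ := by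
  unfold Nop
  have := norm_sub_norm_le (γ y - γ x) (⟪Dg γ γ x, γ y - γ x⟫ • Dg γ γ x)
  rwa [norm_smul, Dg_unit h, mul_one, Real.norm_eq_abs] at this

lemma inner_le_D {γ : ℝ → En n} {x : ℝ} (h : deriv γ x ≠ 0) (d : En n) :
    |⟪Dg γ γ x, d⟫| ≤ ‖d‖ := by
  have := abs_real_inner_le_norm (Dg γ γ x) d
  rwa [Dg_unit h, one_mul] at this

lemma pw_key {γ : ℝ → En n} (u : ℝ → En n) {x y : ℝ} (hx : deriv γ x ≠ 0) (hy : deriv γ y ≠ 0)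
    (hsg : (0 ≤ ⟪Dg γ γ x, γ y - γ x⟫ ∧ 0 ≤ ⟪Dg γ γ y, γ y - γ x⟫) ∨
      (⟪Dg γ γ x, γ y - γ x⟫ ≤ 0 ∧ ⟪Dg γ γ y, γ y - γ x⟫ ≤ 0)) :
    ‖γ y - γ x‖ * ‖Dg γ u y - Dg γ u x‖ ≤ ‖Nop γ γ y x‖ * ‖Dg γ u y‖ + ‖Nop γ γ x y‖ * ‖Dg γ u x‖
      + ‖Nop γ u x y‖ + ‖Nop γ u y x‖ := by
  have hA := Nop_aux hx (y := y)
  have hB := Nop_aux hy (y := x)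
  rw [← neg_sub (γ y) (γ x), inner_neg_right, abs_neg, norm_neg] at hB
  have hA' := inner_le_D hx (γ y - γ x)
  have hB' := inner_le_D hy (γ y - γ x)
  have hs : Nop γ u x y + Nop γ u y x = ⟪Dg γ γ y, γ y - γ x⟫ • Dg γ u y -
      ⟪Dg γ γ x, γ y - γ x⟫ • Dg γ u x := by
    unfold Nop
    rw [← neg_sub (γ y) (γ x), inner_neg_right]; module
  set D := ‖γ y - γ x‖ with hD
  set a := ⟪Dg γ γ x, γ y - γ x⟫
  set b := ⟪Dg γ γ y, γ y - γ x⟫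
  have hD0 : 0 ≤ D := norm_nonneg _
  have gen : ∀ e p q : ℝ, |e| = D → |p| ≤ ‖Nop γ γ y x‖ → |q| ≤ ‖Nop γ γ x y‖ → p = e - b → q = e - a →
      D * ‖Dg γ u y - Dg γ u x‖ ≤ ‖Nop γ γ y x‖ * ‖Dg γ u y‖ + ‖Nop γ γ x y‖ * ‖Dg γ u x‖
      + ‖Nop γ u x y‖ + ‖Nop γ u y x‖ := by
    intro e p q he hp hq hp' hq'
    have e1 : e • (Dg γ u y - Dg γ u x) = p • Dg γ u y - q • Dg γ u x + Nop γ u x y + Nop γ u y x := by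
      rw [add_assoc, hs, hp', hq']; module
    calc D * ‖Dg γ u y - Dg γ u x‖ = ‖e • (Dg γ u y - Dg γ u x)‖ := by
          rw [norm_smul, Real.norm_eq_abs, he]
      _ ≤ ‖p • Dg γ u y - q • Dg γ u x + Nop γ u x y‖ + ‖Nop γ u y x‖ := by rw [e1]; exact norm_add_le _ _
      _ ≤ ‖p • Dg γ u y - q • Dg γ u x‖ + ‖Nop γ u x y‖ + ‖Nop γ u y x‖ := by
          gcongr; exact norm_add_le _ _
      _ ≤ ‖p • Dg γ u y‖ + ‖q • Dg γ u x‖ + ‖Nop γ u x y‖ + ‖Nop γ u y x‖ := by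
          gcongr; exact norm_sub_le _ _
      _ ≤ _ := by
          rw [norm_smul, norm_smul, Real.norm_eq_abs, Real.norm_eq_abs]; gcongr
  rcases hsg with ⟨ha, hb⟩ | ⟨ha, hb⟩
  · rw [abs_of_nonneg ha] at hA hA'; rw [abs_of_nonneg hb] at hB hB'
    refine gen D (D - b) (D - a) (abs_of_nonneg hD0) ?_ ?_ rfl rfl
    · rwa [abs_of_nonneg (by linarith)]
    · rwa [abs_of_nonneg (by linarith)]
  · rw [abs_of_nonpos ha] at hA hA'; rw [abs_of_nonpos hb] at hB hB'
    refine gen (-D) (-D - b) (-D - a) (by rw [abs_neg]; exact abs_of_nonneg hD0) ?_ ?_ rfl rfl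
    · rw [abs_of_nonpos (by linarith)]; linarith
    · rw [abs_of_nonpos (by linarith)]; linarith

lemma pw_R (s : ℝ) {γ : ℝ → En n} (u : ℝ → En n) {x y : ℝ} (hx : deriv γ x ≠ 0) (hy : deriv γ y ≠ 0)
    (hD : 0 < ‖γ y - γ x‖)
    (hsg : (0 ≤ ⟪Dg γ γ x, γ y - γ x⟫ ∧ 0 ≤ ⟪Dg γ γ y, γ y - γ x⟫) ∨
      (⟪Dg γ γ x, γ y - γ x⟫ ≤ 0 ∧ ⟪Dg γ γ y, γ y - γ x⟫ ≤ 0)) :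
    ‖Dg γ u y - Dg γ u x‖ ^ 2 / ‖γ y - γ x‖ ^ (2 * s - 2) ≤
      4 * (‖Rop s γ u x y‖ ^ 2 + ‖Rop s γ u y x‖ ^ 2 + ‖Rop s γ γ x y‖ ^ 2 * ‖Dg γ u x‖ ^ 2
        + ‖Rop s γ γ y x‖ ^ 2 * ‖Dg γ u y‖ ^ 2) := by
  have key := pw_key u hx hy hsg
  simp only [Rop_normsq]
  rw [norm_sub_rev (γ x) (γ y)]
  set D := ‖γ y - γ x‖
  have e1 : D ^ (2 * s - 2) = (D ^ s) ^ 2 / D ^ 2 := by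
    rw [Real.rpow_sub hD, mul_comm, Real.rpow_mul hD.le]; norm_num
  have hp : 0 < (D ^ s) ^ 2 := by positivity
  have e2 : ‖Dg γ u y - Dg γ u x‖ ^ 2 / D ^ (2 * s - 2) =
      (D * ‖Dg γ u y - Dg γ u x‖) ^ 2 / (D ^ s) ^ 2 := by
    rw [e1]; field_simp
  rw [e2]
  have e3 : 4 * (‖Nop γ u x y‖ ^ 2 / (D ^ s) ^ 2 + ‖Nop γ u y x‖ ^ 2 / (D ^ s) ^ 2 +
      ‖Nop γ γ x y‖ ^ 2 / (D ^ s) ^ 2 * ‖Dg γ u x‖ ^ 2 +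
        ‖Nop γ γ y x‖ ^ 2 / (D ^ s) ^ 2 * ‖Dg γ u y‖ ^ 2) =
      (4 * (‖Nop γ u x y‖ ^ 2 + ‖Nop γ u y x‖ ^ 2 + (‖Nop γ γ x y‖ * ‖Dg γ u x‖) ^ 2
        + (‖Nop γ γ y x‖ * ‖Dg γ u y‖) ^ 2)) / (D ^ s) ^ 2 := by
    field_simp
  rw [e3]
  gcongr
  refine (pow_le_pow_left₀ (by positivity) key 2).trans ?_
  generalize ‖Nop γ u x y‖ = p1
  generalize ‖Nop γ u y x‖ = p2
  generalize ‖Nop γ γ x y‖ * ‖Dg γ u x‖ = p3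
  generalize ‖Nop γ γ y x‖ * ‖Dg γ u y‖ = p4
  nlinarith [sq_nonneg (p1 - p2), sq_nonneg (p1 - p3), sq_nonneg (p1 - p4), sq_nonneg (p2 - p3),
    sq_nonneg (p2 - p4), sq_nonneg (p3 - p4)]

/-- the density version -/
lemma muW_div {s : ℝ} {γ : ℝ → En n} {x y : ℝ} (hD : 0 < ‖γ y - γ x‖) (c : ℝ) :
    c / ‖γ y - γ x‖ ^ (2 * s - 1) * (‖deriv γ x‖ * ‖deriv γ y‖) =
      c / ‖γ y - γ x‖ ^ (2 * s - 2) * muW γ x y := by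
  unfold muW
  have : ‖γ y - γ x‖ ^ (2 * s - 1) = ‖γ y - γ x‖ ^ (2 * s - 2) * ‖γ y - γ x‖ := by
    rw [← Real.rpow_add_one hD.ne']; congr 1; ring
  rw [this]; field_simp

lemma pw_W (s : ℝ) {γ : ℝ → En n} (u : ℝ → En n) {x y : ℝ} (hx : deriv γ x ≠ 0) (hy : deriv γ y ≠ 0)
    (hD : 0 < ‖γ y - γ x‖)
    (hsg : (0 ≤ ⟪Dg γ γ x, γ y - γ x⟫ ∧ 0 ≤ ⟪Dg γ γ y, γ y - γ x⟫) ∨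
      (⟪Dg γ γ x, γ y - γ x⟫ ≤ 0 ∧ ⟪Dg γ γ y, γ y - γ x⟫ ≤ 0)) :
    ‖Dg γ u y - Dg γ u x‖ ^ 2 / ‖γ y - γ x‖ ^ (2 * s - 1) * (‖deriv γ x‖ * ‖deriv γ y‖) ≤
      4 * (b1 s γ u x y + b1 s γ u y x + b3 s γ u x y + b3 s γ u y x) := by
  rw [muW_div hD]
  have h := pw_R s u hx hy hD hsg
  have hm := muW_nonneg γ x y
  refine (mul_le_mul_of_nonneg_right h hm).trans ?_
  unfold b1 b3
  rw [muW_comm γ y x]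
  have h1 : 0 ≤ ‖Rop s γ γ x y‖ ^ 2 * ‖Dg γ u y‖ ^ 2 * muW γ x y := by positivity
  have h2 : 0 ≤ ‖Rop s γ γ y x‖ ^ 2 * ‖Dg γ u x‖ ^ 2 * muW γ x y := by positivity
  nlinarith

lemma pw_tau (s : ℝ) {γ : ℝ → En n} {x y : ℝ} (hx : deriv γ x ≠ 0) (hy : deriv γ y ≠ 0)
    (hD : 0 < ‖γ y - γ x‖)
    (hsg : (0 ≤ ⟪Dg γ γ x, γ y - γ x⟫ ∧ 0 ≤ ⟪Dg γ γ y, γ y - γ x⟫) ∨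
      (⟪Dg γ γ x, γ y - γ x⟫ ≤ 0 ∧ ⟪Dg γ γ y, γ y - γ x⟫ ≤ 0)) :
    ‖Dg γ γ y - Dg γ γ x‖ ^ 2 / ‖γ y - γ x‖ ^ (2 * s - 1) * (‖deriv γ x‖ * ‖deriv γ y‖) ≤
      8 * (b1 s γ γ x y + b1 s γ γ y x) := by
  rw [muW_div hD]
  have h := pw_R s γ hx hy hD hsg
  have hm := muW_nonneg γ x y
  refine (mul_le_mul_of_nonneg_right h hm).trans (le_of_eq ?_)
  unfold b1
  rw [muW_comm γ y x, Dg_unit hx, Dg_unit hy]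
  ring

lemma pw_Wtau (s : ℝ) {γ : ℝ → En n} (u : ℝ → En n) {x y : ℝ} (hx : deriv γ x ≠ 0) (hy : deriv γ y ≠ 0)
    (hD : 0 < ‖γ y - γ x‖)
    (hsg : (0 ≤ ⟪Dg γ γ x, γ y - γ x⟫ ∧ 0 ≤ ⟪Dg γ γ y, γ y - γ x⟫) ∨
      (⟪Dg γ γ x, γ y - γ x⟫ ≤ 0 ∧ ⟪Dg γ γ y, γ y - γ x⟫ ≤ 0)) :
    (‖Dg γ u x‖ * ‖Dg γ γ y - Dg γ γ x‖) ^ 2 / ‖γ y - γ x‖ ^ (2 * s - 1) *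
      (‖deriv γ x‖ * ‖deriv γ y‖) ≤ 8 * (b3 s γ u x y + b3 s γ u y x) := by
  have h := mul_le_mul_of_nonneg_left (pw_tau s hx hy hD hsg) (sq_nonneg ‖Dg γ u x‖)
  have hm := muW_nonneg γ x y
  calc _ = ‖Dg γ u x‖ ^ 2 * (‖Dg γ γ y - Dg γ γ x‖ ^ 2 / ‖γ y - γ x‖ ^ (2 * s - 1) *
      (‖deriv γ x‖ * ‖deriv γ y‖)) := by ring
    _ ≤ _ := h
    _ ≤ _ := by
      unfold b1 b3
      rw [muW_comm γ y x]
      have h1 : 0 ≤ ‖Rop s γ γ x y‖ ^ 2 * ‖Dg γ u y‖ ^ 2 * muW γ x y := by positivity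
      have h2 : 0 ≤ ‖Rop s γ γ y x‖ ^ 2 * ‖Dg γ u y‖ ^ 2 * muW γ x y := by positivity
      nlinarith

/-- periodic immersed curves -/
structure Imm (γ : ℝ → En n) : Prop where
  per : Function.Periodic γ 1
  cd : ContDiff ℝ 1 γ
  ne : ∀ x, deriv γ x ≠ 0

lemma deriv_per {γ : ℝ → En n} (h : Function.Periodic γ 1) (x : ℝ) : deriv γ (x + 1) = deriv γ x := by
  rw [← deriv_comp_add_const]
  congr 1; funext z; exact h z

section per
variable {γ u : ℝ → En n} (hγ : Function.Periodic γ 1) (hu : Function.Periodic u 1) (s : ℝ)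
include hγ
lemma muW_perx (x y : ℝ) : muW γ (x + 1) y = muW γ x y := by
  unfold muW; rw [deriv_per hγ, hγ x]
lemma muW_pery (x y : ℝ) : muW γ x (y + 1) = muW γ x y := by
  unfold muW; rw [deriv_per hγ, hγ y]
include hu
lemma Dg_per (x : ℝ) : Dg γ u (x + 1) = Dg γ u x := by
  unfold Dg; rw [deriv_per hγ, deriv_per hu]
lemma Rop_perx (x y : ℝ) : Rop s γ u (x + 1) y = Rop s γ u x y := by
  unfold Rop DDg; rw [deriv_per hγ, deriv_per hu, hγ x, hu x]
lemma Rop_pery (x y : ℝ) : Rop s γ u x (y + 1) = Rop s γ u x y := by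
  unfold Rop DDg; rw [hγ y, hu y]
lemma b1_perx (x y : ℝ) : b1 s γ u (x + 1) y = b1 s γ u x y := by
  unfold b1; rw [muW_perx hγ, Rop_perx hγ hu]
lemma b1_pery (x y : ℝ) : b1 s γ u x (y + 1) = b1 s γ u x y := by
  unfold b1; rw [muW_pery hγ, Rop_pery hγ hu]
lemma b3_perx (x y : ℝ) : b3 s γ u (x + 1) y = b3 s γ u x y := by
  unfold b3; rw [muW_perx hγ, Rop_perx hγ hγ, Dg_per hγ hu]
lemma b3_pery (x y : ℝ) : b3 s γ u x (y + 1) = b3 s γ u x y := by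
  unfold b3; rw [muW_pery hγ, Rop_pery hγ hγ, Dg_per hγ hu]
end per
end static

section loc
variable {n : ℕ}

lemma Imm.cw {γ : ℝ → En n} (h : Imm γ) : Continuous fun x => ‖deriv γ x‖ :=
  (h.cd.continuous_deriv le_rfl).norm
lemma Imm.pw {γ : ℝ → En n} (h : Imm γ) (x : ℝ) : 0 < ‖deriv γ x‖ := norm_pos_iff.2 (h.ne x)
lemma cd_hd {γ : ℝ → En n} (h : ContDiff ℝ 1 γ) (x : ℝ) : HasDerivAt γ (deriv γ x) x :=
  (h.differentiable one_ne_zero x).hasDerivAt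
lemma Imm.cDg {γ u : ℝ → En n} (h : Imm γ) (hu : ContDiff ℝ 1 u) : Continuous (Dg γ u) :=
  (h.cw.inv₀ fun x => (h.pw x).ne').smul (hu.continuous_deriv le_rfl)

lemma cd_ftc {γ : ℝ → En n} (h : ContDiff ℝ 1 γ) (x y : ℝ) : ∫ t in x..y, deriv γ t = γ y - γ x :=
  intervalIntegral.integral_eq_sub_of_hasDerivAt (fun t _ => cd_hd h t)
    ((h.continuous_deriv le_rfl).intervalIntegrable _ _)

lemma cd_norm_le {γ : ℝ → En n} (h : ContDiff ℝ 1 γ) (x y : ℝ) :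
    ‖γ y - γ x‖ ≤ |∫ t in x..y, ‖deriv γ t‖| := by
  rw [← cd_ftc h]; exact intervalIntegral.norm_integral_le_abs_integral_norm

def Osc (γ : ℝ → En n) (a b : ℝ) : Prop :=
  ∀ p ∈ Icc a b, ∀ q ∈ Icc a b, ‖Dg γ γ p - Dg γ γ q‖ ≤ 1 / 2

lemma cone {γ : ℝ → En n} (hI : Imm γ) {a b : ℝ} (hτ : Osc γ a b) {c x y : ℝ} (hc : c ∈ Icc a b)
    (hx : a ≤ x) (hxy : x ≤ y) (hy : y ≤ b) :
    7 / 8 * (∫ t in x..y, ‖deriv γ t‖) ≤ ⟪Dg γ γ c, γ y - γ x⟫ := by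
  have cd := hI.cd.continuous_deriv le_rfl
  have e : ∫ t in x..y, ⟪Dg γ γ c, deriv γ t⟫ = ⟪Dg γ γ c, γ y - γ x⟫ := by
    rw [intervalIntegral.integral_eq_sub_of_hasDerivAt (f := fun t => ⟪Dg γ γ c, γ t⟫), inner_sub_right]
    · intro t _
      simpa using (hasDerivAt_const t (Dg γ γ c)).inner ℝ (cd_hd hI.cd t)
    · exact (continuous_const.inner cd).intervalIntegrable _ _
  rw [← e, ← intervalIntegral.integral_const_mul]
  refine intervalIntegral.integral_mono_on hxy ((hI.cw.const_mul _).intervalIntegrable _ _)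
    ((continuous_const.inner cd).intervalIntegrable _ _) fun t ht => ?_
  have h1 := hτ c hc t ⟨hx.trans ht.1, ht.2.trans hy⟩
  have h2 : deriv γ t = ‖deriv γ t‖ • Dg γ γ t := by
    unfold Dg; rw [smul_smul, mul_inv_cancel₀ (hI.pw t).ne', one_smul]
  have h3 : 7 / 8 ≤ ⟪Dg γ γ c, Dg γ γ t⟫ := by
    have := norm_sub_sq_real (Dg γ γ c) (Dg γ γ t)
    rw [Dg_unit (hI.ne c), Dg_unit (hI.ne t)] at this
    have h4 : ‖Dg γ γ c - Dg γ γ t‖ ^ 2 ≤ (1 / 2) ^ 2 := pow_le_pow_left₀ (norm_nonneg _) h1 2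
    linarith
  calc 7 / 8 * ‖deriv γ t‖ ≤ ⟪Dg γ γ c, Dg γ γ t⟫ * ‖deriv γ t‖ := by
        exact mul_le_mul_of_nonneg_right h3 (norm_nonneg _)
    _ = ⟪Dg γ γ c, ‖deriv γ t‖ • Dg γ γ t⟫ := by rw [real_inner_smul_right]; ring
    _ = _ := by rw [← h2]

def Sgn (γ : ℝ → En n) (x y : ℝ) : Prop :=
  (0 ≤ ⟪Dg γ γ x, γ y - γ x⟫ ∧ 0 ≤ ⟪Dg γ γ y, γ y - γ x⟫) ∨
      (⟪Dg γ γ x, γ y - γ x⟫ ≤ 0 ∧ ⟪Dg γ γ y, γ y - γ x⟫ ≤ 0)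

lemma cone_D {γ : ℝ → En n} (hI : Imm γ) {a b : ℝ} (hτ : Osc γ a b) {x y : ℝ} (hx : x ∈ Icc a b)
    (hy : y ∈ Icc a b) : 7 / 8 * |∫ t in x..y, ‖deriv γ t‖| ≤ ‖γ y - γ x‖ := by
  rcases le_total x y with h | h
  · rw [abs_of_nonneg (wint_nonneg hI.pw h)]
    exact (cone hI hτ hx hx.1 h hy.2).trans ((le_abs_self _).trans (inner_le_D (hI.ne x) _))
  · rw [intervalIntegral.integral_symm, abs_neg, abs_of_nonneg (wint_nonneg hI.pw h), norm_sub_rev]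
    exact (cone hI hτ hx hy.1 h hx.2).trans ((le_abs_self _).trans (inner_le_D (hI.ne x) _))

lemma cone_sgn {γ : ℝ → En n} (hI : Imm γ) {a b : ℝ} (hτ : Osc γ a b) {x y : ℝ} (hx : x ∈ Icc a b)
    (hy : y ∈ Icc a b) : Sgn γ x y := by
  rcases le_total x y with h | h
  · left
    have := wint_nonneg hI.pw h
    have h1 := cone hI hτ hx hx.1 h hy.2
    have h2 := cone hI hτ hy hx.1 h hy.2
    exact ⟨by linarith, by linarith⟩
  · right
    have := wint_nonneg hI.pw h
    have h1 := cone hI hτ hx hy.1 h hx.2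
    have h2 := cone hI hτ hy hy.1 h hx.2
    rw [← neg_sub, inner_neg_right] at h1 h2
    exact ⟨by linarith, by linarith⟩

lemma loc_gen {s : ℝ} (hs : 1 < s) {γ : ℝ → En n} (hI : Imm γ) {a b : ℝ} (hb : b ≤ a + 1) (hτ : Osc γ a b)
    (q F : ℝ → ℝ → ℝ) (hq : ∀ x, q x x = 0) (hq0 : ∀ x y, 0 ≤ q x y)
    (h1 : ∀ x y, F (x + 1) y = F x y) (h2 : ∀ x y, F x (y + 1) = F x y)
    (h : ∀ x y, 0 < ‖γ y - γ x‖ → Sgn γ x y →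
      q x y / ‖γ y - γ x‖ ^ (2 * s - 1) * (‖deriv γ x‖ * ‖deriv γ y‖) ≤ F x y) :
    ∫⁻ x in Ico a b, ∫⁻ y in Ico a b, ENNReal.ofReal (q x y / |∫ t in x..y, ‖deriv γ t‖| ^ (2 * s - 1)
      * (‖deriv γ x‖ * ‖deriv γ y‖)) ≤ lint2 F := by
  have hsub : Ico a b ⊆ Ico a (a + 1) := Ico_subset_Ico_right hb
  refine le_trans ?_ (lint2_sub_le (fun x y => ENNReal.ofReal (F x y)) (fun x y => by rw [h1])
    (fun x y => by rw [h2]) hsub hsub)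
  refine setLIntegral_mono' measurableSet_Ico fun x hx => ?_
  refine setLIntegral_mono' measurableSet_Ico fun y hy => ?_
  have hx' := Ico_subset_Icc_self hx
  have hy' := Ico_subset_Icc_self hy
  rcases eq_or_ne x y with rfl | hne
  · rw [hq]; simp
  apply ENNReal.ofReal_le_ofReal
  have hl := wint_ne hI.cw hI.pw hne
  have hD : 0 < ‖γ y - γ x‖ := lt_of_lt_of_le (by positivity) (cone_D hI hτ hx' hy')
  refine le_trans ?_ (h x y hD (cone_sgn hI hτ hx' hy'))
  have := hq0 x y
  gcongr
  · linarith
  · exact cd_norm_le hI.cd x y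

lemma lint2_4 {f g : ℝ → ℝ → ℝ} (hf : Measurable fun p : ℝ × ℝ => f p.1 p.2)
    (hg : Measurable fun p : ℝ × ℝ => g p.1 p.2) (f0 : ∀ x y, 0 ≤ f x y) (g0 : ∀ x y, 0 ≤ g x y) :
    lint2 (fun x y => f x y + f y x + g x y + g y x) = 2 * (lint2 f + lint2 g) := by
  have hf' : Measurable fun p : ℝ × ℝ => f p.2 p.1 := hf.comp measurable_swap
  have hg' : Measurable fun p : ℝ × ℝ => g p.2 p.1 := hg.comp measurable_swap
  rw [lint2_add (F := fun x y => f x y + f y x + g x y) (G := fun x y => g y x) ((hf.add hf').add hg)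
    (fun x y => add_nonneg (add_nonneg (f0 _ _) (f0 _ _)) (g0 _ _)) (fun x y => g0 _ _),
    lint2_add (F := fun x y => f x y + f y x) (G := fun x y => g x y) (hf.add hf')
    (fun x y => (add_nonneg (f0 _ _) (f0 _ _))) (fun x y => g0 _ _),
    lint2_add (F := fun x y => f x y) (G := fun x y => f y x) hf
    (fun x y => f0 _ _) (fun x y => f0 _ _), lint2_swap hf, lint2_swap hg]
  ring

lemma lint2_2 {f : ℝ → ℝ → ℝ} (hf : Measurable fun p : ℝ × ℝ => f p.1 p.2)
    (f0 : ∀ x y, 0 ≤ f x y) :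
    lint2 (fun x y => f x y + f y x) = 2 * lint2 f := by
  rw [lint2_add (F := fun x y => f x y) (G := fun x y => f y x) hf
    (fun x y => f0 _ _) (fun x y => f0 _ _), lint2_swap hf]
  ring

lemma sm_b1 {s : ℝ} {γ u : ℝ → En n} (hγ : ContDiff ℝ 1 γ) (hu : ContDiff ℝ 1 u) :
    Measurable fun p : ℝ × ℝ => b1 s γ u p.1 p.2 := slice (meas_b1 s (reg_const hγ) (reg_const hu))
lemma sm_b2 {s : ℝ} {γ u : ℝ → En n} (hγ : ContDiff ℝ 1 γ) (hu : ContDiff ℝ 1 u) :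
    Measurable fun p : ℝ × ℝ => b2 s γ u p.1 p.2 := slice (meas_b2 s (reg_const hγ) (reg_const hu))
lemma sm_b3 {s : ℝ} {γ u : ℝ → En n} (hγ : ContDiff ℝ 1 γ) (hu : ContDiff ℝ 1 u) :
    Measurable fun p : ℝ × ℝ => b3 s γ u p.1 p.2 := slice (meas_b3 s (reg_const hγ) (reg_const hu))

lemma lint2_b13 (s : ℝ) (γ u : ℝ → En n) :
    lint2 (b1 s γ u) + lint2 (b3 s γ u) ≤ GE s γ u := by
  unfold GE
  have : lint2 (b1 s γ u) ≤ ENNReal.ofReal 2 * lint2 (b1 s γ u) := by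
    apply le_mul_of_one_le_left zero_le; simp
  calc _ ≤ ENNReal.ofReal 2 * lint2 (b1 s γ u) + lint2 (b3 s γ u) := by gcongr
    _ ≤ ENNReal.ofReal 2 * lint2 (b1 s γ u) + ENNReal.ofReal (2 * s + 1) * lint2 (b2 s γ u) +
        lint2 (b3 s γ u) := by gcongr; exact le_self_add
    _ ≤ _ := by rw [add_assoc _ (h1E γ u)]; exact le_self_add

lemma loc_tau {s : ℝ} (hs : 1 < s) {γ : ℝ → En n} (hI : Imm γ) {a b : ℝ} (hb : b ≤ a + 1) (hτ : Osc γ a b) :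
    ∫⁻ x in Ico a b, ∫⁻ y in Ico a b, ENNReal.ofReal (‖Dg γ γ y - Dg γ γ x‖ ^ 2 /
      |∫ t in x..y, ‖deriv γ t‖| ^ (2 * s - 1) * (‖deriv γ x‖ * ‖deriv γ y‖)) ≤
        ENNReal.ofReal 16 * EtpE s γ := by
  refine (loc_gen hs hI hb hτ (fun x y => ‖Dg γ γ y - Dg γ γ x‖ ^ 2)
    (fun x y => 8 * (b1 s γ γ x y + b1 s γ γ y x)) (by simp) (fun x y => by positivity) ?_ ?_ ?_).trans ?_
  · intro x y; simp only [b1_perx hI.per hI.per, b1_pery hI.per hI.per]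
  · intro x y; simp only [b1_perx hI.per hI.per, b1_pery hI.per hI.per]
  · exact fun x y hD hs => pw_tau s (hI.ne x) (hI.ne y) hD hs
  · rw [lint2_mul (by norm_num), lint2_2 (sm_b1 hI.cd hI.cd) (b1_nonneg s γ γ), ← mul_assoc]
    have : ENNReal.ofReal 8 * 2 = ENNReal.ofReal 16 := by
      rw [← ENNReal.ofReal_ofNat 2, ← ENNReal.ofReal_mul (by norm_num)]; norm_num
    rw [this]; exact le_rfl

lemma loc_W {s : ℝ} (hs : 1 < s) {γ u : ℝ → En n} (hI : Imm γ) (hu : ContDiff ℝ 1 u)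
    (hup : Function.Periodic u 1) {a b : ℝ} (hb : b ≤ a + 1) (hτ : Osc γ a b) :
    ∫⁻ x in Ico a b, ∫⁻ y in Ico a b, ENNReal.ofReal (‖Dg γ u y - Dg γ u x‖ ^ 2 /
      |∫ t in x..y, ‖deriv γ t‖| ^ (2 * s - 1) * (‖deriv γ x‖ * ‖deriv γ y‖)) ≤
        ENNReal.ofReal 8 * GE s γ u := by
  refine (loc_gen hs hI hb hτ (fun x y => ‖Dg γ u y - Dg γ u x‖ ^ 2)
    (fun x y => 4 * (b1 s γ u x y + b1 s γ u y x + b3 s γ u x y + b3 s γ u y x))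
    (by simp) (fun x y => by positivity) ?_ ?_ ?_).trans ?_
  · intro x y; simp only [b1_perx hI.per hup, b1_pery hI.per hup, b3_perx hI.per hup, b3_pery hI.per hup]
  · intro x y; simp only [b1_perx hI.per hup, b1_pery hI.per hup, b3_perx hI.per hup, b3_pery hI.per hup]
  · exact fun x y hD hs => pw_W s u (hI.ne x) (hI.ne y) hD hs
  · rw [lint2_mul (by norm_num), lint2_4 (sm_b1 hI.cd hu) (sm_b3 hI.cd hu) (b1_nonneg s γ u)
      (b3_nonneg s γ u), ← mul_assoc]
    have : ENNReal.ofReal 4 * 2 = ENNReal.ofReal 8 := by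
      rw [← ENNReal.ofReal_ofNat 2, ← ENNReal.ofReal_mul (by norm_num)]; norm_num
    rw [this]; gcongr; exact lint2_b13 _ _ _

lemma S1 {s : ℝ} (hs : 3 / 2 < s) (M : ℝ) (hM : 0 < M) : ∃ r0 > 0, ∀ (n : ℕ) (γ : ℝ → En n), Imm γ →
    EtpE s γ ≤ ENNReal.ofReal M → ∀ a b : ℝ, b ≤ a + 1 → ∫ t in a..b, ‖deriv γ t‖ ≤ r0 →
      ∀ p ∈ Icc a b, ‖Dg γ γ p - Dg γ γ a‖ ≤ 1 / 4 := by
  set α := s - 3 / 2 with hα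
  have hα0 : 0 < α := by linarith
  have hm := morC_pos hα0
  set B := 4 * √M with hB
  have hB0 : 0 < B := by positivity
  refine ⟨(1 / (16 * morC α * B)) ^ (1 / α), by positivity, ?_⟩
  intro n γ hI hE a b hb hr p hp
  by_contra hcon
  push Not at hcon
  have cτ : Continuous fun x => ‖Dg γ γ x - Dg γ γ a‖ := ((hI.cDg hI.cd).sub continuous_const).norm
  have ivt : ∀ q, a ≤ q → 1 / 4 < ‖Dg γ γ q - Dg γ γ a‖ →
      ∃ z ∈ Icc a q, ‖Dg γ γ z - Dg γ γ a‖ = 1 / 4 := by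
    intro q hq h
    have := intermediate_value_Icc hq cτ.continuousOn
    exact this ⟨by simp, h.le⟩
  set S := Icc a b ∩ {z | ‖Dg γ γ z - Dg γ γ a‖ = 1 / 4} with hS
  have hSc : IsCompact S := isCompact_Icc.inter_right (isClosed_eq cτ continuous_const)
  have hSne : S.Nonempty := by
    obtain ⟨z, hz, h⟩ := ivt p hp.1 hcon
    exact ⟨z, ⟨hz.1, hz.2.trans hp.2⟩, h⟩
  obtain ⟨p0, ⟨hp0, hp0e⟩, hmin⟩ := hSc.exists_isLeast hSne
  have hlt : a < p0 := by
    rcases hp0.1.lt_or_eq with h | h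
    · exact h
    · rw [← h] at hp0e; simp at hp0e
  have hle : ∀ q ∈ Icc a p0, ‖Dg γ γ q - Dg γ γ a‖ ≤ 1 / 4 := by
    intro q hq
    by_contra h
    push Not at h
    obtain ⟨z, hz, hze⟩ := ivt q hq.1 h
    have h1 := hmin (show z ∈ S from ⟨⟨hz.1, hz.2.trans (hq.2.trans hp0.2)⟩, hze⟩)
    have h2 : q = p0 := le_antisymm hq.2 (h1.trans hz.2)
    rw [h2] at h
    exact h.ne' hp0e
  have hosc : Osc γ a p0 := by
    intro q hq r hr
    calc ‖Dg γ γ q - Dg γ γ r‖ = ‖(Dg γ γ q - Dg γ γ a) - (Dg γ γ r - Dg γ γ a)‖ := by congr 1; abel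
      _ ≤ _ := norm_sub_le _ _
      _ ≤ 1 / 2 := by linarith [hle q hq, hle r hr]
  have hp1 : p0 ≤ a + 1 := hp0.2.trans hb
  have h1 := loc_tau (s := s) (by linarith) hI hp1 hosc
  have h2 := (morrey_w hα0 hI.cw hI.pw (hI.cDg hI.cd) hlt hB0 (by
    rw [show 2 * α + 2 = 2 * s - 1 by rw [hα]; ring]
    refine h1.trans ?_
    calc ENNReal.ofReal 16 * EtpE s γ ≤ ENNReal.ofReal 16 * ENNReal.ofReal M := by gcongr
      _ = ENNReal.ofReal (B ^ 2) := by
        rw [← ENNReal.ofReal_mul (by norm_num), hB, mul_pow, Real.sq_sqrt hM.le]; norm_num)).2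
  rw [hp0e] at h2
  have h3 : (∫ t in a..p0, ‖deriv γ t‖) ^ α ≤ 1 / (16 * morC α * B) := by
    have h4 : ∫ t in a..p0, ‖deriv γ t‖ ≤ (1 / (16 * morC α * B)) ^ (1 / α) :=
      (wint_mono hI.cw hI.pw le_rfl hlt.le hp0.2).trans hr
    calc _ ≤ ((1 / (16 * morC α * B)) ^ (1 / α)) ^ α :=
          Real.rpow_le_rpow (wint_nonneg hI.pw hlt.le) h4 hα0.le
      _ = _ := by
        rw [← Real.rpow_mul (by positivity), one_div_mul_cancel hα0.ne', Real.rpow_one]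
  have h5 : 2 * morC α * B * (∫ t in a..p0, ‖deriv γ t‖) ^ α ≤ 2 * morC α * B * (1 / (16 * morC α * B)) := by
    gcongr
  have h6 : 2 * morC α * B * (1 / (16 * morC α * B)) = 1 / 8 := by field_simp; norm_num
  linarith

/-- the radius property -/
def Rad (γ : ℝ → En n) (r0 : ℝ) : Prop :=
  ∀ a b : ℝ, b ≤ a + 1 → ∫ t in a..b, ‖deriv γ t‖ ≤ r0 → ∀ p ∈ Icc a b, ‖Dg γ γ p - Dg γ γ a‖ ≤ 1 / 4

lemma Rad.osc {γ : ℝ → En n} {r0 : ℝ} (h : Rad γ r0) {a b : ℝ} (hb : b ≤ a + 1)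
    (hr : ∫ t in a..b, ‖deriv γ t‖ ≤ r0) : Osc γ a b := by
  intro q hq r hr'
  have hle := h a b hb hr
  calc ‖Dg γ γ q - Dg γ γ r‖ = ‖(Dg γ γ q - Dg γ γ a) - (Dg γ γ r - Dg γ γ a)‖ := by congr 1; abel
    _ ≤ _ := norm_sub_le _ _
    _ ≤ 1 / 2 := by linarith [hle q hq, hle r hr']

lemma Rad.len {γ : ℝ → En n} (hI : Imm γ) {r0 : ℝ} (h : Rad γ r0) (a : ℝ) :
    r0 < ∫ t in a..(a + 1), ‖deriv γ t‖ := by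
  by_contra hc
  push Not at hc
  have h1 := cone hI (h.osc le_rfl hc) (c := a) ⟨le_rfl, by linarith⟩ le_rfl (by linarith : a ≤ a + 1) le_rfl
  rw [hI.per a, sub_self, inner_zero_right] at h1
  have := wint_pos hI.cw hI.pw (by linarith : a < a + 1)
  linarith

lemma S2 {s : ℝ} (hs : 3 / 2 < s) (r0 : ℝ) (hr : 0 < r0) : ∃ C > 0, ∀ (n : ℕ) (γ u : ℝ → En n), Imm γ →
    Rad γ r0 → ContDiff ℝ 1 u → Function.Periodic u 1 → ∀ g > 0, GE s γ u ≤ ENNReal.ofReal (g ^ 2) →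
      ∀ x, ‖Dg γ u x‖ ≤ C * g := by
  set α := s - 3 / 2 with hα
  have hα0 : 0 < α := by linarith
  have hm := morC_pos hα0
  refine ⟨3 * morC α * r0 ^ α + (1 + 1 / r0) / 2, by positivity, ?_⟩
  intro n γ u hI hR hu hup g hg hG x
  obtain ⟨b, hb, hbe⟩ := exists_wint hI.cw (by linarith : x ≤ x + 1) (v := r0) ⟨hr.le, (hR.len hI x).le⟩
  have hxb : x < b := by
    rcases hb.1.lt_or_eq with h | h
    · exact h
    · rw [← h] at hbe; simp at hbe; exact absurd hbe hr.ne
  have hosc := hR.osc hb.2 hbe.le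
  have h1 := loc_W (s := s) (by linarith) hI hu hup hb.2 hosc
  have h2 := (morrey_w hα0 hI.cw hI.pw (hI.cDg hu) hxb (B := 3 * g) (by positivity) (by
    rw [show 2 * α + 2 = 2 * s - 1 by rw [hα]; ring]
    refine h1.trans ?_
    calc ENNReal.ofReal 8 * GE s γ u ≤ ENNReal.ofReal 8 * ENNReal.ofReal (g ^ 2) := by gcongr
      _ ≤ ENNReal.ofReal ((3 * g) ^ 2) := by
        rw [← ENNReal.ofReal_mul (by norm_num)]
        apply ENNReal.ofReal_le_ofReal; nlinarith)).1
  rw [hbe] at h2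
  have cW := hI.cDg hu
  have h3 : ∫⁻ y in Ico x b, ENNReal.ofReal (‖Dg γ u y‖ ^ 2 * ‖deriv γ y‖) ≤ ENNReal.ofReal (g ^ 2) := by
    calc _ ≤ ∫⁻ y in Ico x (x + 1), ENNReal.ofReal (‖Dg γ u y‖ ^ 2 * ‖deriv γ y‖) :=
          lintegral_mono_set (Ico_subset_Ico_right hb.2)
      _ = h1E γ u := lint_per _ (fun z => by rw [Dg_per hI.per hup, deriv_per hI.per]) x
      _ ≤ GE s γ u := by
        unfold GE; rw [add_assoc _ (h1E γ u), add_comm (h1E γ u), ← add_assoc]; exact le_add_self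
      _ ≤ _ := hG
  have h4 : ENNReal.ofReal (‖Dg γ u x‖ * r0) ≤ ENNReal.ofReal (r0 * (morC α * (3 * g) * r0 ^ α)) +
      ENNReal.ofReal (g / 2 * r0) + ENNReal.ofReal (1 / (2 * g) * g ^ 2) := by
    calc ENNReal.ofReal (‖Dg γ u x‖ * r0) = ∫⁻ y in Ico x b, ENNReal.ofReal (‖Dg γ u x‖ * ‖deriv γ y‖) := by
          simp_rw [ENNReal.ofReal_mul (norm_nonneg (Dg γ u x))]
          rw [lintegral_const_mul' _ _ ENNReal.ofReal_ne_top, lint_w hI.cw hI.pw hb.1, hbe]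
      _ ≤ ∫⁻ y in Ico x b, (ENNReal.ofReal (‖Dg γ u y - Dg γ u x‖ * ‖deriv γ y‖) +
            ENNReal.ofReal (g / 2 * ‖deriv γ y‖)) +
            ENNReal.ofReal (1 / (2 * g) * (‖Dg γ u y‖ ^ 2 * ‖deriv γ y‖)) := by
          refine lintegral_mono fun y => ?_
          simp only
          rw [← ENNReal.ofReal_add (by positivity) (by positivity),
            ← ENNReal.ofReal_add (by positivity) (by positivity)]
          apply ENNReal.ofReal_le_ofReal
          have e1 : ‖Dg γ u x‖ ≤ ‖Dg γ u y - Dg γ u x‖ + ‖Dg γ u y‖ := by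
            rw [norm_sub_rev]
            have := norm_sub_norm_le (Dg γ u x) (Dg γ u y); linarith
          have e2 : ‖Dg γ u y‖ ≤ g / 2 + 1 / (2 * g) * ‖Dg γ u y‖ ^ 2 := by
            rw [← sub_nonneg]
            have : g / 2 + 1 / (2 * g) * ‖Dg γ u y‖ ^ 2 - ‖Dg γ u y‖ = (g - ‖Dg γ u y‖) ^ 2 / (2 * g) := by
              field_simp; ring
            rw [this]; positivity
          calc _ ≤ (‖Dg γ u y - Dg γ u x‖ + (g / 2 + 1 / (2 * g) * ‖Dg γ u y‖ ^ 2)) * ‖deriv γ y‖ := by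
                gcongr; linarith
            _ = _ := by ring
      _ = (∫⁻ y in Ico x b, ENNReal.ofReal (‖Dg γ u y - Dg γ u x‖ * ‖deriv γ y‖)) +
            (∫⁻ y in Ico x b, ENNReal.ofReal (g / 2 * ‖deriv γ y‖)) +
            ∫⁻ y in Ico x b, ENNReal.ofReal (1 / (2 * g) * (‖Dg γ u y‖ ^ 2 * ‖deriv γ y‖)) := by
          have m1 : Measurable fun y => ENNReal.ofReal (‖Dg γ u y - Dg γ u x‖ * ‖deriv γ y‖) :=
            (((cW.sub continuous_const).norm.mul hI.cw).measurable).ennreal_ofReal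
          have m2 : Measurable fun y => ENNReal.ofReal (g / 2 * ‖deriv γ y‖) :=
            ((continuous_const.mul hI.cw).measurable).ennreal_ofReal
          have m12 : Measurable fun y => ENNReal.ofReal (‖Dg γ u y - Dg γ u x‖ * ‖deriv γ y‖) +
            ENNReal.ofReal (g / 2 * ‖deriv γ y‖) := m1.add m2
          rw [lintegral_add_left m12, lintegral_add_left m1]
      _ ≤ _ := by
          refine add_le_add (add_le_add h2 ?_) ?_
          · simp_rw [ENNReal.ofReal_mul (by positivity : 0 ≤ g / 2)]
            rw [lintegral_const_mul' _ _ ENNReal.ofReal_ne_top, lint_w hI.cw hI.pw hb.1, hbe]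
          · have hg2 : 0 ≤ 1 / (2 * g) := by positivity
            simp_rw [ENNReal.ofReal_mul hg2]
            rw [lintegral_const_mul' _ _ ENNReal.ofReal_ne_top]
            gcongr
  rw [← ENNReal.ofReal_add (by positivity) (by positivity),
    ← ENNReal.ofReal_add (by positivity) (by positivity),
    ENNReal.ofReal_le_ofReal_iff (by positivity)] at h4
  have h5 : ‖Dg γ u x‖ * r0 ≤ (3 * morC α * r0 ^ α + (1 + 1 / r0) / 2) * g * r0 := by
    refine h4.trans (le_of_eq ?_)
    field_simp; ring
  exact le_of_mul_le_mul_right h5 hr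
end loc

section bilip
variable {n : ℕ}

lemma cd_lip {u : ℝ → En n} (hu : ContDiff ℝ 1 u) {K : ℝ} (hK : ∀ x, ‖deriv u x‖ ≤ K) (x y : ℝ) :
    ‖u y - u x‖ ≤ K * |y - x| := by
  rw [← cd_ftc hu]
  exact intervalIntegral.norm_integral_le_of_norm_le_const fun t _ => hK t

lemma per_I01 {E : Type*} {u : ℝ → E} (hu : Function.Periodic u 1) (x : ℝ) : ∃ z ∈ I01, u x = u z := by
  obtain ⟨z, hz, h⟩ := hu.exists_mem_Ico₀ one_pos x
  exact ⟨z, hz, h⟩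

lemma sup_u {s : ℝ} {γ u : ℝ → En n} (hI : Imm γ) (hu : ContDiff ℝ 1 u) (hup : Function.Periodic u 1)
    {c0 C0 C g : ℝ} (hc0 : 0 < c0) (hc : ∀ x, c0 ≤ ‖deriv γ x‖) (hC : ∀ x, ‖deriv γ x‖ ≤ C0)
    (hC1 : 0 < C) (hg : 0 < g) (hG : GE s γ u ≤ ENNReal.ofReal (g ^ 2)) (hW : ∀ x, ‖Dg γ u x‖ ≤ C * g) (x : ℝ) :
    ‖u x‖ ≤ (1 / 2 + 1 / (2 * c0) + C * C0) * g := by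
  have hC0 : 0 < C0 := hc0.trans_le ((hc 0).trans (hC 0))
  have hu' : ∀ x, ‖deriv u x‖ ≤ C * g * C0 := fun x => by
    rw [← norm_Dg_mul (hI.ne x)]; gcongr
    · exact hW x
    · exact hC x
  obtain ⟨z, hz, hxz⟩ := per_I01 hup x
  rw [hxz]
  have hl2 : ∫⁻ y in I01, ENNReal.ofReal (‖u y‖ ^ 2 * c0) ≤ ENNReal.ofReal (g ^ 2) := by
    calc _ ≤ l2E γ u := by
          refine lintegral_mono fun y => ENNReal.ofReal_le_ofReal ?_
          gcongr; exact hc y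
      _ ≤ GE s γ u := by unfold GE; exact le_add_self
      _ ≤ _ := hG
  have h1 : ENNReal.ofReal ‖u z‖ ≤ ENNReal.ofReal ((1 / 2 + C * C0) * g) +
      ENNReal.ofReal (1 / (2 * g * c0) * g ^ 2) := by
    calc ENNReal.ofReal ‖u z‖ = ∫⁻ y in I01, ENNReal.ofReal ‖u z‖ := by simp [I01]
      _ ≤ ∫⁻ y in I01, (ENNReal.ofReal ((1 / 2 + C * C0) * g) +
          ENNReal.ofReal (1 / (2 * g * c0)) * ENNReal.ofReal (‖u y‖ ^ 2 * c0)) := by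
        refine setLIntegral_mono' measurableSet_Ico fun y hy => ?_
        rw [← ENNReal.ofReal_mul (by positivity), ← ENNReal.ofReal_add (by positivity) (by positivity)]
        apply ENNReal.ofReal_le_ofReal
        have e1 := cd_lip hu hu' y z
        have e2 : |z - y| ≤ 1 := by
          rw [abs_le]; constructor <;> linarith [hz.1, hz.2, hy.1, hy.2]
        have e3 : ‖u z - u y‖ ≤ C * g * C0 * 1 := e1.trans (by gcongr)
        have e4 := norm_sub_norm_le (u z) (u y)
        have e5 : ‖u y‖ ≤ g / 2 + 1 / (2 * g * c0) * (‖u y‖ ^ 2 * c0) := by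
          rw [← sub_nonneg]
          have : g / 2 + 1 / (2 * g * c0) * (‖u y‖ ^ 2 * c0) - ‖u y‖ = (g - ‖u y‖) ^ 2 / (2 * g) := by
            field_simp; ring
          rw [this]; positivity
        linarith
      _ = ENNReal.ofReal ((1 / 2 + C * C0) * g) +
          ENNReal.ofReal (1 / (2 * g * c0)) * ∫⁻ y in I01, ENNReal.ofReal (‖u y‖ ^ 2 * c0) := by
        rw [lintegral_add_left measurable_const, lintegral_const_mul' _ _ ENNReal.ofReal_ne_top]
        simp [I01]
      _ ≤ _ := by
        rw [ENNReal.ofReal_mul (p := 1 / (2 * g * c0)) (by positivity)]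
        gcongr
  rw [← ENNReal.ofReal_add (by positivity) (by positivity), ENNReal.ofReal_le_ofReal_iff (by positivity)] at h1
  refine h1.trans (le_of_eq ?_)
  field_simp; ring

lemma loc_lower {γ : ℝ → En n} (hI : Imm γ) {r0 c0 C0 h0 : ℝ} (hR : Rad γ r0)
    (hc0 : 0 < c0) (hc : ∀ x, c0 ≤ ‖deriv γ x‖) (hC : ∀ x, ‖deriv γ x‖ ≤ C0)
    (hh : h0 ≤ 1) (hr : C0 * h0 ≤ r0) {x y : ℝ} (h : |y - x| ≤ h0) :
    Osc γ (min x y) (max x y) ∧ 1 / 2 * c0 * |y - x| ≤ ‖γ y - γ x‖ := by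
  have up : ∀ a b : ℝ, a ≤ b → ∫ t in a..b, ‖deriv γ t‖ ≤ C0 * (b - a) := fun a b hab => by
    have := intervalIntegral.integral_mono_on hab (hI.cw.intervalIntegrable a b)
      (continuous_const.intervalIntegrable (μ := volume) (u := fun _ => C0) a b) (fun t _ => hC t)
    simpa [mul_comm] using this
  have lo : ∀ a b : ℝ, a ≤ b → c0 * (b - a) ≤ ∫ t in a..b, ‖deriv γ t‖ := fun a b hab => by
    have := intervalIntegral.integral_mono_on hab 
      (continuous_const.intervalIntegrable (μ := volume) (u := fun _ => c0) a b)
      (hI.cw.intervalIntegrable a b) (fun t _ => hc t)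
    simpa [mul_comm] using this
  have hC0 : 0 ≤ C0 := hc0.le.trans ((hc 0).trans (hC 0))
  have e : max x y - min x y = |y - x| := by rw [max_sub_min_eq_abs]
  have osc : Osc γ (min x y) (max x y) := by
    apply hR.osc
    · linarith
    · refine (up _ _ min_le_max).trans (le_trans ?_ hr)
      rw [e]; gcongr
  refine ⟨osc, ?_⟩
  have h1 := cone_D hI osc (x := x) (y := y) ⟨min_le_left _ _, le_max_left _ _⟩ ⟨min_le_right _ _, le_max_right _ _⟩
  have h2 : c0 * |y - x| ≤ |∫ t in x..y, ‖deriv γ t‖| := by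
    rcases le_total x y with hxy | hxy
    · rw [abs_of_nonneg (by linarith : 0 ≤ y - x)]
      exact (lo x y hxy).trans (le_abs_self _)
    · rw [intervalIntegral.integral_symm, abs_neg, abs_sub_comm, abs_of_nonneg (by linarith : 0 ≤ x - y)]
      exact (lo y x hxy).trans (le_abs_self _)
  have : 0 ≤ c0 * |y - x| := by positivity
  linarith

/-- nonlocal part: a minimal pair with small distance costs energy -/
lemma nonloc {s : ℝ} (hs : 3 / 2 < s) {γ : ℝ → En n} (hI : Imm γ) {r0 c0 C0 δ : ℝ} (hR : Rad γ r0)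
    (hc0 : 0 < c0) (hc : ∀ x, c0 ≤ ‖deriv γ x‖) (hC : ∀ x, ‖deriv γ x‖ ≤ C0) {x y : ℝ}
    (hδ : 0 < δ) (hδr : δ ≤ r0) (hδC : δ ≤ C0) (hd : ‖γ y - γ x‖ = δ) (hperp : ⟪Dg γ γ x, γ y - γ x⟫ = 0) :
    ENNReal.ofReal (c0 ^ 2 / (2 ^ (2 * s + 1) * 4096 * C0 ^ 2) * δ ^ (3 - 2 * s)) ≤ EtpE s γ := by
  have hC0 : 0 < C0 := hc0.trans_le ((hc 0).trans (hC 0))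
  set η := δ / (16 * C0) with hη
  have hη0 : 0 < η := by positivity
  have hη1 : η ≤ 1 := by rw [hη, div_le_one (by positivity)]; linarith
  have hCη : C0 * η = δ / 16 := by rw [hη]; field_simp
  refine le_trans ?_ (lint2_sub_le (fun x y => ENNReal.ofReal (b1 s γ γ x y))
    (fun x y => by rw [b1_perx hI.per hI.per]) (fun x y => by rw [b1_pery hI.per hI.per])
    (A := Ico x (x + η)) (B := Ico y (y + η)) (a := x) (b := y)
    (Ico_subset_Ico_right (by linarith)) (Ico_subset_Ico_right (by linarith)))
  have pt : ∀ p ∈ Ico x (x + η), ∀ q ∈ Ico y (y + η),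
      δ ^ 2 / 16 / (2 * δ) ^ (2 * s + 1) * c0 ^ 2 ≤ b1 s γ γ p q := by
    intro p hp q hq
    have l1 : ‖γ p - γ x‖ ≤ δ / 16 := by
      rw [← hCη]; refine (cd_lip hI.cd hC x p).trans ?_
      gcongr; rw [abs_of_nonneg] <;> linarith [hp.1, hp.2]
    have l2 : ‖γ q - γ y‖ ≤ δ / 16 := by
      rw [← hCη]; refine (cd_lip hI.cd hC y q).trans ?_
      gcongr; rw [abs_of_nonneg] <;> linarith [hq.1, hq.2]
    have l3 : ‖(γ q - γ p) - (γ y - γ x)‖ ≤ δ / 8 := by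
      calc _ = ‖(γ q - γ y) - (γ p - γ x)‖ := by congr 1; abel
        _ ≤ _ := norm_sub_le _ _
        _ ≤ _ := by linarith
    have l4 : ‖Dg γ γ p - Dg γ γ x‖ ≤ 1 / 4 := by
      refine hR x p (by linarith [hp.2]) ?_ p ⟨hp.1, le_rfl⟩
      have := intervalIntegral.integral_mono_on hp.1 (hI.cw.intervalIntegrable x p)
        (continuous_const.intervalIntegrable (μ := volume) (u := fun _ => C0) x p) (fun t _ => hC t)
      rw [intervalIntegral.integral_const, smul_eq_mul] at this
      nlinarith [hp.2]
    have l5 : ‖γ q - γ p‖ ≤ 9 / 8 * δ := by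
      have := norm_sub_norm_le (γ q - γ p) (γ y - γ x); linarith
    have l6 : 7 / 8 * δ ≤ ‖γ q - γ p‖ := by
      have := norm_sub_norm_le (γ y - γ x) (γ q - γ p); rw [norm_sub_rev (γ y - γ x) (γ q - γ p)] at this; linarith
    have l7 : |⟪Dg γ γ p, γ q - γ p⟫| ≤ 13 / 32 * δ := by
      have e : ⟪Dg γ γ p, γ q - γ p⟫ = ⟪Dg γ γ p - Dg γ γ x, γ q - γ p⟫ +
          ⟪Dg γ γ x, (γ q - γ p) - (γ y - γ x)⟫ := by
        rw [inner_sub_left, inner_sub_right (Dg γ γ x) _ (γ y - γ x), hperp]; ring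
      rw [e]
      refine (abs_add_le _ _).trans ?_
      have a1 := abs_real_inner_le_norm (Dg γ γ p - Dg γ γ x) (γ q - γ p)
      have a2 := inner_le_D (hI.ne x) ((γ q - γ p) - (γ y - γ x))
      have a3 : ‖Dg γ γ p - Dg γ γ x‖ * ‖γ q - γ p‖ ≤ 1 / 4 * (9 / 8 * δ) := by gcongr
      linarith
    have l8 : δ / 4 ≤ ‖Nop γ γ p q‖ := by
      have := Nop_aux (hI.ne p) (y := q); linarith
    have hD : 0 < ‖γ q - γ p‖ := lt_of_lt_of_le (by positivity) l6
    have e : b1 s γ γ p q = ‖Nop γ γ p q‖ ^ 2 / ‖γ q - γ p‖ ^ (2 * s + 1) * (‖deriv γ p‖ * ‖deriv γ q‖) := by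
      unfold b1 muW
      rw [Rop_normsq, Real.rpow_add_one hD.ne', mul_comm 2 s, Real.rpow_mul hD.le, Real.rpow_two]
      field_simp
    rw [e]
    have e2 : δ ^ 2 / 16 = (δ / 4) ^ 2 := by ring
    rw [e2, pow_two c0]
    gcongr
    · linarith
    · exact hc p
    · exact hc q
  calc _ = ENNReal.ofReal (δ ^ 2 / 16 / (2 * δ) ^ (2 * s + 1) * c0 ^ 2 * η * η) := by
        congr 1
        have e1 : δ ^ (3 - 2 * s) = δ ^ 4 / δ ^ (2 * s + 1) := by
          rw [← Real.rpow_natCast δ 4, ← Real.rpow_sub hδ]; congr 1; push_cast; ring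
        rw [e1, Real.mul_rpow (by norm_num) hδ.le, hη]
        field_simp; norm_num
    _ = ∫⁻ p in Ico x (x + η), ∫⁻ q in Ico y (y + η),
        ENNReal.ofReal (δ ^ 2 / 16 / (2 * δ) ^ (2 * s + 1) * c0 ^ 2) := by
        simp only [lintegral_const, Measure.restrict_apply MeasurableSet.univ, univ_inter,
          Real.volume_Ico, add_sub_cancel_left]
        rw [← ENNReal.ofReal_mul (by positivity), ← ENNReal.ofReal_mul (by positivity)]
    _ ≤ _ := by
        refine setLIntegral_mono' measurableSet_Ico fun p hp => ?_
        refine setLIntegral_mono' measurableSet_Ico fun q hq => ?_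
        exact ENNReal.ofReal_le_ofReal (pt p hp q hq)

lemma S3 {s : ℝ} (hs : 3 / 2 < s) (r0 c0 C0 M : ℝ) (hr : 0 < r0) (hc0 : 0 < c0) (hC0 : 0 < C0) (hM : 0 < M) :
    ∃ κ > 0, ∀ (n : ℕ) (γ : ℝ → En n), Imm γ → InjOn γ I01 → Rad γ r0 → EtpE s γ ≤ ENNReal.ofReal M →
      (∀ x, c0 ≤ ‖deriv γ x‖) → (∀ x, ‖deriv γ x‖ ≤ C0) →
      ∀ x h, |h| ≤ 1 / 2 → κ * |h| ≤ ‖γ (x + h) - γ x‖ := by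
  set h0 := min (1 / 4) (r0 / C0) with hh0
  have h00 : 0 < h0 := by positivity
  have h04 : h0 ≤ 1 / 4 := min_le_left _ _
  have h0r : C0 * h0 ≤ r0 := by
    calc C0 * h0 ≤ C0 * (r0 / C0) := by gcongr; exact min_le_right _ _
      _ = r0 := by field_simp
  set K := c0 ^ 2 / (2 ^ (2 * s + 1) * 4096 * C0 ^ 2) with hK
  have hK0 : 0 < K := by positivity
  set δ1 := (K / (M + 1)) ^ (1 / (2 * s - 3)) with hδ1
  have hδ10 : 0 < δ1 := by positivity
  set δ0 := min (1 / 2 * c0 * h0) (min (min r0 C0) δ1) with hδ0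
  have hδ00 : 0 < δ0 := by positivity
  refine ⟨min (1 / 2 * c0) δ0, by positivity, ?_⟩
  intro n γ hI hinj hR hE hc hC
  have loc : ∀ x h, |h| ≤ h0 → 1 / 2 * c0 * |h| ≤ ‖γ (x + h) - γ x‖ := by
    intro x h hh
    have := (loc_lower hI hR hc0 hc hC (by linarith : h0 ≤ 1) h0r (x := x) (y := x + h) (by simpa using hh)).2
    simpa using this
  have cγ := hI.cd.continuous
  have main : ∀ x, ∀ h ∈ Icc h0 (1 - h0), δ0 ≤ ‖γ (x + h) - γ x‖ := by
    have hcomp : IsCompact (Icc (0:ℝ) 1 ×ˢ Icc h0 (1 - h0)) := isCompact_Icc.prod isCompact_Icc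
    obtain ⟨⟨x0, k⟩, hmem, hmin⟩ := hcomp.exists_isMinOn ⟨(0, h0), ⟨by simp, by simp; linarith⟩⟩
      (f := fun p : ℝ × ℝ => ‖γ (p.1 + p.2) - γ p.1‖) (by fun_prop)
    have hx0 : x0 ∈ Icc (0:ℝ) 1 := hmem.1
    have hk : k ∈ Icc h0 (1 - h0) := hmem.2
    have hmin' : ∀ x, ∀ h ∈ Icc h0 (1 - h0), ‖γ (x0 + k) - γ x0‖ ≤ ‖γ (x + h) - γ x‖ := by
      intro x h hh
      have hp : Function.Periodic (fun z => ‖γ (z + h) - γ z‖) 1 := fun z => by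
        simp only; rw [hI.per z, add_right_comm, hI.per]
      obtain ⟨z, hz, he⟩ := per_I01 hp x
      have hm := isMinOn_iff.1 hmin (z, h) (mk_mem_prod (Ico_subset_Icc_self hz) hh)
      exact hm.trans_eq he.symm
    intro x h hh
    refine le_trans ?_ (hmin' x h hh)
    by_contra hlt
    push Not at hlt
    set δ := ‖γ (x0 + k) - γ x0‖ with hδ
    have hpos : 0 < δ := by
      rw [hδ, norm_pos_iff, sub_ne_zero]
      intro heq
      have hf1 : γ (Int.fract x0) = γ x0 := by
        have := hI.per.sub_zsmul_eq ⌊x0⌋ (x := x0)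
        rw [zsmul_eq_mul, mul_one] at this; exact this
      have hf2 : γ (Int.fract (x0 + k)) = γ (x0 + k) := by
        have := hI.per.sub_zsmul_eq ⌊x0 + k⌋ (x := x0 + k)
        rw [zsmul_eq_mul, mul_one] at this; exact this
      have := hinj ⟨Int.fract_nonneg x0, Int.fract_lt_one x0⟩
        ⟨Int.fract_nonneg (x0 + k), Int.fract_lt_one (x0 + k)⟩ (by rw [hf1, hf2, heq])
      rw [Int.fract_eq_fract] at this
      obtain ⟨m, hm⟩ := this
      have h1 : (0:ℝ) < -m := by linarith [hk.1]
      have h2 : -(m:ℝ) < 1 := by linarith [hk.2]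
      have h3 : 0 < -m := by exact_mod_cast h1
      have h4 : -m < 1 := by exact_mod_cast h2
      omega
    have d1 : δ < 1 / 2 * c0 * h0 := hlt.trans_le (min_le_left _ _)
    have d2 : δ < min r0 C0 := hlt.trans_le ((min_le_right _ _).trans (min_le_left _ _))
    have d3 : δ < δ1 := hlt.trans_le ((min_le_right _ _).trans (min_le_right _ _))
    have k1 : h0 < k := by
      rcases hk.1.lt_or_eq with h | h
      · exact h
      · have := loc x0 k (by rw [← h, abs_of_pos h00])
        rw [← h, abs_of_pos h00] at this
        rw [hδ, ← h] at d1; linarith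
    have k2 : k < 1 - h0 := by
      rcases hk.2.lt_or_eq with h | h
      · exact h
      · have := loc (x0 + 1) (-h0) (by rw [abs_neg, abs_of_pos h00])
        rw [abs_neg, abs_of_pos h00, hI.per, show x0 + 1 + -h0 = x0 + k by rw [h]; ring] at this
        linarith
    have hperp0 : ⟪deriv γ x0, γ (x0 + k) - γ x0⟫ = 0 := by
      have hmin2 : IsLocalMin (fun z => ‖γ (x0 + k) - γ z‖ ^ 2) x0 := by
        have : ∀ᶠ z in 𝓝 x0, x0 + k - z ∈ Icc h0 (1 - h0) := by
          have hc : Tendsto (fun z => x0 + k - z) (𝓝 x0) (𝓝 k) := by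
            have : Continuous fun z : ℝ => x0 + k - z := by fun_prop
            simpa using this.tendsto x0
          exact hc (Icc_mem_nhds k1 k2)
        filter_upwards [this] with z hz
        have := hmin' z _ hz
        rw [add_sub_cancel] at this
        exact pow_le_pow_left₀ (norm_nonneg _) this 2
      have hd : HasDerivAt (fun z => ‖γ (x0 + k) - γ z‖ ^ 2) (2 * ⟪γ (x0 + k) - γ x0, -deriv γ x0⟫) x0 := by
        have := ((hasDerivAt_const x0 (γ (x0 + k))).sub (cd_hd hI.cd x0)).norm_sq
        simpa using this
      have := hmin2.hasDerivAt_eq_zero hd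
      rw [inner_neg_right, real_inner_comm] at this
      linarith
    have hperp : ⟪Dg γ γ x0, γ (x0 + k) - γ x0⟫ = 0 := by
      unfold Dg; rw [real_inner_smul_left, hperp0, mul_zero]
    have hen := nonloc hs hI hR hc0 hc hC (x := x0) (y := x0 + k) hpos (d2.le.trans (min_le_left _ _))
      (d2.le.trans (min_le_right _ _)) hδ.symm hperp
    have := hen.trans hE
    rw [ENNReal.ofReal_le_ofReal_iff hM.le] at this
    have h3 : 0 < 2 * s - 3 := by linarith
    have h4 : δ ^ (2 * s - 3) < K / (M + 1) := by
      calc δ ^ (2 * s - 3) < δ1 ^ (2 * s - 3) := Real.rpow_lt_rpow hpos.le d3 h3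
        _ = _ := by rw [hδ1, ← Real.rpow_mul (by positivity), one_div_mul_cancel h3.ne', Real.rpow_one]
    have h5 : δ ^ (3 - 2 * s) = (δ ^ (2 * s - 3))⁻¹ := by
      rw [← Real.rpow_neg hpos.le]; congr 1; ring
    rw [h5] at this
    have h6 : 0 < δ ^ (2 * s - 3) := by positivity
    rw [lt_div_iff₀ (by positivity)] at h4
    rw [← div_eq_mul_inv, div_le_iff₀ h6] at this
    nlinarith
  intro x h hh
  rcases le_or_gt |h| h0 with hl | hl
  · refine le_trans ?_ (loc x h hl)
    gcongr; exact min_le_left _ _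
  · have key : δ0 ≤ ‖γ (x + h) - γ x‖ := by
      rcases le_total 0 h with hp | hp
      · rw [abs_of_nonneg hp] at hl hh
        exact main x h ⟨hl.le, by linarith⟩
      · rw [abs_of_nonpos hp] at hl hh
        have := main (x + h) (-h) ⟨hl.le, by linarith⟩
        rwa [add_neg_cancel_right, norm_sub_rev] at this
    calc min (1 / 2 * c0) δ0 * |h| ≤ δ0 * 1 := by
          gcongr
          · exact min_le_right _ _
          · linarith
      _ ≤ _ := by linarith
end bilip

section fin
variable {n : ℕ}

lemma cs_lint {α : Type*} [MeasurableSpace α] {μ : Measure α} {f g : α → ℝ≥0∞} (hf : AEMeasurable f μ)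
    (hg : AEMeasurable g μ) : (∫⁻ a, f a * g a ∂μ) ^ 2 ≤ (∫⁻ a, f a ^ 2 ∂μ) * ∫⁻ a, g a ^ 2 ∂μ := by
  have h := ENNReal.lintegral_mul_le_Lp_mul_Lq μ Real.HolderConjugate.two_two hf hg
  simp only [Pi.mul_apply, ENNReal.rpow_two] at h
  refine (pow_le_pow_left' h 2).trans (le_of_eq ?_)
  rw [mul_pow, ← ENNReal.rpow_two, ← ENNReal.rpow_two, ← ENNReal.rpow_mul, ← ENNReal.rpow_mul]
  norm_num

lemma jensen01 {ψ : ℝ → ℝ} (h : Continuous ψ) : (∫ t in (0:ℝ)..1, ψ t) ^ 2 ≤ ∫ t in (0:ℝ)..1, ψ t ^ 2 := by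
  set m := ∫ t in (0:ℝ)..1, ψ t with hm
  have h1 : 0 ≤ ∫ t in (0:ℝ)..1, (ψ t - m) ^ 2 :=
    intervalIntegral.integral_nonneg (by norm_num) fun t _ => sq_nonneg _
  have h2 : ∫ t in (0:ℝ)..1, (ψ t - m) ^ 2 = (∫ t in (0:ℝ)..1, ψ t ^ 2) - m ^ 2 := by
    have e : ∀ t, (ψ t - m) ^ 2 = ψ t ^ 2 - 2 * m * ψ t + m ^ 2 := fun t => by ring
    simp_rw [e]
    rw [intervalIntegral.integral_add, intervalIntegral.integral_sub, intervalIntegral.integral_const_mul,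
      intervalIntegral.integral_const, ← hm]
    · simp; ring
    · exact (h.pow 2).intervalIntegrable _ _
    · exact (h.const_mul _).intervalIntegrable _ _
    · exact ((h.pow 2).sub (h.const_mul _)).intervalIntegrable _ _
    · exact continuous_const.intervalIntegrable _ _
  linarith

lemma ofReal_int01 {ψ : ℝ → ℝ} (h : Continuous ψ) (h0 : ∀ t, 0 ≤ ψ t) :
    ENNReal.ofReal (∫ t in (0:ℝ)..1, ψ t) = ∫⁻ t in I01, ENNReal.ofReal (ψ t) := by
  rw [intervalIntegral.integral_of_le (by norm_num), I01, setLIntegral_congr Ico_ae_eq_Ioc,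
    ofReal_integral_eq_lintegral_ofReal]
  · exact (h.integrableOn_Icc (a := 0) (b := 1)).mono_set Ioc_subset_Icc_self
  · exact ae_of_all _ fun x => h0 x

lemma scale_lint (G : ℝ → ℝ≥0∞) (hG : Measurable G) {θ : ℝ} (h0 : 0 < θ) (h1 : θ ≤ 1) :
    ∫⁻ h in Ico (-1/2 : ℝ) (1/2), G (θ * h) ≤ ENNReal.ofReal (1 / θ) * ∫⁻ h in Ico (-1/2 : ℝ) (1/2), G h := by
  set S := Ico (-1/2 : ℝ) (1/2)
  have hS : MeasurableSet S := measurableSet_Ico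
  calc ∫⁻ h in S, G (θ * h) ≤ ∫⁻ h, S.indicator G (θ * h) := by
        rw [← lintegral_indicator hS]
        refine lintegral_mono fun h => ?_
        by_cases hh : h ∈ S
        · have : θ * h ∈ S := by
            constructor
            · nlinarith [hh.1]
            · nlinarith [hh.2]
          simp [hh, this]
        · simp [hh]
    _ = ∫⁻ k, S.indicator G k ∂(Measure.map (fun h => θ * h) volume) := by
        rw [lintegral_map (hG.indicator hS) (by fun_prop)]
    _ = ENNReal.ofReal (1 / θ) * ∫⁻ h, S.indicator G h := by
        rw [Real.map_volume_mul_left h0.ne', lintegral_smul_measure, abs_of_pos (by positivity), one_div]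
        rfl
    _ = _ := by rw [lintegral_indicator hS]

lemma gag_shift {v : ℝ → En n} (hv : Function.Periodic v 1) (s : ℝ) :
    gagliardoSqE (s - 1) v = ∫⁻ x in I01, ∫⁻ h in Ico (-1/2 : ℝ) (1/2),
      ENNReal.ofReal (‖v (x + h) - v x‖ ^ 2 / |h| ^ (2 * s - 1)) := by
  unfold gagliardoSqE
  rw [lint2_shift (fun x y => ENNReal.ofReal (‖v y - v x‖ ^ 2 / dT x y ^ (2 * (s - 1) + 1)))
    (fun x y => by rw [hv, dT_add_right])]
  refine lintegral_congr fun x => ?_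
  refine setLIntegral_congr_fun measurableSet_Ico fun h hh => ?_
  rw [dT_of_le, show 2 * (s - 1) + 1 = 2 * s - 1 by ring]
  · rw [show x - (x + h) = -h by ring, abs_neg]
  · rw [show x - (x + h) = -h by ring, abs_neg, abs_le]; constructor <;> linarith [hh.1, hh.2]

lemma taylor_sq {v : ℝ → En n} (hv : ContDiff ℝ 1 v) (x h : ℝ) :
    ‖v (x + h) - v x - h • deriv v x‖ ^ 2 ≤
      h ^ 2 * ∫ θ in (0:ℝ)..1, ‖deriv v (x + θ * h) - deriv v x‖ ^ 2 := by
  have cd := hv.continuous_deriv le_rfl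
  have cψ : Continuous fun θ : ℝ => deriv v (x + θ * h) - deriv v x := by fun_prop
  have e : ∫ θ in (0:ℝ)..1, h • (deriv v (x + θ * h) - deriv v x) = v (x + h) - v x - h • deriv v x := by
    rw [intervalIntegral.integral_eq_sub_of_hasDerivAt (f := fun θ => v (x + θ * h) - θ • (h • deriv v x))]
    · simp; abel
    · intro θ _
      have h1 : HasDerivAt (fun θ : ℝ => x + θ * h) h θ := by
        simpa using ((hasDerivAt_id θ).mul_const h).const_add x
      have h2 := (cd_hd hv (x + θ * h)).scomp θ h1
      have h3 : HasDerivAt (fun θ : ℝ => θ • (h • deriv v x)) (h • deriv v x) θ := by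
        simpa using (hasDerivAt_id θ).smul_const (h • deriv v x)
      rw [smul_sub]
      exact h2.sub h3
    · exact (cψ.const_smul h).intervalIntegrable _ _
  have h1 : ‖v (x + h) - v x - h • deriv v x‖ ≤ |h| * ∫ θ in (0:ℝ)..1, ‖deriv v (x + θ * h) - deriv v x‖ := by
    rw [← e, intervalIntegral.integral_smul, norm_smul, Real.norm_eq_abs]
    gcongr
    exact intervalIntegral.norm_integral_le_integral_norm (by norm_num)
  calc _ ≤ (|h| * ∫ θ in (0:ℝ)..1, ‖deriv v (x + θ * h) - deriv v x‖) ^ 2 := pow_le_pow_left₀ (norm_nonneg _) h1 2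
    _ = h ^ 2 * (∫ θ in (0:ℝ)..1, ‖deriv v (x + θ * h) - deriv v x‖) ^ 2 := by rw [mul_pow, sq_abs]
    _ ≤ _ := by gcongr; exact jensen01 cψ.norm

lemma hardy {s : ℝ} (hs : 3 / 2 < s) {v : ℝ → En n} (hv : ContDiff ℝ 1 v) (hp : Function.Periodic v 1) :
    ∫⁻ x in I01, ∫⁻ h in Ico (-1/2 : ℝ) (1/2),
      ENNReal.ofReal (‖v (x + h) - v x - h • deriv v x‖ ^ 2 / |h| ^ (2 * s + 1)) ≤
        gagliardoSqE (s - 1) (deriv v) := by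
  have cd := hv.continuous_deriv le_rfl
  set S := Ico (-1/2 : ℝ) (1/2)
  have mF : Measurable fun q : ℝ × ℝ × ℝ =>
      ENNReal.ofReal (‖deriv v (q.1 + q.2.2 * q.2.1) - deriv v q.1‖ ^ 2 / |q.2.1| ^ (2 * s - 1)) := by
    apply Measurable.ennreal_ofReal
    apply Measurable.div
    · exact Continuous.measurable (by fun_prop)
    · exact (Continuous.measurable (by fun_prop : Continuous fun q : ℝ × ℝ × ℝ => |q.2.1|)).pow_const _
  calc _ ≤ ∫⁻ x in I01, ∫⁻ h in S, ∫⁻ θ in I01,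
        ENNReal.ofReal (‖deriv v (x + θ * h) - deriv v x‖ ^ 2 / |h| ^ (2 * s - 1)) := by
        refine lintegral_mono fun x => lintegral_mono fun h => ?_
        simp only
        rcases eq_or_ne h 0 with rfl | hh
        · simp
        have hh' : 0 < |h| := abs_pos.2 hh
        have cψ : Continuous fun θ : ℝ => ‖deriv v (x + θ * h) - deriv v x‖ ^ 2 / |h| ^ (2 * s - 1) := by
          fun_prop
        rw [← ofReal_int01 cψ (fun t => by positivity)]
        apply ENNReal.ofReal_le_ofReal
        rw [intervalIntegral.integral_div]
        have e1 : |h| ^ (2 * s + 1) = |h| ^ (2 * s - 1) * h ^ 2 := by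
          rw [← sq_abs h, ← Real.rpow_two, ← Real.rpow_add hh']; congr 1; ring
        rw [e1, div_le_div_iff₀ (by positivity) (by positivity)]
        have := mul_le_mul_of_nonneg_right (taylor_sq hv x h) (by positivity : 0 ≤ |h| ^ (2 * s - 1))
        refine this.trans (le_of_eq (by ring))
    _ = ∫⁻ x in I01, ∫⁻ θ in I01, ∫⁻ h in S,
        ENNReal.ofReal (‖deriv v (x + θ * h) - deriv v x‖ ^ 2 / |h| ^ (2 * s - 1)) := by
        refine lintegral_congr fun x => ?_
        rw [lintegral_lintegral_swap]
        exact (mF.comp (by fun_prop : Measurable fun p : ℝ × ℝ => (x, p))).aemeasurable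
    _ = ∫⁻ θ in I01, ∫⁻ x in I01, ∫⁻ h in S,
        ENNReal.ofReal (‖deriv v (x + θ * h) - deriv v x‖ ^ 2 / |h| ^ (2 * s - 1)) := by
        have m3 := mF.comp (by fun_prop : Measurable fun r : (ℝ × ℝ) × ℝ => (r.1.1, r.2, r.1.2))
        have m4 := m3.lintegral_prod_right' (ν := volume.restrict S)
        rw [lintegral_lintegral_swap]
        exact m4.aemeasurable
    _ ≤ ∫⁻ θ in I01, gagliardoSqE (s - 1) (deriv v) := by
        refine setLIntegral_mono' measurableSet_Ico fun θ hθ => ?_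
        rw [gag_shift (deriv_per hp)]
        refine lintegral_mono fun x => ?_
        simp only
        rcases hθ.1.lt_or_eq with h0 | h0
        · set G : ℝ → ℝ≥0∞ := fun k => ENNReal.ofReal (‖deriv v (x + k) - deriv v x‖ ^ 2 / |k| ^ (2 * s - 1)) with hG
          have mG : Measurable G := by
            apply Measurable.ennreal_ofReal
            apply Measurable.div
            · exact Continuous.measurable (by fun_prop)
            · exact (Continuous.measurable (by fun_prop : Continuous fun q : ℝ => |q|)).pow_const _
          have e : ∀ h, ENNReal.ofReal (‖deriv v (x + θ * h) - deriv v x‖ ^ 2 / |h| ^ (2 * s - 1)) =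
              ENNReal.ofReal (θ ^ (2 * s - 1)) * G (θ * h) := fun h => by
            rw [hG]; simp only
            rw [← ENNReal.ofReal_mul (by positivity), abs_mul, abs_of_pos h0, Real.mul_rpow h0.le (abs_nonneg _)]
            congr 1
            have : (0:ℝ) < θ ^ (2 * s - 1) := by positivity
            field_simp
          simp_rw [e]
          rw [lintegral_const_mul' _ _ ENNReal.ofReal_ne_top]
          calc _ ≤ ENNReal.ofReal (θ ^ (2 * s - 1)) * (ENNReal.ofReal (1 / θ) * ∫⁻ h in S, G h) := by
                gcongr; exact scale_lint G mG h0 hθ.2.le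
            _ = ENNReal.ofReal (θ ^ (2 * s - 2)) * ∫⁻ h in S, G h := by
                rw [← mul_assoc, ← ENNReal.ofReal_mul (by positivity)]
                congr 2
                rw [show 2 * s - 1 = (2 * s - 2) + 1 by ring, Real.rpow_add_one h0.ne']; field_simp
            _ ≤ 1 * ∫⁻ h in S, G h := by
                gcongr
                rw [ENNReal.ofReal_le_one]
                exact Real.rpow_le_one h0.le hθ.2.le (by linarith)
            _ = _ := one_mul _
        · rw [← h0]; simp
    _ = _ := by simp [I01]
end fin

section fin8
variable {n : ℕ}

lemma b1_form {s : ℝ} {γ u : ℝ → En n} {x y : ℝ} (hD : 0 < ‖γ y - γ x‖) :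
    b1 s γ u x y = ‖Nop γ u x y‖ ^ 2 * (‖deriv γ x‖ * ‖deriv γ y‖) / ‖γ y - γ x‖ ^ (2 * s + 1) := by
  unfold b1 muW
  rw [Rop_normsq]
  have : ‖γ y - γ x‖ ^ (2 * s + 1) = (‖γ y - γ x‖ ^ s) ^ 2 * ‖γ y - γ x‖ := by
    rw [Real.rpow_add_one hD.ne', ← Real.rpow_natCast, ← Real.rpow_mul hD.le]; norm_num; ring_nf; simp
  rw [this]; field_simp

lemma Nop_taylor {γ u : ℝ → En n} {x : ℝ} (hx : deriv γ x ≠ 0) (h : ℝ) :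
    ‖Nop γ u x (x + h)‖ ≤ ‖u (x + h) - u x - h • deriv u x‖
      + ‖Dg γ u x‖ * ‖γ (x + h) - γ x - h • deriv γ x‖ := by
  have hw : ‖deriv γ x‖ ≠ 0 := by simpa using hx
  have e : Nop γ u x (x + h) = (u (x + h) - u x - h • deriv u x)
      - ⟪Dg γ γ x, γ (x + h) - γ x - h • deriv γ x⟫ • Dg γ u x := by
    have e1 : ⟪Dg γ γ x, h • deriv γ x⟫ • Dg γ u x = h • deriv u x := by
      unfold Dg
      rw [real_inner_smul_left, real_inner_smul_right, real_inner_self_eq_norm_sq, smul_smul]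
      congr 1; field_simp
    rw [inner_sub_right _ (γ (x + h) - γ x), sub_smul, e1]
    unfold Nop; abel
  rw [e]
  refine (norm_sub_le _ _).trans (add_le_add le_rfl ?_)
  rw [norm_smul, mul_comm, Real.norm_eq_abs]
  exact mul_le_mul_of_nonneg_left (inner_le_D hx _) (norm_nonneg _)

lemma b1_fin_pt {s : ℝ} (hs : 3 / 2 < s) {γ u : ℝ → En n} {c K L : ℝ} (hc : 0 < c)
    (hne : ∀ x, deriv γ x ≠ 0) (hK : ∀ x, ‖deriv γ x‖ ≤ K) (hL : ∀ x, ‖Dg γ u x‖ ≤ L)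
    (x h : ℝ) (hD : c * |h| ≤ ‖γ (x + h) - γ x‖) :
    b1 s γ u x (x + h) ≤ 2 * K ^ 2 / c ^ (2 * s + 1) *
      (‖u (x + h) - u x - h • deriv u x‖ ^ 2 / |h| ^ (2 * s + 1) +
        L ^ 2 * (‖γ (x + h) - γ x - h • deriv γ x‖ ^ 2 / |h| ^ (2 * s + 1))) := by
  rcases eq_or_ne h 0 with rfl | hh
  · simp [b1, Rop, DDg]
  have h0 : 0 < |h| := abs_pos.2 hh
  have hD0 : 0 < ‖γ (x + h) - γ x‖ := lt_of_lt_of_le (by positivity) hD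
  rw [b1_form hD0]
  have hN := Nop_taylor (u := u) (hne x) h
  set a := ‖u (x + h) - u x - h • deriv u x‖ with ha
  set b := ‖γ (x + h) - γ x - h • deriv γ x‖ with hb
  have hN2 : ‖Nop γ u x (x + h)‖ ≤ a + L * b :=
    hN.trans (add_le_add le_rfl (mul_le_mul_of_nonneg_right (hL x) (norm_nonneg _)))
  have hN3 : ‖Nop γ u x (x + h)‖ ^ 2 ≤ 2 * (a ^ 2 + L ^ 2 * b ^ 2) := by
    calc _ ≤ (a + L * b) ^ 2 := by gcongr
      _ ≤ _ := by nlinarith [sq_nonneg (a - L * b)]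
  have hK0 : 0 ≤ K := (norm_nonneg _).trans (hK 0)
  have hww : ‖deriv γ x‖ * ‖deriv γ (x + h)‖ ≤ K ^ 2 := by
    rw [pow_two]; exact mul_le_mul (hK _) (hK _) (norm_nonneg _) hK0
  have hpow : c ^ (2 * s + 1) * |h| ^ (2 * s + 1) ≤ ‖γ (x + h) - γ x‖ ^ (2 * s + 1) := by
    rw [← Real.mul_rpow hc.le h0.le]; exact Real.rpow_le_rpow (by positivity) hD (by linarith)
  calc _ ≤ (2 * (a ^ 2 + L ^ 2 * b ^ 2)) * K ^ 2 / (c ^ (2 * s + 1) * |h| ^ (2 * s + 1)) := by gcongr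
    _ = _ := by field_simp

lemma meas_in {F : ℝ → ℝ → ℝ≥0∞} (h : Measurable fun p : ℝ × ℝ => F p.1 p.2) (S : Set ℝ) :
    Measurable fun x => ∫⁻ y in S, F x y :=
  h.lintegral_prod_right' (ν := volume.restrict S)

lemma lint_comb {F G : ℝ → ℝ → ℝ≥0∞} (hF : Measurable fun p : ℝ × ℝ => F p.1 p.2)
    (S : Set ℝ) {a b : ℝ≥0∞} (ha : a ≠ ⊤) (hb : b ≠ ⊤) :
    ∫⁻ x in I01, ∫⁻ h in S, a * (F x h + b * G x h) =
      a * ((∫⁻ x in I01, ∫⁻ h in S, F x h) + b * ∫⁻ x in I01, ∫⁻ h in S, G x h) := by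
  have e : ∀ x, ∫⁻ h in S, a * (F x h + b * G x h) =
      a * ((∫⁻ h in S, F x h) + b * ∫⁻ h in S, G x h) := by
    intro x
    have m2 : Measurable fun h => F x h := hF.comp (by fun_prop : Measurable fun h : ℝ => (x, h))
    rw [lintegral_const_mul' _ _ ha, lintegral_add_left m2, lintegral_const_mul' _ _ hb]
  simp_rw [e]
  rw [lintegral_const_mul' _ _ ha, lintegral_add_left (meas_in hF S), lintegral_const_mul' _ _ hb]

lemma b1_fin {s : ℝ} (hs : 3 / 2 < s) {γ u : ℝ → En n} {c K L M : ℝ} (hc : 0 < c)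
    (hI : Imm γ) (hu : ContDiff ℝ 1 u) (hup : Function.Periodic u 1)
    (hK : ∀ x, ‖deriv γ x‖ ≤ K) (hL : ∀ x, ‖Dg γ u x‖ ≤ L)
    (hD : ∀ x h, |h| ≤ 1 / 2 → c * |h| ≤ ‖γ (x + h) - γ x‖)
    (gγ : gagliardoSqE (s - 1) (deriv γ) ≤ ENNReal.ofReal M)
    (gu : gagliardoSqE (s - 1) (deriv u) ≤ ENNReal.ofReal M) (hM : 0 ≤ M) :
    lint2 (b1 s γ u) ≤ ENNReal.ofReal (2 * K ^ 2 / c ^ (2 * s + 1) * (M + L ^ 2 * M)) := by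
  unfold lint2
  rw [lint2_shift (fun x y => ENNReal.ofReal (b1 s γ u x y)) (fun x y => by rw [b1_pery hI.per hup])]
  set A := 2 * K ^ 2 / c ^ (2 * s + 1) with hA
  have hA0 : 0 ≤ A := by positivity
  let f := fun (v : ℝ → En n) (x h : ℝ) => ‖v (x + h) - v x - h • deriv v x‖ ^ 2 / |h| ^ (2 * s + 1)
  have mf : ∀ v : ℝ → En n, ContDiff ℝ 1 v → Measurable fun p : ℝ × ℝ => ENNReal.ofReal (f v p.1 p.2) := by
    intro v hv
    have c1 := hv.continuous_deriv le_rfl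
    have c0 := hv.continuous
    have : Continuous fun p : ℝ × ℝ => ‖v (p.1 + p.2) - v p.1 - p.2 • deriv v p.1‖ ^ 2 := by fun_prop
    exact (this.measurable.div (by fun_prop)).ennreal_ofReal
  have f0 : ∀ v x h, 0 ≤ f v x h := fun v x h => by simp only [f]; positivity
  calc _ ≤ ∫⁻ x in I01, ∫⁻ h in Ico (-1/2 : ℝ) (1/2), ENNReal.ofReal A * (ENNReal.ofReal (f u x h) +
        ENNReal.ofReal (L ^ 2) * ENNReal.ofReal (f γ x h)) := by
        refine lintegral_mono fun x => setLIntegral_mono' measurableSet_Ico fun h hh => ?_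
        rw [← ENNReal.ofReal_mul (by positivity), ← ENNReal.ofReal_add (f0 _ _ _)
          (mul_nonneg (by positivity) (f0 _ _ _)), ← ENNReal.ofReal_mul hA0]
        refine ENNReal.ofReal_le_ofReal (b1_fin_pt hs hc hI.ne hK hL x h (hD x h ?_))
        rw [abs_le]; constructor <;> linarith [hh.1, hh.2]
    _ = ENNReal.ofReal A * ((∫⁻ x in I01, ∫⁻ h in Ico (-1/2 : ℝ) (1/2), ENNReal.ofReal (f u x h)) +
        ENNReal.ofReal (L ^ 2) * ∫⁻ x in I01, ∫⁻ h in Ico (-1/2 : ℝ) (1/2), ENNReal.ofReal (f γ x h)) := by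
        exact lint_comb (mf u hu) (F := fun x h => ENNReal.ofReal (f u x h)) (G := fun x h => ENNReal.ofReal (f γ x h)) _ ENNReal.ofReal_ne_top ENNReal.ofReal_ne_top
    _ ≤ ENNReal.ofReal A * (ENNReal.ofReal M + ENNReal.ofReal (L ^ 2) * ENNReal.ofReal M) := by
        gcongr
        · exact (hardy hs hu hup).trans gu
        · exact (hardy hs hI.cd hI.per).trans gγ
    _ = _ := by
        rw [← ENNReal.ofReal_mul (by positivity), ← ENNReal.ofReal_add hM (by positivity),
          ← ENNReal.ofReal_mul hA0]

lemma per_shift {u : ℝ → En n} (hu : Function.Periodic u 1) (x y : ℝ) :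
    ∃ h, |h| = dT x y ∧ ∀ v : ℝ → En n, Function.Periodic v 1 → v y = v (x + h) := by
  refine ⟨y - x + round (x - y), ?_, ?_⟩
  · rw [dT_eq, ← abs_neg]; congr 1; ring
  · intro v hv
    have := (hv.int_mul (round (x - y))) y
    rw [← this]; congr 1; ring

lemma lip_per {u : ℝ → En n} (hu : ContDiff ℝ 1 u) (hup : Function.Periodic u 1) {K : ℝ}
    (hK : ∀ x, ‖deriv u x‖ ≤ K) (x y : ℝ) : ‖u y - u x‖ ≤ K * dT x y := by
  obtain ⟨h, h1, h2⟩ := per_shift hup x y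
  rw [h2 u hup, ← h1]
  simpa using cd_lip hu hK x (x + h)

lemma low_per {γ : ℝ → En n} (hp : Function.Periodic γ 1) {c : ℝ}
    (hD : ∀ x h, |h| ≤ 1 / 2 → c * |h| ≤ ‖γ (x + h) - γ x‖) (x y : ℝ) : c * dT x y ≤ ‖γ y - γ x‖ := by
  obtain ⟨h, h1, h2⟩ := per_shift hp x y
  rw [h2 γ hp, ← h1]
  exact hD x h (h1 ▸ dT_le_half x y)

lemma S6 {s : ℝ} (hs : 3 / 2 < s) {c K M : ℝ} (hc : 0 < c) (hM : 0 ≤ M) :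
    ∃ K' > 0, ∀ (n : ℕ) (γ u : ℝ → En n), Imm γ → ContDiff ℝ 1 u → Function.Periodic u 1 →
      (∀ x, c ≤ ‖deriv γ x‖) → (∀ x, ‖deriv γ x‖ ≤ K) → (∀ x, ‖deriv u x‖ ≤ K) → (∀ x, ‖u x‖ ≤ K) →
      (∀ x h, |h| ≤ 1 / 2 → c * |h| ≤ ‖γ (x + h) - γ x‖) →
      gagliardoSqE (s - 1) (deriv γ) ≤ ENNReal.ofReal M → gagliardoSqE (s - 1) (deriv u) ≤ ENNReal.ofReal M →
      EtpE s γ ≤ ENNReal.ofReal K' ∧ GE s γ u ≤ ENNReal.ofReal K' := by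
  set L := K / c with hL
  set B := 2 * K ^ 2 / c ^ (2 * s + 1) * (M + L ^ 2 * M) with hB
  have hB0 : 0 ≤ B := by positivity
  refine ⟨|B| + (2 * B + (2 * s + 1) * (L ^ 2 * B) + 2 * L ^ 2 * B + L ^ 2 * |K| + K ^ 2 * |K|) + 1,
    by positivity, ?_⟩
  intro n γ u hI hu hup hcγ hKγ hKu hu0 hD gγ gu
  have hcK : c ≤ K := (hcγ 0).trans (hKγ 0)
  have hK0 : 0 < K := hc.trans_le hcK
  have hL1 : 1 ≤ L := by rw [hL, le_div_iff₀ hc]; linarith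
  have hLu : ∀ x, ‖Dg γ u x‖ ≤ L := fun x => by
    have h1 := norm_Dg_mul (u := u) (hI.ne x)
    rw [hL, le_div_iff₀ hc]
    calc _ ≤ ‖Dg γ u x‖ * ‖deriv γ x‖ := mul_le_mul_of_nonneg_left (hcγ x) (norm_nonneg _)
      _ ≤ K := h1 ▸ hKu x
  have hLγ : ∀ x, ‖Dg γ γ x‖ ≤ L := fun x => (Dg_unit (hI.ne x)).trans_le hL1
  have hE : EtpE s γ ≤ ENNReal.ofReal B := b1_fin hs hc hI hI.cd hI.per hKγ hLγ hD gγ gγ hM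
  have hE' : lint2 (b1 s γ γ) ≤ ENNReal.ofReal B := hE
  refine ⟨hE.trans (ENNReal.ofReal_le_ofReal ?_), ?_⟩
  · rw [abs_of_nonneg hB0, abs_of_nonneg hK0.le]
    have : 0 ≤ (2 * B + (2 * s + 1) * (L ^ 2 * B) + 2 * L ^ 2 * B + L ^ 2 * K + K ^ 2 * K) := by positivity
    linarith
  have h1 : lint2 (b1 s γ u) ≤ ENNReal.ofReal B := b1_fin hs hc hI hu hup hKγ hLu hD gγ gu hM
  have h2 : lint2 (b2 s γ u) ≤ ENNReal.ofReal (L ^ 2 * B) := by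
    rw [ENNReal.ofReal_mul (by positivity)]
    refine le_trans ?_ (mul_le_mul_right hE' _)
    rw [← lint2_mul (by positivity)]
    refine lint2_mono fun x _ y _ => ?_
    have h3 : ‖u y - u x‖ ≤ L * ‖γ y - γ x‖ := by
      refine (lip_per hu hup hKu x y).trans ?_
      have := low_per hI.per hD x y
      rw [hL, div_mul_eq_mul_div, le_div_iff₀ hc, mul_assoc]
      gcongr; linarith
    have h4 : ‖u y - u x‖ ^ 2 / ‖γ y - γ x‖ ^ 2 ≤ L ^ 2 := by
      rw [← div_pow]
      refine pow_le_pow_left₀ (by positivity) (div_le_of_le_mul₀ (norm_nonneg _) (by positivity) h3) 2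
    unfold b2 b1
    have hm := muW_nonneg γ x y
    calc _ ≤ ‖Rop s γ γ x y‖ ^ 2 * L ^ 2 * muW γ x y := by gcongr
      _ = _ := by ring
  have h3 : lint2 (b3 s γ u) ≤ ENNReal.ofReal (2 * L ^ 2 * B) := by
    rw [ENNReal.ofReal_mul (by positivity)]
    refine le_trans ?_ (mul_le_mul_right hE' _)
    rw [← lint2_mul (by positivity)]
    refine lint2_mono fun x _ y _ => ?_
    unfold b3 b1
    have hm := muW_nonneg γ x y
    calc _ ≤ ‖Rop s γ γ x y‖ ^ 2 * (L ^ 2 + L ^ 2) * muW γ x y := by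
          gcongr
          · exact hLu x
          · exact hLu y
      _ = _ := by ring
  have h4 : h1E γ u ≤ ENNReal.ofReal (L ^ 2 * |K|) := by
    unfold h1E
    calc _ ≤ ∫⁻ x in I01, ENNReal.ofReal (L ^ 2 * |K|) := lintegral_mono fun x =>
          ENNReal.ofReal_le_ofReal (mul_le_mul (pow_le_pow_left₀ (norm_nonneg _) (hLu x) 2)
            ((hKγ x).trans (le_abs_self _)) (norm_nonneg _) (by positivity))
      _ = _ := by simp [I01]
  have h5 : l2E γ u ≤ ENNReal.ofReal (K ^ 2 * |K|) := by
    unfold l2E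
    calc _ ≤ ∫⁻ x in I01, ENNReal.ofReal (K ^ 2 * |K|) := lintegral_mono fun x =>
          ENNReal.ofReal_le_ofReal (mul_le_mul (pow_le_pow_left₀ (norm_nonneg _) (hu0 x) 2)
            ((hKγ x).trans (le_abs_self _)) (norm_nonneg _) (by positivity))
      _ = _ := by simp [I01]
  unfold GE
  have hs0 : 0 ≤ 2 * s + 1 := by linarith
  calc _ ≤ ENNReal.ofReal 2 * ENNReal.ofReal B + ENNReal.ofReal (2 * s + 1) * ENNReal.ofReal (L ^ 2 * B)
      + ENNReal.ofReal (2 * L ^ 2 * B) + ENNReal.ofReal (L ^ 2 * |K|) + ENNReal.ofReal (K ^ 2 * |K|) := by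
        gcongr
    _ = ENNReal.ofReal (2 * B + (2 * s + 1) * (L ^ 2 * B) + 2 * L ^ 2 * B + L ^ 2 * |K| + K ^ 2 * |K|) := by
        rw [← ENNReal.ofReal_mul (by norm_num), ← ENNReal.ofReal_mul hs0, ← ENNReal.ofReal_add (by positivity) (by positivity),
          ← ENNReal.ofReal_add (by positivity) (by positivity), ← ENNReal.ofReal_add (by positivity) (by positivity),
          ← ENNReal.ofReal_add (by positivity) (by positivity)]
    _ ≤ _ := ENNReal.ofReal_le_ofReal (by linarith [abs_nonneg B])
end fin8

section sob
variable {n : ℕ}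

lemma holder1 {s : ℝ} (hs : 3 / 2 < s) {v : ℝ → En n} (hv : Continuous v) (hp : Function.Periodic v 1)
    {B : ℝ} (hB : 0 < B) (hg : gagliardoSqE (s - 1) v ≤ ENNReal.ofReal (B ^ 2)) {x y : ℝ}
    (h : |y - x| ≤ 1 / 2) : ‖v y - v x‖ ≤ 2 * morC (s - 3 / 2) * B * |y - x| ^ (s - 3 / 2) := by
  have hα : 0 < s - 3 / 2 := by linarith
  have main : ∀ x y : ℝ, x < y → y - x ≤ 1 / 2 →
      ‖v y - v x‖ ≤ 2 * morC (s - 3 / 2) * B * (y - x) ^ (s - 3 / 2) := by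
    intro x y hxy hle
    have := (morrey_w hα (w := fun _ => 1) continuous_const (fun _ => one_pos) hv hxy hB ?_).2
    · simpa using this
    refine le_trans ?_ hg
    unfold gagliardoSqE
    refine le_trans ?_ (lint2_sub_le _ (fun x y => by rw [hp, dT_add_left])
      (fun x y => by rw [hp, dT_add_right]) (A := Ico x y) (B := Ico x y) (a := x) (b := x)
      (Ico_subset_Ico_right (by linarith)) (Ico_subset_Ico_right (by linarith)))
    refine setLIntegral_mono' measurableSet_Ico fun a ha => ?_
    refine setLIntegral_mono' measurableSet_Ico fun b hb => ?_
    apply le_of_eq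
    have hab : |a - b| ≤ 1 / 2 := by
      rw [abs_le]; constructor <;> linarith [ha.1, ha.2, hb.1, hb.2]
    rw [dT_of_le hab]
    congr 1
    simp only [intervalIntegral.integral_const, smul_eq_mul, mul_one]
    rw [abs_sub_comm b a]; congr 2; ring
  rcases lt_trichotomy x y with h1 | rfl | h1
  · rw [abs_of_pos (by linarith)] at h ⊢; exact main x y h1 h
  · simp [Real.zero_rpow hα.ne']
  · rw [abs_sub_comm, abs_of_pos (by linarith)] at h ⊢
    rw [norm_sub_rev]; exact main y x h1 h

lemma sup_of_l2 {f : ℝ → En n} (hf : Continuous f) (hp : Function.Periodic f 1) {H : ℝ}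
    (h : ∀ x z, |z - x| ≤ 1 / 2 → ‖f z - f x‖ ≤ H) (x : ℝ) :
    ‖f x‖ ^ 2 ≤ 2 * (∫ z in I01, ‖f z‖ ^ 2) + 2 * H ^ 2 := by
  have hH : 0 ≤ H := (norm_nonneg _).trans (h 0 0 (by norm_num))
  have cf : Continuous fun z => ‖f z‖ ^ 2 := by fun_prop
  have e : ∫ z in I01, ‖f z‖ ^ 2 = ∫ z in (x - 1/2)..(x - 1/2 + 1), ‖f z‖ ^ 2 := by
    have hpp : Function.Periodic (fun z => ‖f z‖ ^ 2) 1 := fun z => by simp only [hp z]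
    rw [hpp.intervalIntegral_add_eq (x - 1/2) 0, intervalIntegral.integral_of_le (by norm_num), I01, zero_add,
      integral_Ico_eq_integral_Ioc]
  have : ∫ z in (x - 1/2)..(x - 1/2 + 1), ‖f x‖ ^ 2 ≤
      ∫ z in (x - 1/2)..(x - 1/2 + 1), (2 * ‖f z‖ ^ 2 + 2 * H ^ 2) := by
    refine intervalIntegral.integral_mono_on (by linarith) (by simp) (Continuous.intervalIntegrable (by fun_prop) _ _) ?_
    intro z hz
    have h1 := h x z (by rw [abs_le]; constructor <;> linarith [hz.1, hz.2])
    have h2 : ‖f x‖ ≤ ‖f z‖ + H := by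
      have := norm_sub_norm_le (f x) (f z); rw [norm_sub_rev] at this; linarith
    calc _ ≤ (‖f z‖ + H) ^ 2 := by gcongr
      _ ≤ _ := by nlinarith [sq_nonneg (‖f z‖ - H)]
  rw [intervalIntegral.integral_add (Continuous.intervalIntegrable (by fun_prop) _ _) (by simp),
    intervalIntegral.integral_const_mul] at this
  simp only [intervalIntegral.integral_const, smul_eq_mul] at this
  rw [e]; linarith

def sobC (s : ℝ) : ℝ := 4 + 4 * morC (s - 3 / 2)
lemma sobC_pos {s : ℝ} (hs : 3 / 2 < s) : 0 < sobC s := by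
  unfold sobC; have := morC_pos (α := s - 3 / 2) (by linarith); linarith

lemma int_sq_nonneg (f : ℝ → En n) : 0 ≤ ∫ x in I01, ‖f x‖ ^ 2 := integral_nonneg fun x => by positivity

lemma HsNorm_parts {s : ℝ} {u : ℝ → En n} (hu : InHs s u) {N : ℝ} (hN : 0 < N) (h : HsNorm s u ≤ N) :
    (∫ x in I01, ‖u x‖ ^ 2) ≤ N ^ 2 ∧ (∫ x in I01, ‖deriv u x‖ ^ 2) ≤ N ^ 2 ∧
      gagliardoSqE (s - 1) (deriv u) ≤ ENNReal.ofReal (N ^ 2) := by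
  have h1 := (Real.sqrt_le_left hN.le).1 h
  unfold HsNormSq at h1
  have h2 := int_sq_nonneg u
  have h3 := int_sq_nonneg (deriv u)
  have h4 : 0 ≤ (gagliardoSqE (s - 1) (deriv u)).toReal := ENNReal.toReal_nonneg
  refine ⟨by linarith, by linarith, ?_⟩
  rw [← ENNReal.ofReal_toReal hu.2.2.ne]
  exact ENNReal.ofReal_le_ofReal (by linarith)

lemma sob {s : ℝ} (hs : 3 / 2 < s) {u : ℝ → En n} (hu : InHs s u) {N : ℝ} (hN : 0 < N)
    (h : HsNorm s u ≤ N) : (∀ x, ‖deriv u x‖ ≤ sobC s * N) ∧ ∀ x, ‖u x‖ ≤ sobC s * N := by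
  obtain ⟨h1, h2, h3⟩ := HsNorm_parts hu hN h
  obtain ⟨hp, hc, -⟩ := hu
  have hm := morC_pos (α := s - 3 / 2) (by linarith)
  have hd : ∀ x, ‖deriv u x‖ ≤ (2 + 4 * morC (s - 3 / 2)) * N := by
    intro x
    have := sup_of_l2 (hc.continuous_deriv le_rfl) (fun x => deriv_per hp x)
      (H := 2 * morC (s - 3 / 2) * N) (fun x z hxz => by
        refine (holder1 hs (hc.continuous_deriv le_rfl) (fun x => deriv_per hp x) hN h3 hxz).trans ?_
        refine mul_le_of_le_one_right (by positivity) ?_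
        exact Real.rpow_le_one (by positivity) (by linarith) (by linarith)) x
    refine le_of_sq_le_sq ?_ (by positivity)
    nlinarith [mul_pos hm (mul_pos hN hN), mul_pos (mul_pos hm hm) (mul_pos hN hN)]
  refine ⟨fun x => (hd x).trans (by unfold sobC; gcongr; norm_num), fun x => ?_⟩
  have := sup_of_l2 hc.continuous hp (H := (1 + 2 * morC (s - 3 / 2)) * N) (fun x z hxz => by
    refine (cd_lip hc hd x z).trans ?_
    have : (2 + 4 * morC (s - 3 / 2)) * N * |z - x| ≤ (2 + 4 * morC (s - 3 / 2)) * N * (1 / 2) := by gcongr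
    linarith) x
  refine le_of_sq_le_sq ?_ (by have := sobC_pos hs; positivity)
  unfold sobC
  nlinarith [mul_pos hm (mul_pos hN hN), mul_pos (mul_pos hm hm) (mul_pos hN hN), mul_pos hN hN]
end sob

section path
variable {n : ℕ}

lemma gag_meas {v : ℝ → En n} (hv : Continuous v) (e : ℝ) :
    Measurable fun p : ℝ × ℝ => ‖v p.2 - v p.1‖ ^ 2 / dT p.1 p.2 ^ e := by
  have : Continuous fun p : ℝ × ℝ => ‖v p.2 - v p.1‖ ^ 2 := by fun_prop
  exact this.measurable.div (dT_meas.pow_const e)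

lemma gag_add {s : ℝ} {v w : ℝ → En n} (hv : Continuous v) :
    gagliardoSqE (s - 1) (fun x => v x + w x) ≤
      ENNReal.ofReal 2 * (gagliardoSqE (s - 1) v + gagliardoSqE (s - 1) w) := by
  have e : ∀ f : ℝ → En n, gagliardoSqE (s - 1) f =
    lint2 fun x y => ‖f y - f x‖ ^ 2 / dT x y ^ (2 * (s - 1) + 1) := fun f => rfl
  rw [e, e, e, ← lint2_add (gag_meas hv _)
    (fun x y => div_nonneg (by positivity) (Real.rpow_nonneg (dT_nonneg _ _) _))
    (fun x y => div_nonneg (by positivity) (Real.rpow_nonneg (dT_nonneg _ _) _)), ← lint2_mul (by norm_num)]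
  refine lint2_mono fun x _ y _ => ?_
  rw [← add_div, ← mul_div_assoc]
  have := Real.rpow_nonneg (dT_nonneg x y) (2 * (s - 1) + 1)
  gcongr
  have h1 : ‖v y + w y - (v x + w x)‖ ≤ ‖v y - v x‖ + ‖w y - w x‖ := by
    rw [show v y + w y - (v x + w x) = (v y - v x) + (w y - w x) by abel]; exact norm_add_le _ _
  calc _ ≤ (‖v y - v x‖ + ‖w y - w x‖) ^ 2 := by gcongr
    _ ≤ _ := by nlinarith [sq_nonneg (‖v y - v x‖ - ‖w y - w x‖)]

lemma gag_smul {s : ℝ} (v : ℝ → En n) (c : ℝ) :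
    gagliardoSqE (s - 1) (fun x => c • v x) = ENNReal.ofReal (c ^ 2) * gagliardoSqE (s - 1) v := by
  have e : ∀ f : ℝ → En n, gagliardoSqE (s - 1) f =
    lint2 fun x y => ‖f y - f x‖ ^ 2 / dT x y ^ (2 * (s - 1) + 1) := fun f => rfl
  rw [e, e, ← lint2_mul (by positivity)]
  congr 1; funext x y
  rw [← smul_sub, norm_smul, mul_pow, Real.norm_eq_abs, sq_abs, mul_div_assoc]

lemma InHs.smul {s : ℝ} {u : ℝ → En n} (hu : InHs s u) (c : ℝ) :
    InHs s (fun x => c • u x) ∧ ∀ x, deriv (fun x => c • u x) x = c • deriv u x := by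
  have hd : ∀ x, deriv (fun x => c • u x) x = c • deriv u x := fun x => ((cd_hd hu.2.1 x).const_smul c).deriv
  refine ⟨⟨fun x => by simp only [hu.1 x], hu.2.1.const_smul c, ?_⟩, hd⟩
  rw [show deriv (fun x => c • u x) = fun x => c • deriv u x from funext hd, gag_smul]
  exact ENNReal.mul_lt_top ENNReal.ofReal_lt_top hu.2.2

lemma InHs.add {s : ℝ} {u v : ℝ → En n} (hu : InHs s u) (hv : InHs s v) :
    InHs s (fun x => u x + v x) ∧ ∀ x, deriv (fun x => u x + v x) x = deriv u x + deriv v x := by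
  have hd : ∀ x, deriv (fun x => u x + v x) x = deriv u x + deriv v x :=
    fun x => ((cd_hd hu.2.1 x).add (cd_hd hv.2.1 x)).deriv
  refine ⟨⟨fun x => by simp only [hu.1 x, hv.1 x], hu.2.1.add hv.2.1, ?_⟩, hd⟩
  rw [show deriv (fun x => u x + v x) = fun x => deriv u x + deriv v x from funext hd]
  refine (gag_add (hu.2.1.continuous_deriv le_rfl)).trans_lt ?_
  exact ENNReal.mul_lt_top ENNReal.ofReal_lt_top (ENNReal.add_lt_top.2 ⟨hu.2.2, hv.2.2⟩)

lemma InHs.sub {s : ℝ} {u v : ℝ → En n} (hu : InHs s u) (hv : InHs s v) :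
    InHs s (fun x => u x - v x) ∧ ∀ x, deriv (fun x => u x - v x) x = deriv u x - deriv v x := by
  have h := hu.add (hv.smul (-1)).1
  have e : (fun x => u x - v x) = fun x => u x + (-1 : ℝ) • v x := by funext x; simp [sub_eq_add_neg]
  rw [e]
  refine ⟨h.1, fun x => ?_⟩
  rw [h.2, (hv.smul (-1)).2]; simp [sub_eq_add_neg]

lemma gag_le_of_sub {s : ℝ} {u v : ℝ → En n} (hu : InHs s u) (hv : InHs s v) :
    gagliardoSqE (s - 1) (deriv u) ≤ ENNReal.ofReal 2 *
      (gagliardoSqE (s - 1) (deriv fun x => u x - v x) + gagliardoSqE (s - 1) (deriv v)) := by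
  have h := hu.sub hv
  have := gag_add (s := s) (v := deriv fun x => u x - v x) (w := deriv v) (h.1.2.1.continuous_deriv le_rfl)
  refine le_trans (le_of_eq ?_) this
  congr 1; funext x; rw [h.2]; simp

/-- uniform (in `x`) closeness packaged -/
lemma C1Path.velo {s : ℝ} (hs : 3 / 2 < s) (P : C1Path s n) {t : ℝ} (ht : t ∈ Icc (0:ℝ) 1) {ε : ℝ} (hε : 0 < ε) :
    ∀ᶠ τ in 𝓝[Icc (0:ℝ) 1] t,
      (∀ x, ‖P.V τ x - P.V t x‖ ≤ ε) ∧ (∀ x, ‖deriv (P.V τ) x - deriv (P.V t) x‖ ≤ ε) ∧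
      gagliardoSqE (s - 1) (deriv (P.V τ)) ≤ ENNReal.ofReal 2 *
        (ENNReal.ofReal ((ε / sobC s) ^ 2) + gagliardoSqE (s - 1) (deriv (P.V t))) := by
  have hC := sobC_pos hs
  have h1 := (P.contV t ht).eventually (gt_mem_nhds (show 0 < ε / sobC s by positivity))
  filter_upwards [h1, self_mem_nhdsWithin] with τ hτ hτ1
  have hh := (P.memV τ hτ1).sub (P.memV t ht)
  have := sob hs hh.1 (N := ε / sobC s) (by positivity) hτ.le
  rw [mul_div_cancel₀ _ hC.ne'] at this
  refine ⟨this.2, fun x => by rw [← hh.2]; exact this.1 x, ?_⟩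
  refine (gag_le_of_sub (P.memV τ hτ1) (P.memV t ht)).trans ?_
  gcongr
  exact (HsNorm_parts hh.1 (by positivity) hτ.le).2.2

lemma C1Path.diffq {s : ℝ} (hs : 3 / 2 < s) (P : C1Path s n) {t : ℝ} (ht : t ∈ Icc (0:ℝ) 1) {ε : ℝ} (hε : 0 < ε) :
    ∀ᶠ τ in 𝓝[Icc (0:ℝ) 1] t,
      (∀ x, ‖P.Γ τ x - P.Γ t x - (τ - t) • P.V t x‖ ≤ ε * |τ - t|) ∧
      (∀ x, ‖deriv (P.Γ τ) x - deriv (P.Γ t) x - (τ - t) • deriv (P.V t) x‖ ≤ ε * |τ - t|) ∧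
      gagliardoSqE (s - 1) (deriv (P.Γ τ)) ≤ ENNReal.ofReal 2 *
        (ENNReal.ofReal ((τ - t) ^ 2) * (ENNReal.ofReal 2 * (ENNReal.ofReal ((ε / sobC s) ^ 2) +
        gagliardoSqE (s - 1) (deriv (P.V t)))) + gagliardoSqE (s - 1) (deriv (P.Γ t))) := by
  have hC := sobC_pos hs
  have h1 := (P.isDeriv t ht).eventually (gt_mem_nhds (show 0 < ε / sobC s by positivity))
  have h2 : ∀ᶠ τ in 𝓝[Icc (0:ℝ) 1 \ {t}] t,
      HsNorm s (fun x => (τ - t)⁻¹ • (P.Γ τ x - P.Γ t x) - P.V t x) < ε / sobC s := by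
    have hT : Tendsto (fun τ : ℝ => τ - t) (𝓝[Icc (0:ℝ) 1 \ {t}] t)
        (𝓝[{h : ℝ | t + h ∈ Set.Icc (0 : ℝ) 1 ∧ h ≠ 0}] 0) := by
      refine tendsto_nhdsWithin_iff.2 ⟨?_, ?_⟩
      · have : Tendsto (fun τ : ℝ => τ - t) (𝓝 t) (𝓝 (t - t)) := (continuous_id.sub continuous_const).tendsto t
        rw [sub_self] at this; exact this.mono_left nhdsWithin_le_nhds
      · filter_upwards [self_mem_nhdsWithin] with τ hτ
        refine ⟨by rw [add_sub_cancel]; exact hτ.1, sub_ne_zero.2 hτ.2⟩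
    filter_upwards [hT.eventually h1] with τ hτ
    simpa using hτ
  rw [show Icc (0:ℝ) 1 \ {t} = Icc (0:ℝ) 1 ∩ {t}ᶜ from rfl, nhdsWithin_inter', ] at h2
  rw [eventually_inf_principal] at h2
  filter_upwards [h2, self_mem_nhdsWithin] with τ hτ hτ1
  rcases eq_or_ne τ t with rfl | hne
  · refine ⟨by simp, by simp, ?_⟩
    refine le_trans ?_ (mul_le_mul_right le_add_self _)
    exact le_mul_of_one_le_left zero_le (by simp)
  have hτ := hτ hne
  have h0 : τ - t ≠ 0 := sub_ne_zero.2 hne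
  have hd := (P.mem τ hτ1).1.sub (P.mem t ht).1
  have hq := hd.1.smul (τ - t)⁻¹
  have hh := hq.1.sub (P.memV t ht)
  have hN := sob hs hh.1 (N := ε / sobC s) (by positivity) hτ.le
  rw [mul_div_cancel₀ _ hC.ne'] at hN
  have key : ∀ (a b : En n), ‖(τ - t)⁻¹ • a - b‖ ≤ ε → ‖a - (τ - t) • b‖ ≤ ε * |τ - t| := by
    intro a b hab
    have : a - (τ - t) • b = (τ - t) • ((τ - t)⁻¹ • a - b) := by
      rw [smul_sub, smul_smul, mul_inv_cancel₀ h0, one_smul]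
    rw [this, norm_smul, Real.norm_eq_abs, mul_comm]; gcongr
  refine ⟨fun x => key _ _ (hN.2 x), fun x => key _ _ ?_, ?_⟩
  · have := hN.1 x
    rw [hh.2, hq.2, hd.2] at this; exact this
  · refine (gag_le_of_sub (P.mem τ hτ1).1 (P.mem t ht).1).trans ?_
    gcongr
    have e : (deriv fun x => P.Γ τ x - P.Γ t x) =
        fun x => (τ - t) • deriv (fun x => (τ - t)⁻¹ • (P.Γ τ x - P.Γ t x)) x := by
      funext x; rw [hq.2, smul_smul, mul_inv_cancel₀ h0, one_smul]
    rw [e, gag_smul]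
    gcongr
    refine (gag_le_of_sub hq.1 (P.memV t ht)).trans ?_
    gcongr
    exact (HsNorm_parts hh.1 (by positivity) hτ.le).2.2
end path

section path2
variable {n : ℕ}

def cl (t : ℝ) : ℝ := max 0 (min 1 t)
lemma cl_cont : Continuous cl := by unfold cl; fun_prop
lemma cl_mem (t : ℝ) : cl t ∈ Icc (0:ℝ) 1 := ⟨le_max_left _ _, max_le zero_le_one (min_le_left _ _)⟩
lemma cl_eq {t : ℝ} (h : t ∈ Icc (0:ℝ) 1) : cl t = t := by
  unfold cl; rw [min_eq_right h.2, max_eq_right h.1]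

lemma joint_cont {F : ℝ → ℝ → En n} (h1 : ∀ t ∈ Icc (0:ℝ) 1, Continuous (F t))
    (h2 : ∀ t ∈ Icc (0:ℝ) 1, ∀ ε > 0, ∀ᶠ τ in 𝓝[Icc (0:ℝ) 1] t, ∀ x, ‖F τ x - F t x‖ ≤ ε) :
    Continuous fun p : ℝ × ℝ => F (cl p.1) p.2 := by
  rw [continuous_iff_continuousAt]
  rintro ⟨t, x⟩
  rw [ContinuousAt, Metric.tendsto_nhds]
  intro ε hε
  have e1 : ∀ᶠ p : ℝ × ℝ in 𝓝 (t, x), ∀ z, ‖F (cl p.1) z - F (cl t) z‖ ≤ ε / 3 := by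
    have hT : Tendsto (fun p : ℝ × ℝ => cl p.1) (𝓝 (t, x)) (𝓝[Icc (0:ℝ) 1] (cl t)) :=
      tendsto_nhdsWithin_iff.2 ⟨(cl_cont.comp continuous_fst).tendsto (t, x), Eventually.of_forall fun p => cl_mem _⟩
    exact hT.eventually (h2 (cl t) (cl_mem t) (ε / 3) (by positivity))
  have e2 : ∀ᶠ p : ℝ × ℝ in 𝓝 (t, x), dist (F (cl t) p.2) (F (cl t) x) < ε / 3 :=
    Metric.tendsto_nhds.1 (((h1 _ (cl_mem t)).comp continuous_snd).tendsto (t, x)) (ε / 3) (by positivity)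
  filter_upwards [e1, e2] with p hp1 hp2
  calc dist (F (cl p.1) p.2) (F (cl t) x) ≤ dist (F (cl p.1) p.2) (F (cl t) p.2) + dist (F (cl t) p.2) (F (cl t) x) :=
        dist_triangle _ _ _
    _ < ε := by rw [dist_eq_norm]; linarith [hp1 p.2]

lemma per_bdd {u : ℝ → En n} (hu : Continuous u) (hp : Function.Periodic u 1) : ∃ K > 0, ∀ x, ‖u x‖ ≤ K := by
  obtain ⟨C, hC⟩ := isCompact_Icc.exists_bound_of_continuousOn (s := Icc (0:ℝ) 1) hu.continuousOn
  refine ⟨|C| + 1, by positivity, fun x => ?_⟩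
  obtain ⟨z, hz, e⟩ := per_I01 hp x
  rw [e]; linarith [hC z ⟨hz.1, hz.2.le⟩, le_abs_self C]

lemma unif_of_diffq {F V : ℝ → ℝ → En n} {t K : ℝ} (hK : ∀ x, ‖V t x‖ ≤ K)
    (h : ∀ᶠ τ in 𝓝[Icc (0:ℝ) 1] t, ∀ x, ‖F τ x - F t x - (τ - t) • V t x‖ ≤ 1 * |τ - t|) {ε : ℝ} (hε : 0 < ε) :
    ∀ᶠ τ in 𝓝[Icc (0:ℝ) 1] t, ∀ x, ‖F τ x - F t x‖ ≤ ε := by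
  have hK0 : 0 ≤ K := (norm_nonneg _).trans (hK 0)
  have h2 : ∀ᶠ τ in 𝓝[Icc (0:ℝ) 1] t, |τ - t| < ε / (K + 1) := by
    have := Metric.ball_mem_nhds t (show 0 < ε / (K + 1) by positivity)
    exact (mem_nhdsWithin_of_mem_nhds this)
  filter_upwards [h, h2] with τ h1 h2 x
  have h3 : ‖F τ x - F t x‖ ≤ |τ - t| * K + 1 * |τ - t| := by
    calc _ = ‖(τ - t) • V t x + (F τ x - F t x - (τ - t) • V t x)‖ := by congr 1; abel
      _ ≤ _ := norm_add_le _ _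
      _ ≤ _ := by rw [norm_smul, Real.norm_eq_abs]; gcongr; exacts [hK x, h1 x]
  rw [lt_div_iff₀ (by positivity)] at h2
  linarith

lemma hasDeriv_of_diffq {F V : ℝ → ℝ → En n} {t : ℝ} (ht : t ∈ Ioo (0:ℝ) 1) (x : ℝ)
    (h : ∀ ε > 0, ∀ᶠ τ in 𝓝[Icc (0:ℝ) 1] t, ‖F τ x - F t x - (τ - t) • V t x‖ ≤ ε * |τ - t|) :
    HasDerivAt (fun τ => F (cl τ) x) (V (cl t) x) t := by
  have hI : Icc (0:ℝ) 1 ∈ 𝓝 t := Icc_mem_nhds ht.1 ht.2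
  have ht' : t ∈ Icc (0:ℝ) 1 := ⟨ht.1.le, ht.2.le⟩
  rw [cl_eq ht']
  have : HasDerivAt (fun τ => F τ x) (V t x) t := by
    rw [hasDerivAt_iff_isLittleO, Asymptotics.isLittleO_iff]
    intro ε hε
    have := h ε hε
    rw [nhdsWithin_eq_nhds.2 hI] at this
    filter_upwards [this] with τ hτ
    simpa [Real.norm_eq_abs] using hτ
  refine this.congr_of_eventuallyEq ?_
  filter_upwards [hI] with τ hτ
  rw [cl_eq hτ]

lemma cpt_bdd {φ : ℝ → ℝ≥0∞} (h : ∀ t ∈ Icc (0:ℝ) 1, ∃ M : ℝ, ∀ᶠ τ in 𝓝[Icc (0:ℝ) 1] t, φ τ ≤ ENNReal.ofReal M) :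
    ∃ M : ℝ, 0 ≤ M ∧ ∀ t ∈ Icc (0:ℝ) 1, φ t ≤ ENNReal.ofReal M := by
  refine isCompact_Icc.induction_on (p := fun S => ∃ M : ℝ, 0 ≤ M ∧ ∀ t ∈ S, φ t ≤ ENNReal.ofReal M) ?_ ?_ ?_ ?_
  · exact ⟨0, le_rfl, by simp⟩
  · rintro S T hST ⟨M, h0, hM⟩; exact ⟨M, h0, fun t ht => hM t (hST ht)⟩
  · rintro S T ⟨M, h0, hM⟩ ⟨N, h0', hN⟩
    refine ⟨M + N, by positivity, ?_⟩
    rintro t (ht | ht)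
    · exact (hM t ht).trans (ENNReal.ofReal_le_ofReal (by linarith))
    · exact (hN t ht).trans (ENNReal.ofReal_le_ofReal (by linarith))
  · intro t ht
    obtain ⟨M, hM⟩ := h t ht
    exact ⟨_, hM, |M|, abs_nonneg _, fun τ hτ => (show φ τ ≤ _ from hτ).trans (ENNReal.ofReal_le_ofReal (le_abs_self M))⟩

structure Good (s : ℝ) (A U : ℝ → ℝ → En n) : Prop where
  imm : ∀ t, Imm (A t)
  inj : ∀ t, InjOn (A t) I01
  cdU : ∀ t, ContDiff ℝ 1 (U t)
  perU : ∀ t, Function.Periodic (U t) 1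
  rA : Reg A
  rU : Reg U
  d0 : ∀ t ∈ Ioo (0:ℝ) 1, ∀ x, HasDerivAt (fun τ => A τ x) (U t x) t
  d1 : ∀ t ∈ Ioo (0:ℝ) 1, ∀ x, HasDerivAt (fun τ => deriv (A τ) x) (deriv (U t) x) t
  bdd : ∃ K', 0 < K' ∧ ∀ t, EtpE s (A t) ≤ ENNReal.ofReal K' ∧ GE s (A t) (U t) ≤ ENNReal.ofReal K'

lemma InM.imm {s : ℝ} {γ : ℝ → En n} (h : InM s γ) : Imm γ := ⟨h.1.1, h.1.2.1, h.2.2⟩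

lemma inj_shift {γ : ℝ → En n} (hp : Function.Periodic γ 1) (hi : InjOn γ I01) {x h : ℝ} (h0 : h ≠ 0)
    (h1 : |h| ≤ 1 / 2) : γ (x + h) ≠ γ x := by
  intro e
  have hf : ∀ z, γ (Int.fract z) = γ z := fun z => by
    have := (hp.int_mul (-⌊z⌋)) z
    rw [← this]; congr 1; push_cast; rw [Int.fract]; ring
  rw [← hf, ← hf x] at e
  have m : ∀ z : ℝ, Int.fract z ∈ I01 := fun z => ⟨Int.fract_nonneg z, Int.fract_lt_one z⟩
  have := hi (m _) (m _) e
  rw [Int.fract_eq_fract] at this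
  obtain ⟨k, hk⟩ := this
  rw [add_sub_cancel_left] at hk
  have hk0 : k ≠ 0 := by rintro rfl; simp at hk; exact h0 hk
  have : (1:ℝ) ≤ |(k:ℝ)| := by exact_mod_cast Int.one_le_abs hk0
  rw [← hk] at this; linarith

lemma cpt_lower {A : ℝ → ℝ → En n} (rA : Reg A) (hI : ∀ t, Imm (A t)) (hinj : ∀ t, InjOn (A t) I01) :
    ∃ c > 0, ∀ t ∈ Icc (0:ℝ) 1, ∀ x h, |h| ≤ 1 / 2 → c * |h| ≤ ‖A t (x + h) - A t x‖ := by
  let F : ℝ × ℝ × ℝ → En n := fun q => ∫ θ in (0:ℝ)..1, deriv (A q.1) (q.2.1 + θ * q.2.2)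
  have cF : Continuous F := by
    refine intervalIntegral.continuous_parametric_intervalIntegral_of_continuous' (μ := volume)
      (f := fun (q : ℝ × ℝ × ℝ) θ => deriv (A q.1) (q.2.1 + θ * q.2.2)) ?_ 0 1
    exact rA.2.comp (by fun_prop : Continuous fun r : (ℝ × ℝ × ℝ) × ℝ => (r.1.1, r.1.2.1 + r.2 * r.1.2.2))
  have hF : ∀ t x h, h • F (t, x, h) = A t (x + h) - A t x := by
    intro t x h
    have := intervalIntegral.smul_integral_comp_mul_add (deriv (A t)) h x (a := 0) (b := 1)
    simp only [mul_zero, zero_add, mul_one] at this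
    rw [add_comm h x, cd_ftc (hI t).cd] at this
    rw [← this]; congr 1
    refine intervalIntegral.integral_congr fun θ _ => ?_
    simp only []; congr 1; ring
  have hne : ∀ t x h, |h| ≤ 1 / 2 → F (t, x, h) ≠ 0 := by
    intro t x h hh h0
    rcases eq_or_ne h 0 with rfl | hn
    · simp only [F, mul_zero, add_zero, intervalIntegral.integral_const, sub_zero, one_smul] at h0
      exact (hI t).ne x h0
    · apply inj_shift (hI t).per (hinj t) hn hh (x := x)
      rw [← sub_eq_zero, ← hF, h0, smul_zero]
  have hcpt : IsCompact (Icc (0:ℝ) 1 ×ˢ (Icc (0:ℝ) 1 ×ˢ Icc (-1/2:ℝ) (1/2))) :=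
    isCompact_Icc.prod (isCompact_Icc.prod isCompact_Icc)
  obtain ⟨q, hq, hmin⟩ := hcpt.exists_isMinOn ⟨(0, 0, 0), by norm_num⟩ cF.norm.continuousOn
  have hq' : |q.2.2| ≤ 1 / 2 := by rw [abs_le]; constructor <;> linarith [hq.2.2.1, hq.2.2.2]
  refine ⟨‖F q‖, norm_pos_iff.2 (hne q.1 q.2.1 q.2.2 hq'), ?_⟩
  intro t ht x h hh
  obtain ⟨k, hk⟩ : ∃ k : ℤ, x + k ∈ Icc (0:ℝ) 1 := ⟨-⌊x⌋, by
    push_cast; rw [← sub_eq_add_neg]; exact ⟨Int.fract_nonneg x, (Int.fract_lt_one x).le⟩⟩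
  have e : A t (x + h) - A t x = A t ((x + k) + h) - A t (x + k) := by
    have h1 := (hI t).per.int_mul k
    have h2 := h1 (x + h)
    have h3 := h1 x
    rw [mul_one] at h2 h3
    rw [h3, show x + k + h = x + h + k by ring, h2]
  rw [e, ← hF, norm_smul, Real.norm_eq_abs, mul_comm]
  have := isMinOn_iff.1 hmin (t, x + k, h) ⟨ht, hk, by simp only []; rw [abs_le] at hh; constructor <;> linarith [hh.1, hh.2]⟩
  gcongr

lemma cpt_upper {F : ℝ → ℝ → En n} (hF : Continuous fun p : ℝ × ℝ => F p.1 p.2)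
    (hp : ∀ t, Function.Periodic (F t) 1) : ∃ K > 0, ∀ t ∈ Icc (0:ℝ) 1, ∀ x, ‖F t x‖ ≤ K := by
  obtain ⟨C, hC⟩ := (isCompact_Icc.prod isCompact_Icc).exists_bound_of_continuousOn
    (s := Icc (0:ℝ) 1 ×ˢ Icc (0:ℝ) 1) hF.continuousOn
  refine ⟨|C| + 1, by positivity, fun t ht x => ?_⟩
  obtain ⟨z, hz, e⟩ := per_I01 (hp t) x
  rw [e]; linarith [hC (t, z) ⟨ht, hz.1, hz.2.le⟩, le_abs_self C]

lemma cpt_low' {F : ℝ → ℝ → En n} (hF : Continuous fun p : ℝ × ℝ => F p.1 p.2)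
    (hp : ∀ t, Function.Periodic (F t) 1) (hne : ∀ t x, F t x ≠ 0) :
    ∃ K > 0, ∀ t ∈ Icc (0:ℝ) 1, ∀ x, K ≤ ‖F t x‖ := by
  obtain ⟨q, hq, hmin⟩ := (isCompact_Icc.prod isCompact_Icc).exists_isMinOn
    (s := Icc (0:ℝ) 1 ×ˢ Icc (0:ℝ) 1) ⟨(0, 0), by norm_num⟩ hF.norm.continuousOn
  refine ⟨‖F q.1 q.2‖, norm_pos_iff.2 (hne _ _), fun t ht x => ?_⟩
  obtain ⟨z, hz, e⟩ := per_I01 (hp t) x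
  rw [e]; exact isMinOn_iff.1 hmin (t, z) ⟨ht, hz.1, hz.2.le⟩

lemma C1Path.good {s : ℝ} (hs : 3 / 2 < s) (P : C1Path s n) :
    Good s (fun t => P.Γ (cl t)) (fun t => P.V (cl t)) := by
  have imm : ∀ t, Imm (P.Γ (cl t)) := fun t => (P.mem _ (cl_mem t)).imm
  have bV : ∀ t ∈ Icc (0:ℝ) 1, ∃ K > 0, (∀ x, ‖P.V t x‖ ≤ K) ∧ ∀ x, ‖deriv (P.V t) x‖ ≤ K := fun t ht => by
    have hv := P.memV t ht
    obtain ⟨K1, h1, h1'⟩ := per_bdd hv.2.1.continuous hv.1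
    obtain ⟨K2, h2, h2'⟩ := per_bdd (hv.2.1.continuous_deriv le_rfl) (fun x => deriv_per hv.1 x)
    exact ⟨K1 + K2, by positivity, fun x => by linarith [h1' x], fun x => by linarith [h2' x]⟩
  have rA : Reg (fun t => P.Γ (cl t)) := by
    constructor
    · refine joint_cont (F := P.Γ) (fun t ht => (P.mem t ht).1.2.1.continuous) fun t ht ε hε => ?_
      obtain ⟨K, -, h1, h2⟩ := bV t ht
      exact unif_of_diffq h1 ((P.diffq hs ht one_pos).mono fun τ h => h.1) hε
    · refine joint_cont (F := fun t => deriv (P.Γ t)) (fun t ht => (P.mem t ht).1.2.1.continuous_deriv le_rfl)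
        fun t ht ε hε => ?_
      obtain ⟨K, -, h1, h2⟩ := bV t ht
      exact unif_of_diffq (V := fun t => deriv (P.V t)) h2 ((P.diffq hs ht one_pos).mono fun τ h => h.2.1) hε
  have rU : Reg (fun t => P.V (cl t)) := by
    constructor
    · exact joint_cont (F := P.V) (fun t ht => (P.memV t ht).2.1.continuous) fun t ht ε hε =>
        (P.velo hs ht hε).mono fun τ h => h.1
    · exact joint_cont (F := fun t => deriv (P.V t)) (fun t ht => (P.memV t ht).2.1.continuous_deriv le_rfl)
        fun t ht ε hε => (P.velo hs ht hε).mono fun τ h => h.2.1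
  have inj : ∀ t, InjOn (P.Γ (cl t)) I01 := fun t => (P.mem _ (cl_mem t)).2.1
  have cdU : ∀ t, ContDiff ℝ 1 (P.V (cl t)) := fun t => (P.memV _ (cl_mem t)).2.1
  have perU : ∀ t, Function.Periodic (P.V (cl t)) 1 := fun t => (P.memV _ (cl_mem t)).1
  refine ⟨imm, inj, cdU, perU, rA, rU, ?_, ?_, ?_⟩
  · intro t ht x
    refine hasDeriv_of_diffq ht x fun ε hε => ?_
    exact (P.diffq hs ⟨ht.1.le, ht.2.le⟩ hε).mono fun τ h => h.1 x
  · intro t ht x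
    refine hasDeriv_of_diffq (F := fun t => deriv (P.Γ t)) (V := fun t => deriv (P.V t)) ht x fun ε hε => ?_
    exact (P.diffq hs ⟨ht.1.le, ht.2.le⟩ hε).mono fun τ h => h.2.1 x
  · obtain ⟨c1, hc1, h1⟩ := cpt_lower rA imm inj
    obtain ⟨c2, hc2, h2⟩ := cpt_low' rA.2 (fun t x => deriv_per (imm t).per x) (fun t x => (imm t).ne x)
    obtain ⟨K1, hK1, k1⟩ := cpt_upper rA.2 (fun t x => deriv_per (imm t).per x)
    obtain ⟨K2, hK2, k2⟩ := cpt_upper rU.2 (fun t x => deriv_per (perU t) x)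
    obtain ⟨K3, hK3, k3⟩ := cpt_upper rU.1 (fun t x => (perU t) x)
    obtain ⟨M1, hM1, m1⟩ := cpt_bdd (φ := fun t => gagliardoSqE (s - 1) (deriv (P.Γ t))) fun t ht => by
      have h3 := (P.memV t ht).2.2.ne
      have h4 := (P.mem t ht).1.2.2.ne
      refine ⟨(ENNReal.ofReal 2 * (ENNReal.ofReal 1 * (ENNReal.ofReal 2 * (ENNReal.ofReal ((1 / sobC s) ^ 2) +
        gagliardoSqE (s - 1) (deriv (P.V t)))) + gagliardoSqE (s - 1) (deriv (P.Γ t)))).toReal, ?_⟩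
      filter_upwards [P.diffq hs ht one_pos, self_mem_nhdsWithin] with τ hτ hτ1
      rw [ENNReal.ofReal_toReal (ENNReal.mul_ne_top ENNReal.ofReal_ne_top (ENNReal.add_ne_top.2
        ⟨ENNReal.mul_ne_top ENNReal.ofReal_ne_top (ENNReal.mul_ne_top ENNReal.ofReal_ne_top
        (ENNReal.add_ne_top.2 ⟨ENNReal.ofReal_ne_top, h3⟩)), h4⟩))]
      refine hτ.2.2.trans ?_
      gcongr
      nlinarith [hτ1.1, hτ1.2, ht.1, ht.2]
    obtain ⟨M2, hM2, m2⟩ := cpt_bdd (φ := fun t => gagliardoSqE (s - 1) (deriv (P.V t))) fun t ht => by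
      have h3 := (P.memV t ht).2.2.ne
      refine ⟨(ENNReal.ofReal 2 * (ENNReal.ofReal ((1 / sobC s) ^ 2) +
        gagliardoSqE (s - 1) (deriv (P.V t)))).toReal, ?_⟩
      filter_upwards [P.velo hs ht one_pos, self_mem_nhdsWithin] with τ hτ hτ1
      rw [ENNReal.ofReal_toReal (ENNReal.mul_ne_top ENNReal.ofReal_ne_top
        (ENNReal.add_ne_top.2 ⟨ENNReal.ofReal_ne_top, h3⟩))]
      exact hτ.2.2
    obtain ⟨K', hK', H⟩ := S6 hs (c := min c1 c2) (K := K1 + K2 + K3) (M := M1 + M2) (by positivity) (by positivity)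
    refine ⟨K', hK', fun t => ?_⟩
    have ee := cl_eq (cl_mem t)
    have ht := cl_mem t
    refine H n _ _ (imm t) (cdU t) (perU t) (fun x => (min_le_right _ _).trans ?_) (fun x => ?_) (fun x => ?_)
      (fun x => ?_) (fun x h hh => ?_) ?_ ?_
    · have := h2 (cl t) ht x; simpa only [ee] using this
    · have := k1 (cl t) ht x; simp only [ee] at this; linarith
    · have := k2 (cl t) ht x; simp only [ee] at this; linarith
    · have := k3 (cl t) ht x; simp only [ee] at this; linarith
    · have := h1 (cl t) ht x h hh; simp only [ee] at this
      refine le_trans ?_ this; gcongr; exact min_le_left _ _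
    · exact (m1 _ ht).trans (ENNReal.ofReal_le_ofReal (by linarith))
    · exact (m2 _ ht).trans (ENNReal.ofReal_le_ofReal (by linarith))
end path2

section time
variable {n : ℕ}

lemma ftc_abs {φ φ' q : ℝ → ℝ} (hφ : ContinuousOn φ (Icc 0 1)) (hd : ∀ t ∈ Ioo (0:ℝ) 1, HasDerivAt φ (φ' t) t)
    (hb : ∀ t ∈ Ioo (0:ℝ) 1, |φ' t| ≤ q t) (hq : Continuous q) (hq0 : ∀ t, 0 ≤ q t) {T : ℝ} (hT : T ∈ Icc (0:ℝ) 1) :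
    |φ T - φ 1| ≤ ∫ t in (0:ℝ)..1, q t := by
  have hQ : ∀ t, HasDerivAt (fun t => ∫ r in (0:ℝ)..t, q r) (q t) t := fun t =>
    intervalIntegral.integral_hasDerivAt_right (hq.intervalIntegrable _ _)
      (hq.stronglyMeasurableAtFilter _ _) hq.continuousAt
  set Q := fun t => ∫ r in (0:ℝ)..t, q r with hQd
  have cQ : Continuous Q := continuous_iff_continuousAt.2 fun t => (hQ t).continuousAt
  have h1 : MonotoneOn (fun t => Q t + φ t) (Icc 0 1) := by
    refine monotoneOn_of_deriv_nonneg (convex_Icc 0 1) (cQ.continuousOn.add hφ) ?_ ?_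
    · rw [interior_Icc]; exact fun t ht => ((hQ t).add (hd t ht)).differentiableAt.differentiableWithinAt
    · rw [interior_Icc]; intro t ht
      have e := ((hQ t).add (hd t ht)).deriv
      rw [show (fun t => Q t + φ t) = Q + φ from rfl, e]; linarith [(abs_le.1 (hb t ht)).1]
  have h2 : MonotoneOn (fun t => Q t - φ t) (Icc 0 1) := by
    refine monotoneOn_of_deriv_nonneg (convex_Icc 0 1) (cQ.continuousOn.sub hφ) ?_ ?_
    · rw [interior_Icc]; exact fun t ht => ((hQ t).sub (hd t ht)).differentiableAt.differentiableWithinAt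
    · rw [interior_Icc]; intro t ht
      have e := ((hQ t).sub (hd t ht)).deriv
      rw [show (fun t => Q t - φ t) = Q - φ from rfl, e]; linarith [(abs_le.1 (hb t ht)).2]
  have m1 : (1:ℝ) ∈ Icc (0:ℝ) 1 := ⟨zero_le_one, le_rfl⟩
  have a1 := h1 hT m1 hT.2
  have a2 := h2 hT m1 hT.2
  have a3 : 0 ≤ Q T := intervalIntegral.integral_nonneg hT.1 fun t _ => hq0 t
  simp only at a1 a2
  rw [abs_le]; constructor <;> linarith

lemma wcs {q : ℝ → ℝ → ℝ → ℝ} {g : ℝ → ℝ} (hq : Measurable fun p : ℝ × ℝ × ℝ => q p.1 p.2.1 p.2.2)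
    (hg : Measurable g) (g0 : ∀ t, 0 < g t) {K Λ : ℝ} (hK : 0 ≤ K) (hΛ : 0 ≤ Λ)
    (hgi : ∫⁻ t in I01, ENNReal.ofReal (g t) ≤ ENNReal.ofReal Λ)
    (hb : ∀ t ∈ I01, lint2 (fun x y => q t x y ^ 2) ≤ ENNReal.ofReal (K * g t ^ 2)) (q0 : ∀ t x y, 0 ≤ q t x y) :
    ∫⁻ x in I01, ∫⁻ y in I01, (∫⁻ t in I01, ENNReal.ofReal (q t x y)) ^ 2 ≤ ENNReal.ofReal (K * Λ ^ 2) := by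
  let H : ℝ → ℝ → ℝ → ℝ≥0∞ := fun t x y => ENNReal.ofReal (q t x y ^ 2 / g t)
  have mH : Measurable fun p : ℝ × ℝ × ℝ => H p.1 p.2.1 p.2.2 :=
    ((hq.pow_const 2).div (hg.comp measurable_fst)).ennreal_ofReal
  have pt : ∀ x y, (∫⁻ t in I01, ENNReal.ofReal (q t x y)) ^ 2 ≤ ENNReal.ofReal Λ * ∫⁻ t in I01, H t x y := by
    intro x y
    have mq : Measurable fun t => q t x y := hq.comp (by fun_prop : Measurable fun t : ℝ => (t, x, y))
    have := cs_lint (μ := volume.restrict I01) (f := fun t => ENNReal.ofReal (q t x y / √(g t)))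
      (g := fun t => ENNReal.ofReal (√(g t))) (mq.div hg.sqrt).ennreal_ofReal.aemeasurable
      hg.sqrt.ennreal_ofReal.aemeasurable
    have e1 : ∀ t, ENNReal.ofReal (q t x y / √(g t)) * ENNReal.ofReal (√(g t)) = ENNReal.ofReal (q t x y) := fun t => by
      have := Real.sqrt_pos.2 (g0 t)
      rw [← ENNReal.ofReal_mul (div_nonneg (q0 _ _ _) this.le)]; congr 1; field_simp
    have e2 : ∀ t, ENNReal.ofReal (q t x y / √(g t)) ^ 2 = H t x y := fun t => by
      rw [← ENNReal.ofReal_pow (div_nonneg (q0 _ _ _) (Real.sqrt_nonneg _)), div_pow, Real.sq_sqrt (g0 t).le]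
    have e3 : ∀ t, ENNReal.ofReal (√(g t)) ^ 2 = ENNReal.ofReal (g t) := fun t => by
      rw [← ENNReal.ofReal_pow (Real.sqrt_nonneg _), Real.sq_sqrt (g0 t).le]
    simp_rw [e1, e2, e3] at this
    rw [mul_comm]
    exact this.trans (mul_le_mul_right hgi _)
  have m1 : Measurable fun p : (ℝ × ℝ) × ℝ => H p.2 p.1.1 p.1.2 :=
    mH.comp (by fun_prop : Measurable fun p : (ℝ × ℝ) × ℝ => (p.2, p.1.1, p.1.2))
  calc _ ≤ ∫⁻ x in I01, ∫⁻ y in I01, ENNReal.ofReal Λ * ∫⁻ t in I01, H t x y := by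
        gcongr with x y; exact pt x y
    _ = ENNReal.ofReal Λ * ∫⁻ x in I01, ∫⁻ y in I01, ∫⁻ t in I01, H t x y := by
        simp_rw [lintegral_const_mul' _ _ ENNReal.ofReal_ne_top]
    _ = ENNReal.ofReal Λ * ∫⁻ t in I01, ∫⁻ x in I01, ∫⁻ y in I01, H t x y := by
        congr 1
        have s1 : ∀ x, ∫⁻ y in I01, ∫⁻ t in I01, H t x y = ∫⁻ t in I01, ∫⁻ y in I01, H t x y := fun x => by
          apply lintegral_lintegral_swap
          exact (mH.comp (by fun_prop : Measurable fun p : ℝ × ℝ => (p.2, x, p.1))).aemeasurable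
        simp_rw [s1]
        apply lintegral_lintegral_swap
        have m2 : Measurable fun p : (ℝ × ℝ) × ℝ => H p.1.2 p.1.1 p.2 :=
          mH.comp (by fun_prop : Measurable fun p : (ℝ × ℝ) × ℝ => (p.1.2, p.1.1, p.2))
        exact (m2.lintegral_prod_right' (ν := volume.restrict I01)).aemeasurable
    _ ≤ ENNReal.ofReal Λ * ∫⁻ t in I01, ENNReal.ofReal (K * g t) := by
        gcongr 1
        refine setLIntegral_mono' measurableSet_Ico fun t ht => ?_
        have e : ∀ x y, H t x y = ENNReal.ofReal ((g t)⁻¹) * ENNReal.ofReal (q t x y ^ 2) := fun x y => by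
          rw [← ENNReal.ofReal_mul (inv_nonneg.2 (g0 t).le)]; simp only [H]; congr 1; rw [div_eq_inv_mul]
        simp_rw [e, lintegral_const_mul' _ _ ENNReal.ofReal_ne_top]
        refine (mul_le_mul_right (hb t ht) _).trans (le_of_eq ?_)
        rw [← ENNReal.ofReal_mul (inv_nonneg.2 (g0 t).le)]
        congr 1; have := (g0 t).ne'; field_simp
    _ ≤ ENNReal.ofReal Λ * (ENNReal.ofReal K * ENNReal.ofReal Λ) := by
        gcongr
        simp_rw [ENNReal.ofReal_mul hK, lintegral_const_mul' _ _ ENNReal.ofReal_ne_top]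
        gcongr
    _ = _ := by rw [← ENNReal.ofReal_mul hK, ← ENNReal.ofReal_mul hΛ]; congr 1; ring

lemma hd_norm {a : ℝ → En n} {a' : En n} {t : ℝ} (h : HasDerivAt a a' t) (h0 : a t ≠ 0) :
    HasDerivAt (fun t => ‖a t‖) (⟪a t, a'⟫ / ‖a t‖) t := by
  have := (h.norm_sq).sqrt (by simpa using h0)
  simp only [Real.sqrt_sq (norm_nonneg _)] at this
  convert this using 1
  have : ‖a t‖ ≠ 0 := by simpa using h0
  field_simp

lemma dnorm_le (a a' : En n) : |⟪a, a'⟫ / ‖a‖| ≤ ‖a'‖ := by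
  rw [abs_div, abs_norm]
  exact div_le_of_le_mul₀ (norm_nonneg _) (norm_nonneg _) ((abs_real_inner_le_norm _ _).trans_eq (mul_comm _ _))

lemma dE {a e d : ℝ → En n} {a' e' d' : En n} {t : ℝ} (ha : HasDerivAt a a' t) (he : HasDerivAt e e' t)
    (hd : HasDerivAt d d' t) (ha0 : a t ≠ 0) (he0 : e t ≠ 0) (hd0 : d t ≠ 0) {m : ℝ} (hm : 0 ≤ m) :
    ∃ f', HasDerivAt (fun t => (‖d t‖ ^ 2 - ⟪a t, d t⟫ ^ 2 / ‖a t‖ ^ 2) * (‖a t‖ * ‖e t‖) * ‖d t‖ ^ (-m)) f' t ∧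
      |f'| ≤ (2 * (‖d t - (⟪a t, d t⟫ / ‖a t‖ ^ 2) • a t‖ * ‖d' - (⟪a t, d t⟫ / ‖a t‖ ^ 2) • a'‖) +
        ‖d t - (⟪a t, d t⟫ / ‖a t‖ ^ 2) • a t‖ ^ 2 * (‖a'‖ / ‖a t‖ + ‖e'‖ / ‖e t‖ + m * (‖d'‖ / ‖d t‖))) *
        ((‖a t‖ * ‖e t‖) * ‖d t‖ ^ (-m)) := by
  have na : 0 < ‖a t‖ := norm_pos_iff.2 ha0
  have ne : 0 < ‖e t‖ := norm_pos_iff.2 he0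
  have nd : 0 < ‖d t‖ := norm_pos_iff.2 hd0
  have h1 := ((hd.norm_sq).sub (((ha.inner ℝ hd).pow 2).div (ha.norm_sq) (by positivity)))
  have h2 := (hd_norm ha ha0).mul (hd_norm he he0)
  have h3 := (hd_norm hd hd0).rpow_const (p := -m) (Or.inl nd.ne')
  have h4 := (h1.mul h2).mul h3
  set N := d t - (⟪a t, d t⟫ / ‖a t‖ ^ 2) • a t with hN
  set Nu := d' - (⟪a t, d t⟫ / ‖a t‖ ^ 2) • a' with hNu
  have eN : ‖d t‖ ^ 2 - ⟪a t, d t⟫ ^ 2 / ‖a t‖ ^ 2 = ‖N‖ ^ 2 := by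
    rw [hN, norm_sub_sq_real, norm_smul, inner_smul_right, real_inner_comm, mul_pow, Real.norm_eq_abs, sq_abs]
    field_simp; ring
  have eNu : 2 * ⟪d t, d'⟫ - (2 * ⟪a t, d t⟫ * (⟪a t, d'⟫ + ⟪a', d t⟫) * ‖a t‖ ^ 2 -
      ⟪a t, d t⟫ ^ 2 * (2 * ⟪a t, a'⟫)) / (‖a t‖ ^ 2) ^ 2 = 2 * ⟪N, Nu⟫ := by
    rw [hN, hNu, inner_sub_left, inner_sub_right, inner_sub_right, inner_smul_left, inner_smul_left,
      inner_smul_right, inner_smul_right, real_inner_comm (d t) a']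
    simp only [RCLike.conj_to_real]
    field_simp; ring
  refine ⟨_, h4, ?_⟩
  simp only [Pi.sub_apply, Pi.mul_apply, Pi.div_apply, Pi.pow_apply, Nat.cast_ofNat, Nat.add_one_sub_one, pow_one]
  rw [eN, eNu]
  have r1 : ‖d t‖ ^ (-m - 1) = ‖d t‖ ^ (-m) / ‖d t‖ := by rw [Real.rpow_sub_one nd.ne']
  rw [r1]
  set p := ‖d t‖ ^ (-m) with hp
  have p0 : 0 < p := Real.rpow_pos_of_pos nd _
  have i1 : |⟪N, Nu⟫| ≤ ‖N‖ * ‖Nu‖ := abs_real_inner_le_norm _ _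
  have i2 := dnorm_le (a t) a'
  have i3 := dnorm_le (e t) e'
  have i4 := dnorm_le (d t) d'
  set X := ⟪N, Nu⟫
  set Y := ⟪a t, a'⟫ / ‖a t‖
  set Z := ⟪e t, e'⟫ / ‖e t‖
  set D := ⟪d t, d'⟫ / ‖d t‖
  have ee : (2 * X * (‖a t‖ * ‖e t‖) + ‖N‖ ^ 2 * (Y * ‖e t‖ + ‖a t‖ * Z)) * p +
      ‖N‖ ^ 2 * (‖a t‖ * ‖e t‖) * (D * (-m) * (p / ‖d t‖)) =
      (2 * X + ‖N‖ ^ 2 * (Y / ‖a t‖ + Z / ‖e t‖ - m * (D / ‖d t‖))) * ((‖a t‖ * ‖e t‖) * p) := by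
    field_simp
    ring
  rw [ee, abs_mul, abs_of_pos (show 0 < ‖a t‖ * ‖e t‖ * p by positivity)]
  refine mul_le_mul_of_nonneg_right ?_ (by positivity)
  refine (abs_add_le _ _).trans ?_
  rw [abs_mul, abs_mul, abs_two, abs_of_nonneg (sq_nonneg ‖N‖)]
  gcongr
  refine (abs_sub _ _).trans ?_
  refine add_le_add ((abs_add_le _ _).trans (add_le_add ?_ ?_)) ?_
  · rw [abs_div, abs_norm]; gcongr
  · rw [abs_div, abs_norm]; gcongr
  · rw [abs_mul, abs_div, abs_norm, abs_of_nonneg hm]; gcongr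
end time

section estep
variable {n : ℕ}

lemma num_q {N Nu Wx Wy V w m : ℝ} (hN : 0 ≤ N) (hNu : 0 ≤ Nu) (hx : 0 ≤ Wx) (hy : 0 ≤ Wy) (hV : 0 ≤ V)
    (hw : 0 ≤ w) (hm : 0 ≤ m) :
    (2 * (N * Nu) + N ^ 2 * (Wx + Wy + m * V)) * w ≤ 2 * √(N ^ 2 * w + 1) *
      (√(Nu ^ 2 * w) + m / 2 * √(N ^ 2 * V ^ 2 * w) + √(N ^ 2 * (Wx ^ 2 + Wy ^ 2) * w)) := by
  obtain ⟨r, hr, rfl⟩ : ∃ r, 0 ≤ r ∧ w = r ^ 2 := ⟨√w, Real.sqrt_nonneg _, (Real.sq_sqrt hw).symm⟩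
  have e1 : √(Nu ^ 2 * r ^ 2) = Nu * r := by rw [← mul_pow, Real.sqrt_sq (by positivity)]
  have e2 : √(N ^ 2 * V ^ 2 * r ^ 2) = N * V * r := by rw [← mul_pow, ← mul_pow, Real.sqrt_sq (by positivity)]
  have e3 : N * r * ((Wx + Wy) / 2) ≤ √(N ^ 2 * (Wx ^ 2 + Wy ^ 2) * r ^ 2) := by
    apply Real.le_sqrt_of_sq_le
    have : ((Wx + Wy) / 2) ^ 2 ≤ Wx ^ 2 + Wy ^ 2 := by nlinarith [sq_nonneg (Wx - Wy), sq_nonneg Wx, sq_nonneg Wy]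
    calc (N * r * ((Wx + Wy) / 2)) ^ 2 = N ^ 2 * ((Wx + Wy) / 2) ^ 2 * r ^ 2 := by ring
      _ ≤ _ := by gcongr
  have e4 : N * r ≤ √(N ^ 2 * r ^ 2 + 1) := by
    apply Real.le_sqrt_of_sq_le; rw [mul_pow]; linarith
  rw [e1, e2]
  calc _ = 2 * (N * r) * (Nu * r + m / 2 * (N * V * r) + N * r * ((Wx + Wy) / 2)) := by ring
    _ ≤ _ := by gcongr

def qq (s : ℝ) (γ u : ℝ → En n) (x y : ℝ) : ℝ :=
  √(b1 s γ u x y) + (2 * s + 1) / 2 * √(b2 s γ u x y) + √(b3 s γ u x y)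

lemma qq_nonneg {s : ℝ} (hs : 0 < s) (γ u : ℝ → En n) (x y : ℝ) : 0 ≤ qq s γ u x y := by
  unfold qq; positivity

lemma qq_sq {s : ℝ} (hs : 0 < s) (γ u : ℝ → En n) (x y : ℝ) :
    qq s γ u x y ^ 2 ≤ 3 * (b1 s γ u x y) + (3 * ((2 * s + 1) / 2) ^ 2) * b2 s γ u x y + 3 * b3 s γ u x y := by
  unfold qq
  have h1 := Real.sq_sqrt (b1_nonneg s γ u x y)
  have h2 := Real.sq_sqrt (b2_nonneg s γ u x y)
  have h3 := Real.sq_sqrt (b3_nonneg s γ u x y)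
  generalize √(b1 s γ u x y) = a at *
  generalize √(b2 s γ u x y) = b at *
  generalize √(b3 s γ u x y) = c at *
  rw [← h1, ← h2, ← h3]
  nlinarith [sq_nonneg (a - (2 * s + 1) / 2 * b), sq_nonneg (a - c), sq_nonneg ((2 * s + 1) / 2 * b - c)]

lemma meas_qq {A U : ℝ → ℝ → En n} (s : ℝ) (hA : Reg A) (hU : Reg U) :
    Measurable fun q : ℝ × ℝ × ℝ => qq s (A q.1) (U q.1) q.2.1 q.2.2 :=
  (((meas_b1 s hA hU).sqrt).add ((meas_b2 s hA hU).sqrt.const_mul _)).add (meas_b3 s hA hU).sqrt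

lemma lint2_qq {s : ℝ} (hs : 0 < s) {γ u : ℝ → En n} (hγ : ContDiff ℝ 1 γ) (hu : ContDiff ℝ 1 u) :
    lint2 (fun x y => qq s γ u x y ^ 2) ≤ ENNReal.ofReal (3 * (2 * s + 1)) * GE s γ u := by
  have m1 := slice (meas_b1 s (reg_const hγ) (reg_const hu))
  have m2 := slice (meas_b2 s (reg_const hγ) (reg_const hu))
  simp only at m1 m2
  refine (lint2_mono fun x _ y _ => qq_sq hs γ u x y).trans ?_
  have c1 : ∀ x y, 0 ≤ 3 * b1 s γ u x y := fun x y => by linarith [b1_nonneg s γ u x y]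
  have c2 : ∀ x y, 0 ≤ (3 * ((2 * s + 1) / 2) ^ 2) * b2 s γ u x y := fun x y =>
    mul_nonneg (by positivity) (b2_nonneg s γ u x y)
  rw [lint2_add ((m1.const_mul _).add (m2.const_mul _)) (fun x y => add_nonneg (c1 x y) (c2 x y))
    (fun x y => by linarith [b3_nonneg s γ u x y]), lint2_add (m1.const_mul _) c1 c2, lint2_mul (by norm_num),
    lint2_mul (by positivity), lint2_mul (by norm_num)]
  unfold GE
  rw [mul_add, mul_add, mul_add, mul_add, ← mul_assoc, ← mul_assoc, ← ENNReal.ofReal_mul (by positivity),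
    ← ENNReal.ofReal_mul (by positivity)]
  refine le_add_right (le_add_right ?_)
  have o : ∀ {p q : ℝ} {z : ℝ≥0∞}, p ≤ q → ENNReal.ofReal p * z ≤ ENNReal.ofReal q * z := fun h => by gcongr
  exact add_le_add (add_le_add (o (by linarith)) (o (by nlinarith))) (o (by linarith))

lemma b_w {s : ℝ} {γ : ℝ → En n} (u : ℝ → En n) {x y : ℝ} (hD : 0 < ‖γ y - γ x‖) :
    b1 s γ u x y = ‖Nop γ u x y‖ ^ 2 * (‖deriv γ x‖ * ‖deriv γ y‖ * ‖γ y - γ x‖ ^ (-(2 * s + 1))) ∧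
    b2 s γ u x y = ‖Nop γ γ x y‖ ^ 2 * (‖u y - u x‖ / ‖γ y - γ x‖) ^ 2 *
      (‖deriv γ x‖ * ‖deriv γ y‖ * ‖γ y - γ x‖ ^ (-(2 * s + 1))) ∧
    b3 s γ u x y = ‖Nop γ γ x y‖ ^ 2 * (‖Dg γ u x‖ ^ 2 + ‖Dg γ u y‖ ^ 2) *
      (‖deriv γ x‖ * ‖deriv γ y‖ * ‖γ y - γ x‖ ^ (-(2 * s + 1))) := by
  have h : ∀ v, b1 s γ v x y = ‖Nop γ v x y‖ ^ 2 * (‖deriv γ x‖ * ‖deriv γ y‖ * ‖γ y - γ x‖ ^ (-(2 * s + 1))) :=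
    fun v => by rw [b1_form hD, Real.rpow_neg hD.le]; ring
  refine ⟨h u, ?_, ?_⟩
  · have e : b2 s γ u x y = b1 s γ γ x y * (‖u y - u x‖ / ‖γ y - γ x‖) ^ 2 := by unfold b2 b1; rw [div_pow]; ring
    rw [e, h]; ring
  · have e : b3 s γ u x y = b1 s γ γ x y * (‖Dg γ u x‖ ^ 2 + ‖Dg γ u y‖ ^ 2) := by unfold b3 b1; ring
    rw [e, h]; ring

lemma Nop_eq (γ u : ℝ → En n) (x y : ℝ) :
    Nop γ u x y = (u y - u x) - (⟪deriv γ x, γ y - γ x⟫ / ‖deriv γ x‖ ^ 2) • deriv u x := by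
  unfold Nop; rw [← DDg_eq]; unfold DDg; rw [div_eq_inv_mul]

lemma Nop_sq {γ : ℝ → En n} {x y : ℝ} (h : deriv γ x ≠ 0) :
    ‖γ y - γ x‖ ^ 2 - ⟪deriv γ x, γ y - γ x⟫ ^ 2 / ‖deriv γ x‖ ^ 2 = ‖Nop γ γ x y‖ ^ 2 := by
  have : ‖deriv γ x‖ ≠ 0 := by simpa using h
  rw [Nop_eq, norm_sub_sq_real (γ y - γ x) (_ • _), norm_smul, inner_smul_right, real_inner_comm, mul_pow, Real.norm_eq_abs, sq_abs]
  field_simp; ring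

structure Spd (s : ℝ) (A U : ℝ → ℝ → En n) (g : ℝ → ℝ) (Λ : ℝ) : Prop where
  good : Good s A U
  mg : Measurable g
  g0 : ∀ t, 0 < g t
  gE : ∀ t, GE s (A t) (U t) ≤ ENNReal.ofReal (g t ^ 2)
  Λ0 : 0 ≤ Λ
  gi : ∫⁻ t in I01, ENNReal.ofReal (g t) ≤ ENNReal.ofReal Λ

variable {s : ℝ} {A U : ℝ → ℝ → En n} {g : ℝ → ℝ} {Λ : ℝ}

lemma Reg.ct (h : Reg A) (x : ℝ) : Continuous fun t => A t x :=
  h.1.comp (by fun_prop : Continuous fun t : ℝ => (t, x))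
lemma Reg.cdt (h : Reg A) (x : ℝ) : Continuous fun t => deriv (A t) x :=
  h.2.comp (by fun_prop : Continuous fun t : ℝ => (t, x))

lemma Good.pt (hG : Good s A U) (hs : 0 < s) {x y : ℝ} (hx : x ∈ I01) (hy : y ∈ I01) (hne : x ≠ y)
    {T : ℝ} (hT : T ∈ Icc (0:ℝ) 1) :
    |√(b1 s (A T) (A T) x y + 1) - √(b1 s (A 1) (A 1) x y + 1)| ≤ ∫ t in (0:ℝ)..1, qq s (A t) (U t) x y ∧
    Continuous (fun t => qq s (A t) (U t) x y) := by
  have hD : ∀ t, A t y - A t x ≠ 0 := fun t h => hne (hG.inj t hx hy (sub_eq_zero.1 h).symm)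
  have hDn : ∀ t, ‖A t y - A t x‖ ≠ 0 := fun t => norm_ne_zero_iff.2 (hD t)
  have c1 := hG.rA.ct x
  have c2 := hG.rA.ct y
  have c3 := hG.rA.cdt x
  have c4 := hG.rA.cdt y
  have c5 := hG.rU.ct x
  have c6 := hG.rU.ct y
  have c7 := hG.rU.cdt x
  have c8 := hG.rU.cdt y
  have h3 : ∀ t, ‖deriv (A t) x‖ ≠ 0 := fun t => norm_ne_zero_iff.2 ((hG.imm t).ne x)
  have h4 : ∀ t, ‖deriv (A t) y‖ ≠ 0 := fun t => norm_ne_zero_iff.2 ((hG.imm t).ne y)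
  have cD : Continuous fun t => ‖A t y - A t x‖ := (c2.sub c1).norm
  have cRop : ∀ W : ℝ → ℝ → En n, Reg W → Continuous fun t => Rop s (A t) (W t) x y := fun W hW => by
    unfold Rop DDg
    exact ((cD.rpow_const fun t => Or.inl (hDn t)).inv₀ fun t => (Real.rpow_pos_of_pos
      (norm_pos_iff.2 (hD t)) _).ne').smul (((hW.ct y).sub (hW.ct x)).sub
      ((((c3.norm.pow 2).inv₀ fun t => pow_ne_zero 2 (h3 t)).mul (c3.inner (c2.sub c1))).smul (hW.cdt x)))
  have cmu : Continuous fun t => muW (A t) x y := (c3.norm.mul c4.norm).div₀ cD hDn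
  have cb : ∀ W : ℝ → ℝ → En n, Reg W → Continuous fun t => b1 s (A t) (W t) x y := fun W hW =>
    ((cRop W hW).norm.pow 2).mul cmu
  have cA := cRop A hG.rA
  have cb2 : Continuous fun t => b2 s (A t) (U t) x y :=
    ((cA.norm.pow 2).mul (((c6.sub c5).norm.pow 2).div₀ (cD.pow 2) fun t => pow_ne_zero 2 (hDn t))).mul cmu
  have cb3 : Continuous fun t => b3 s (A t) (U t) x y :=
    ((cA.norm.pow 2).mul ((((c3.norm.inv₀ h3).smul c7).norm.pow 2).add
      (((c4.norm.inv₀ h4).smul c8).norm.pow 2))).mul cmu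
  have cq : Continuous (fun t => qq s (A t) (U t) x y) :=
    (((cb U hG.rU).sqrt).add (continuous_const.mul cb2.sqrt)).add cb3.sqrt
  refine ⟨?_, cq⟩
  have key : ∀ t ∈ Ioo (0:ℝ) 1, ∃ f', HasDerivAt (fun t => √(b1 s (A t) (A t) x y + 1)) f' t ∧
      |f'| ≤ qq s (A t) (U t) x y := by
    intro t ht
    obtain ⟨f', h1, h2⟩ := dE (hG.d1 t ht x) (hG.d1 t ht y) ((hG.d0 t ht y).sub (hG.d0 t ht x))
      ((hG.imm t).ne x) ((hG.imm t).ne y) (hD t) (m := 2 * s + 1) (by positivity)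
    simp only [Pi.sub_apply] at h1 h2
    have ef : ∀ t, (‖A t y - A t x‖ ^ 2 - ⟪deriv (A t) x, A t y - A t x⟫ ^ 2 / ‖deriv (A t) x‖ ^ 2) *
        (‖deriv (A t) x‖ * ‖deriv (A t) y‖) * ‖A t y - A t x‖ ^ (-(2 * s + 1)) = b1 s (A t) (A t) x y := fun t => by
      rw [(b_w (A t) (norm_pos_iff.2 (hD t))).1, Nop_sq ((hG.imm t).ne x)]; ring
    have h1' : HasDerivAt (fun t => b1 s (A t) (A t) x y) f' t := by
      refine h1.congr_of_eventuallyEq (Eventually.of_forall fun t => (ef t).symm)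
    rw [← Nop_eq, ← Nop_eq] at h2
    have f0 := b1_nonneg s (A t) (A t) x y
    refine ⟨_, (h1'.add_const 1).sqrt (by positivity), ?_⟩
    have sp : 0 < 2 * √(b1 s (A t) (A t) x y + 1) := by positivity
    rw [abs_div, abs_of_pos sp, div_le_iff₀ sp]
    have hq := num_q (norm_nonneg (Nop (A t) (A t) x y)) (norm_nonneg (Nop (A t) (U t) x y))
      (norm_nonneg (Dg (A t) (U t) x)) (norm_nonneg (Dg (A t) (U t) y))
      (show 0 ≤ ‖U t y - U t x‖ / ‖A t y - A t x‖ by positivity)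
      (show 0 ≤ ‖deriv (A t) x‖ * ‖deriv (A t) y‖ * ‖A t y - A t x‖ ^ (-(2 * s + 1)) by positivity)
      (show 0 ≤ 2 * s + 1 by positivity)
    obtain ⟨e1, e2, e3⟩ := b_w (s := s) (U t) (norm_pos_iff.2 (hD t))
    rw [← e1, ← e2, ← e3, ← (b_w (A t) (norm_pos_iff.2 (hD t))).1] at hq
    have d1 : ‖Dg (A t) (U t) x‖ = ‖deriv (U t) x‖ / ‖deriv (A t) x‖ := by
      rw [eq_div_iff (h3 t)]; exact norm_Dg_mul ((hG.imm t).ne x)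
    have d2 : ‖Dg (A t) (U t) y‖ = ‖deriv (U t) y‖ / ‖deriv (A t) y‖ := by
      rw [eq_div_iff (h4 t)]; exact norm_Dg_mul ((hG.imm t).ne y)
    rw [← d1, ← d2] at h2
    refine h2.trans (hq.trans_eq ?_)
    unfold qq; ring
  choose! f' k1 k2 using key
  exact ftc_abs (((cb A hG.rA).add continuous_const).sqrt.continuousOn) k1 k2 cq
    (fun t => qq_nonneg hs _ _ _ _) hT

lemma Spd.E (hS : Spd s A U g Λ) (hs : 0 < s) {M : ℝ} (hM : 0 ≤ M) (h1 : EtpE s (A 1) ≤ ENNReal.ofReal M)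
    {T : ℝ} (hT : T ∈ Icc (0:ℝ) 1) :
    EtpE s (A T) ≤ ENNReal.ofReal (2 * (M + 1) + 2 * (3 * (2 * s + 1) * Λ ^ 2)) := by
  have hG := hS.good
  have W := wcs (meas_qq s hG.rA hG.rU) hS.mg hS.g0 (K := 3 * (2 * s + 1)) (by positivity) hS.Λ0 hS.gi
    (fun t _ => (lint2_qq hs (hG.imm t).cd (hG.cdU t)).trans (by
      rw [ENNReal.ofReal_mul (by positivity : (0:ℝ) ≤ 3 * (2 * s + 1))]; exact mul_le_mul_right (hS.gE t) _)) (fun t x y => qq_nonneg hs _ _ _ _)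
  set Q : ℝ → ℝ → ℝ≥0∞ := fun x y => (∫⁻ t in I01, ENNReal.ofReal (qq s (A t) (U t) x y)) ^ 2 with hQ
  have pt : ∀ x ∈ I01, ∀ y ∈ I01, x ≠ y → ENNReal.ofReal (b1 s (A T) (A T) x y) ≤
      ENNReal.ofReal (2 * (b1 s (A 1) (A 1) x y + 1)) + 2 * Q x y := by
    intro x hx y hy hne
    obtain ⟨h, cq⟩ := hG.pt hs hx hy hne hT
    have i0 : 0 ≤ ∫ t in (0:ℝ)..1, qq s (A t) (U t) x y :=
      intervalIntegral.integral_nonneg (by norm_num) fun t _ => qq_nonneg hs _ _ _ _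
    have e : Q x y = ENNReal.ofReal ((∫ t in (0:ℝ)..1, qq s (A t) (U t) x y) ^ 2) := by
      rw [hQ, ENNReal.ofReal_pow i0, ofReal_int01 cq fun t => qq_nonneg hs _ _ _ _]
    rw [e, ← ENNReal.ofReal_ofNat 2, ← ENNReal.ofReal_mul (by norm_num), ← ENNReal.ofReal_add
      (by linarith [b1_nonneg s (A 1) (A 1) x y]) (by positivity)]
    apply ENNReal.ofReal_le_ofReal
    have a1 := Real.sq_sqrt (show 0 ≤ b1 s (A T) (A T) x y + 1 by linarith [b1_nonneg s (A T) (A T) x y])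
    have a2 := Real.sq_sqrt (show 0 ≤ b1 s (A 1) (A 1) x y + 1 by linarith [b1_nonneg s (A 1) (A 1) x y])
    have a3 := (abs_le.1 h).2
    have a4 := Real.sqrt_nonneg (b1 s (A T) (A T) x y + 1)
    have a5 := Real.sqrt_nonneg (b1 s (A 1) (A 1) x y + 1)
    generalize √(b1 s (A T) (A T) x y + 1) = p at *
    generalize √(b1 s (A 1) (A 1) x y + 1) = r at *
    generalize (∫ t in (0:ℝ)..1, qq s (A t) (U t) x y) = i at *
    nlinarith [sq_nonneg (r - i), mul_self_le_mul_self a4 (show p ≤ r + i by linarith)]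
  have mb : Measurable fun p : ℝ × ℝ => 2 * (b1 s (A 1) (A 1) p.1 p.2 + 1) :=
    ((slice (meas_b1 s (reg_const (hG.imm 1).cd) (reg_const (hG.imm 1).cd))).add_const 1).const_mul 2
  calc EtpE s (A T) ≤ ∫⁻ x in I01, ∫⁻ y in I01, (ENNReal.ofReal (2 * (b1 s (A 1) (A 1) x y + 1)) + 2 * Q x y) := by
        refine setLIntegral_mono' measurableSet_Ico fun x hx => ?_
        refine setLIntegral_mono_ae' measurableSet_Ico ?_
        have : ∀ᵐ y : ℝ, y ≠ x := by rw [ae_iff]; simp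
        filter_upwards [this] with y hy hy1
        exact pt x hx y hy1 hy.symm
    _ = lint2 (fun x y => 2 * (b1 s (A 1) (A 1) x y + 1)) + 2 * ∫⁻ x in I01, ∫⁻ y in I01, Q x y := by
        have : ∀ x, ∫⁻ y in I01, (ENNReal.ofReal (2 * (b1 s (A 1) (A 1) x y + 1)) + 2 * Q x y) =
            (∫⁻ y in I01, ENNReal.ofReal (2 * (b1 s (A 1) (A 1) x y + 1))) + 2 * ∫⁻ y in I01, Q x y := fun x => by
          have mx : Measurable fun y => ENNReal.ofReal (2 * (b1 s (A 1) (A 1) x y + 1)) :=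
            (mb.comp (by fun_prop : Measurable fun y : ℝ => (x, y))).ennreal_ofReal
          rw [lintegral_add_left mx,
            lintegral_const_mul' _ _ (by norm_num)]
        simp_rw [this]
        rw [lintegral_add_left (meas_inner mb), lintegral_const_mul' _ _ (by norm_num)]
        rfl
    _ ≤ ENNReal.ofReal (2 * (M + 1)) + 2 * ENNReal.ofReal (3 * (2 * s + 1) * Λ ^ 2) := by
        gcongr
        rw [lint2_mul (by norm_num), lint2_add (slice (meas_b1 s (reg_const (hG.imm 1).cd) (reg_const (hG.imm 1).cd)))
          (b1_nonneg _ _ _) (fun _ _ => zero_le_one), lint2_const, ENNReal.ofReal_mul (by norm_num),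
          ENNReal.ofReal_add hM zero_le_one]
        gcongr
        exact h1
    _ = _ := by
        rw [← ENNReal.ofReal_ofNat 2, ← ENNReal.ofReal_mul (by norm_num), ← ENNReal.ofReal_add (by positivity)
          (by positivity)]

lemma C1Path.spd (hs : 3 / 2 < s) (P : C1Path s n) : ∃ g, Spd s (fun t => P.Γ (cl t)) (fun t => P.V (cl t)) g
    (pathLen P + 1) := by
  have hG := P.good hs
  obtain ⟨K, hK, hb⟩ := hG.bdd
  set A := fun t => P.Γ (cl t) with hA
  set U := fun t => P.V (cl t) with hU
  have m1 : Measurable fun t => h1E (A t) (U t) := by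
    have : Measurable fun p : ℝ × ℝ => ENNReal.ofReal (‖Dg (A p.1) (U p.1) p.2‖ ^ 2 * ‖deriv (A p.1) p.2‖) :=
      ((((hG.rA.2.measurable.norm.inv).smul hG.rU.2.measurable).norm.pow_const 2).mul
        hG.rA.2.measurable.norm).ennreal_ofReal
    exact this.lintegral_prod_right' (ν := volume.restrict I01)
  have m2 : Measurable fun t => l2E (A t) (U t) := by
    have : Measurable fun p : ℝ × ℝ => ENNReal.ofReal (‖U p.1 p.2‖ ^ 2 * ‖deriv (A p.1) p.2‖) :=
      ((hG.rU.1.measurable.norm.pow_const 2).mul hG.rA.2.measurable.norm).ennreal_ofReal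
    exact this.lintegral_prod_right' (ν := volume.restrict I01)
  have mG : Measurable fun t => GE s (A t) (U t) := by
    unfold GE
    exact (((((meas_lint2 (meas_b1 s hG.rA hG.rU)).const_mul _).add ((meas_lint2 (meas_b2 s hG.rA hG.rU)).const_mul _)).add
      (meas_lint2 (meas_b3 s hG.rA hG.rU))).add m1).add m2
  have fin : ∀ t, GE s (A t) (U t) ≠ ⊤ := fun t => ((hb t).2.trans_lt ENNReal.ofReal_lt_top).ne
  set r : ℝ → ℝ := fun t => √((GE s (A t) (U t)).toReal) with hr
  have mr : Measurable r := mG.ennreal_toReal.sqrt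
  have r0 : ∀ t, 0 ≤ r t := fun t => Real.sqrt_nonneg _
  have rK : ∀ t, r t ≤ √K := fun t => Real.sqrt_le_sqrt (ENNReal.toReal_le_of_le_ofReal hK.le (hb t).2)
  have rG : ∀ t ∈ Icc (0:ℝ) 1, r t = √(Gmet s (P.Γ t) (P.V t) (P.V t)) := by
    intro t ht
    have e := Gmet_eq (by linarith) (hG.imm t).cd (hG.cdU t) (fin t)
    simp only [hr]
    have e1 : A t = P.Γ t := by simp only [hA, cl_eq ht]
    have e2 : U t = P.V t := by simp only [hU, cl_eq ht]
    rw [← e, e1, e2]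
    by_cases h : 0 ≤ Gmet s (P.Γ t) (P.V t) (P.V t)
    · rw [ENNReal.toReal_ofReal h]
    · rw [ENNReal.ofReal_of_nonpos (by linarith), Real.sqrt_eq_zero_of_nonpos (x := Gmet _ _ _ _) (by linarith)]
      simp
  have ir : IntervalIntegrable r volume 0 1 := by
    rw [intervalIntegrable_iff_integrableOn_Ioc_of_le (by norm_num)]
    exact Measure.integrableOn_of_bounded (M := √K) (by simp) mr.aestronglyMeasurable
      (ae_of_all _ fun t => by rw [Real.norm_of_nonneg (r0 t)]; exact rK t)
  have len : pathLen P = ∫ t in (0:ℝ)..1, r t := by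
    unfold pathLen
    refine intervalIntegral.integral_congr fun t ht => ?_
    rw [uIcc_of_le (by norm_num)] at ht
    exact (rG t ht).symm
  have len0 : 0 ≤ pathLen P := by
    rw [len]; exact intervalIntegral.integral_nonneg (by norm_num) fun t _ => r0 t
  refine ⟨fun t => r t + 1, hG, mr.add_const 1, fun t => by linarith [r0 t], fun t => ?_, by linarith, ?_⟩
  · rw [← ENNReal.ofReal_toReal (fin t)]
    apply ENNReal.ofReal_le_ofReal
    have := Real.sq_sqrt (show 0 ≤ (GE s (A t) (U t)).toReal from ENNReal.toReal_nonneg)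
    have := r0 t
    simp only [hr] at *
    nlinarith
  · have e1 : ∀ t, ENNReal.ofReal (r t + 1) = ENNReal.ofReal (r t) + 1 := fun t => by
      rw [ENNReal.ofReal_add (r0 t) zero_le_one, ENNReal.ofReal_one]
    simp_rw [e1]
    rw [lintegral_add_left mr.ennreal_ofReal, ENNReal.ofReal_add len0 zero_le_one, ENNReal.ofReal_one, len,
      intervalIntegral.integral_of_le (by norm_num), ofReal_integral_eq_lintegral_ofReal
      ((intervalIntegrable_iff_integrableOn_Ioc_of_le (by norm_num)).1 ir) (ae_of_all _ r0), I01,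
      setLIntegral_congr Ico_ae_eq_Ioc]
    gcongr
    simp
end estep

section speed
variable {n : ℕ} {s : ℝ} {A U : ℝ → ℝ → En n} {g : ℝ → ℝ} {Λ : ℝ}

lemma Spd.int (hS : Spd s A U g Λ) {ψ : ℝ → ℝ} (h : Continuous ψ) (h0 : ∀ t, 0 ≤ ψ t) {C : ℝ} (hC : 0 ≤ C)
    (hb : ∀ t ∈ Icc (0:ℝ) 1, ψ t ≤ C * g t) : ∫ t in (0:ℝ)..1, ψ t ≤ C * Λ := by
  rw [← ENNReal.ofReal_le_ofReal_iff (mul_nonneg hC hS.Λ0), ofReal_int01 h h0, ENNReal.ofReal_mul hC]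
  calc _ ≤ ∫⁻ t in I01, ENNReal.ofReal C * ENNReal.ofReal (g t) := by
        refine setLIntegral_mono' measurableSet_Ico fun t ht => ?_
        rw [← ENNReal.ofReal_mul hC]; exact ENNReal.ofReal_le_ofReal (hb t ⟨ht.1, ht.2.le⟩)
    _ = ENNReal.ofReal C * ∫⁻ t in I01, ENNReal.ofReal (g t) := lintegral_const_mul' _ _ ENNReal.ofReal_ne_top
    _ ≤ _ := mul_le_mul_right hS.gi _

lemma Good.cDg (hG : Good s A U) {W : ℝ → ℝ → En n} (hW : Reg W) (x : ℝ) : Continuous fun t => Dg (A t) (W t) x :=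
  ((hG.rA.cdt x).norm.inv₀ fun t => norm_ne_zero_iff.2 ((hG.imm t).ne x)).smul (hW.cdt x)

lemma Good.dlog (hG : Good s A U) (x : ℝ) {t : ℝ} (ht : t ∈ Ioo (0:ℝ) 1) :
    HasDerivAt (fun t => Real.log ‖deriv (A t) x‖) ⟪Dg (A t) (A t) x, Dg (A t) (U t) x⟫ t := by
  have n0 : ‖deriv (A t) x‖ ≠ 0 := norm_ne_zero_iff.2 ((hG.imm t).ne x)
  convert (hd_norm (hG.d1 t ht x) ((hG.imm t).ne x)).log n0 using 1
  unfold Dg; rw [inner_smul_left, inner_smul_right]; simp; field_simp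

lemma Good.clog (hG : Good s A U) (x : ℝ) : Continuous (fun t => Real.log ‖deriv (A t) x‖) :=
  (hG.rA.cdt x).norm.log fun t => norm_ne_zero_iff.2 ((hG.imm t).ne x)

lemma Good.log1 (hG : Good s A U) (x : ℝ) {T : ℝ} (hT : T ∈ Icc (0:ℝ) 1) :
    |Real.log ‖deriv (A T) x‖ - Real.log ‖deriv (A 1) x‖| ≤ ∫ t in (0:ℝ)..1, ‖Dg (A t) (U t) x‖ := by
  refine ftc_abs (hG.clog x).continuousOn (fun t ht => hG.dlog x ht) (fun t _ => ?_) (hG.cDg hG.rU x).norm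
    (fun t => norm_nonneg _) hT
  exact inner_le_D ((hG.imm t).ne x) _

def pp (γ u : ℝ → En n) (x y : ℝ) : ℝ :=
  ‖Dg γ u y - Dg γ u x‖ + ‖Dg γ u x‖ * ‖Dg γ γ y - Dg γ γ x‖

lemma pp_nonneg (γ u : ℝ → En n) (x y : ℝ) : 0 ≤ pp γ u x y := by unfold pp; positivity

lemma Good.cpp (hG : Good s A U) (x y : ℝ) : Continuous fun t => pp (A t) (U t) x y :=
  (((hG.cDg hG.rU y).sub (hG.cDg hG.rU x)).norm).add ((hG.cDg hG.rU x).norm.mul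
    ((hG.cDg hG.rA y).sub (hG.cDg hG.rA x)).norm)

lemma Good.log2 (hG : Good s A U) (x y : ℝ) {T : ℝ} (hT : T ∈ Icc (0:ℝ) 1) :
    |(Real.log ‖deriv (A T) y‖ - Real.log ‖deriv (A T) x‖) - (Real.log ‖deriv (A 1) y‖ - Real.log ‖deriv (A 1) x‖)|
      ≤ ∫ t in (0:ℝ)..1, pp (A t) (U t) x y := by
  refine ftc_abs (φ := fun t => Real.log ‖deriv (A t) y‖ - Real.log ‖deriv (A t) x‖)
    ((hG.clog y).sub (hG.clog x)).continuousOn (fun t ht => (hG.dlog y ht).sub (hG.dlog x ht)) (fun t _ => ?_)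
    (hG.cpp x y) (fun t => pp_nonneg _ _ _ _) hT
  have e : ⟪Dg (A t) (A t) y, Dg (A t) (U t) y⟫ - ⟪Dg (A t) (A t) x, Dg (A t) (U t) x⟫ =
      ⟪Dg (A t) (A t) y, Dg (A t) (U t) y - Dg (A t) (U t) x⟫ +
      ⟪Dg (A t) (A t) y - Dg (A t) (A t) x, Dg (A t) (U t) x⟫ := by
    rw [inner_sub_right, inner_sub_left]; ring
  rw [e]; unfold pp
  refine (abs_add_le _ _).trans (add_le_add (inner_le_D ((hG.imm t).ne y) _) ?_)
  rw [mul_comm]; exact abs_real_inner_le_norm _ _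

lemma Good.pos (hG : Good s A U) (hS : Spd s A U g Λ) {C : ℝ} (hC : 0 ≤ C)
    (hb : ∀ t ∈ Icc (0:ℝ) 1, ∀ x, ‖U t x‖ ≤ C * g t) (x : ℝ) {T : ℝ} (hT : T ∈ Icc (0:ℝ) 1) :
    ‖A T x - A 1 x‖ ≤ C * Λ := by
  set e := A T x - A 1 x with he
  by_cases h0 : ‖e‖ = 0
  · rw [h0]; exact mul_nonneg hC hS.Λ0
  have hp : 0 < ‖e‖ := lt_of_le_of_ne (norm_nonneg _) (Ne.symm h0)
  have h := ftc_abs (φ := fun t => ⟪e, A t x⟫) (φ' := fun t => ⟪e, U t x⟫) (q := fun t => ‖e‖ * ‖U t x‖)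
    (continuous_const.inner (hG.rA.ct x)).continuousOn
    (fun t ht => by simpa using (hasDerivAt_const t e).inner ℝ (hG.d0 t ht x)) (fun t _ => abs_real_inner_le_norm _ _)
    (continuous_const.mul (hG.rU.ct x).norm) (fun t => by positivity) hT
  rw [← inner_sub_right, ← he, real_inner_self_eq_norm_sq, abs_of_nonneg (by positivity),
    intervalIntegral.integral_const_mul, pow_two] at h
  exact (le_of_mul_le_mul_left h hp).trans (hS.int (hG.rU.ct x).norm (fun t => norm_nonneg _) hC
    fun t ht => hb t ht x)

lemma Spd.speed (hS : Spd s A U g Λ) {C c1 C1 : ℝ} (hC : 0 ≤ C) (hc1 : 0 < c1)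
    (hW : ∀ t ∈ Icc (0:ℝ) 1, ∀ x, ‖Dg (A t) (U t) x‖ ≤ C * g t)
    (h1 : ∀ x, c1 ≤ ‖deriv (A 1) x‖) (h2 : ∀ x, ‖deriv (A 1) x‖ ≤ C1) {T : ℝ} (hT : T ∈ Icc (0:ℝ) 1) (x : ℝ) :
    c1 * Real.exp (-(C * Λ)) ≤ ‖deriv (A T) x‖ ∧ ‖deriv (A T) x‖ ≤ C1 * Real.exp (C * Λ) := by
  have hG := hS.good
  have h := (hG.log1 x hT).trans (hS.int (hG.cDg hG.rU x).norm (fun t => norm_nonneg _) hC fun t ht => hW t ht x)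
  obtain ⟨a, b⟩ := abs_le.1 h
  have pT : 0 < ‖deriv (A T) x‖ := norm_pos_iff.2 ((hG.imm T).ne x)
  have p1 : 0 < ‖deriv (A 1) x‖ := hc1.trans_le (h1 x)
  have eT := Real.exp_log pT
  have e1 := Real.exp_log p1
  constructor
  · calc _ ≤ ‖deriv (A 1) x‖ * Real.exp (-(C * Λ)) := by gcongr; exact h1 x
      _ = Real.exp (Real.log ‖deriv (A 1) x‖ + -(C * Λ)) := by rw [Real.exp_add, e1]
      _ ≤ Real.exp (Real.log ‖deriv (A T) x‖) := by gcongr; linarith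
      _ = _ := eT
  · calc _ = Real.exp (Real.log ‖deriv (A T) x‖) := eT.symm
      _ ≤ Real.exp (Real.log ‖deriv (A 1) x‖ + C * Λ) := by gcongr; linarith
      _ = ‖deriv (A 1) x‖ * Real.exp (C * Λ) := by rw [Real.exp_add, e1]
      _ ≤ _ := by gcongr; exact h2 x
end speed

section hsb
variable {n : ℕ} {s : ℝ}

lemma log_a {a b C : ℝ} (ha : 0 < a) (hb : 0 < b) (h1 : a ≤ C) (h2 : b ≤ C) :
    |a - b| ≤ C * |Real.log a - Real.log b| := by
  have key : ∀ a b : ℝ, 0 < a → 0 < b → a ≤ C → a - b ≤ C * |Real.log a - Real.log b| := fun a b ha hb h => by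
    have := Real.log_le_sub_one_of_pos (div_pos hb ha)
    rw [Real.log_div hb.ne' ha.ne'] at this
    have h3 : a - b ≤ a * (Real.log a - Real.log b) := by
      have : a * (Real.log b - Real.log a) ≤ a * (b / a - 1) := by gcongr
      rw [mul_sub a (b / a), mul_div_cancel₀ _ ha.ne'] at this
      linarith
    calc _ ≤ a * (Real.log a - Real.log b) := h3
      _ ≤ a * |Real.log a - Real.log b| := by gcongr; exact le_abs_self _
      _ ≤ _ := by gcongr
  rw [abs_le]
  exact ⟨by linarith [abs_sub_comm (Real.log a) (Real.log b) ▸ key b a hb ha h2], key a b ha hb h1⟩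

lemma log_b {a b c : ℝ} (hc : 0 < c) (h1 : c ≤ a) (h2 : c ≤ b) :
    |Real.log a - Real.log b| ≤ |a - b| / c := by
  have key : ∀ a b : ℝ, c ≤ a → c ≤ b → Real.log a - Real.log b ≤ |a - b| / c := fun a b h1 h2 => by
    have ha := hc.trans_le h1
    have hb := hc.trans_le h2
    have := Real.log_le_sub_one_of_pos (div_pos ha hb)
    rw [Real.log_div ha.ne' hb.ne'] at this
    have e : a / b - 1 = (a - b) / b := by field_simp
    calc _ ≤ (a - b) / b := by linarith
      _ ≤ |a - b| / b := by gcongr; exact le_abs_self _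
      _ ≤ _ := by gcongr
  rw [abs_le]
  exact ⟨by linarith [abs_sub_comm a b ▸ key b a h2 h1], key a b h1 h2⟩

lemma dgam_le {γ : ℝ → En n} (hI : Imm γ) {C0 : ℝ} (hC : ∀ x, ‖deriv γ x‖ ≤ C0) (x y : ℝ) :
    ‖deriv γ y - deriv γ x‖ ≤ C0 * (|Real.log ‖deriv γ y‖ - Real.log ‖deriv γ x‖| + ‖Dg γ γ y - Dg γ γ x‖) := by
  have px := norm_pos_iff.2 (hI.ne x)
  have py := norm_pos_iff.2 (hI.ne y)
  have ex : ∀ z, deriv γ z = ‖deriv γ z‖ • Dg γ γ z := fun z => by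
    unfold Dg; rw [smul_smul, mul_inv_cancel₀ (norm_ne_zero_iff.2 (hI.ne z)), one_smul]
  have e : deriv γ y - deriv γ x = (‖deriv γ y‖ - ‖deriv γ x‖) • Dg γ γ y + ‖deriv γ x‖ • (Dg γ γ y - Dg γ γ x) := by
    conv_lhs => rw [ex y, ex x]
    module
  rw [e, mul_add]
  refine (norm_add_le _ _).trans (add_le_add ?_ ?_)
  · rw [norm_smul, Dg_unit (hI.ne y), mul_one]; exact log_a py px (hC y) (hC x)
  · rw [norm_smul, norm_norm]; gcongr; exact hC x

structure Unif (γ : ℝ → En n) (r0 c0 C0 : ℝ) : Prop where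
  imm : Imm γ
  rad : Rad γ r0
  lo : ∀ x, c0 ≤ ‖deriv γ x‖
  up : ∀ x, ‖deriv γ x‖ ≤ C0

variable {r0 c0 C0 h0 : ℝ} {γ : ℝ → En n}

lemma Unif.pair (h : Unif γ r0 c0 C0) (hc0 : 0 < c0) (hh : h0 ≤ 1) (hr : C0 * h0 ≤ r0) {x y : ℝ}
    (hd : 0 < dT x y) (hd' : dT x y ≤ h0) :
    Sgn γ x y ∧ 0 < ‖γ y - γ x‖ ∧ ‖γ y - γ x‖ ≤ C0 * dT x y := by
  obtain ⟨k, k1, k2⟩ := per_shift h.imm.per x y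
  have ey := k2 γ h.imm.per
  have eD := k2 (Dg γ γ) (Dg_per h.imm.per h.imm.per)
  have kk : |x + k - x| = dT x y := by rw [add_sub_cancel_left, k1]
  obtain ⟨o, l⟩ := loc_lower h.imm h.rad hc0 h.lo h.up hh hr (x := x) (y := x + k) (by rw [kk]; exact hd')
  refine ⟨?_, ?_, lip_per h.imm.cd h.imm.per h.up x y⟩
  · have := cone_sgn h.imm o (x := x) (y := x + k) ⟨min_le_left _ _, le_max_left _ _⟩ ⟨min_le_right _ _, le_max_right _ _⟩
    unfold Sgn at *; rw [ey, eD]; exact this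
  · rw [ey]; rw [kk] at l; exact lt_of_lt_of_le (by positivity) l

lemma Unif.wgt (h : Unif γ r0 c0 C0) (hs : 1 / 2 ≤ s) (hc0 : 0 < c0) {x y q F : ℝ} (hq : 0 ≤ q)
    (hd : 0 < dT x y) (hD : 0 < ‖γ y - γ x‖) (hD' : ‖γ y - γ x‖ ≤ C0 * dT x y)
    (hF : q / ‖γ y - γ x‖ ^ (2 * s - 1) * (‖deriv γ x‖ * ‖deriv γ y‖) ≤ F) :
    q / dT x y ^ (2 * s - 1) ≤ C0 ^ (2 * s - 1) / c0 ^ 2 * F := by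
  have C0p : 0 < C0 := hc0.trans_le ((h.lo x).trans (h.up x))
  have e0 : 0 ≤ 2 * s - 1 := by linarith
  have h1 : ‖γ y - γ x‖ ^ (2 * s - 1) ≤ C0 ^ (2 * s - 1) * dT x y ^ (2 * s - 1) := by
    rw [← Real.mul_rpow C0p.le hd.le]; gcongr
  have p1 : 0 < ‖γ y - γ x‖ ^ (2 * s - 1) := by positivity
  have p2 : 0 < dT x y ^ (2 * s - 1) := by positivity
  have hw : c0 ^ 2 ≤ ‖deriv γ x‖ * ‖deriv γ y‖ := by
    rw [pow_two]; exact mul_le_mul (h.lo x) (h.lo y) hc0.le (norm_nonneg _)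
  calc q / dT x y ^ (2 * s - 1) = q * C0 ^ (2 * s - 1) / (C0 ^ (2 * s - 1) * dT x y ^ (2 * s - 1)) := by field_simp
    _ ≤ q * C0 ^ (2 * s - 1) / ‖γ y - γ x‖ ^ (2 * s - 1) := by gcongr
    _ = C0 ^ (2 * s - 1) / c0 ^ 2 * (q / ‖γ y - γ x‖ ^ (2 * s - 1) * c0 ^ 2) := by field_simp
    _ ≤ C0 ^ (2 * s - 1) / c0 ^ 2 * (q / ‖γ y - γ x‖ ^ (2 * s - 1) * (‖deriv γ x‖ * ‖deriv γ y‖)) := by gcongr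
    _ ≤ _ := by gcongr

lemma Unif.ppl (h : Unif γ r0 c0 C0) (hs : 1 / 2 ≤ s) (hc0 : 0 < c0) (hh : h0 ≤ 1) (hr : C0 * h0 ≤ r0) {x y : ℝ}
    (hd : 0 < dT x y) (hd' : dT x y ≤ h0) (u : ℝ → En n) :
    pp γ u x y ^ 2 / dT x y ^ (2 * s - 1) ≤ C0 ^ (2 * s - 1) / c0 ^ 2 *
      (24 * (b1 s γ u x y + b1 s γ u y x + b3 s γ u x y + b3 s γ u y x)) := by
  obtain ⟨p1, p2, p3⟩ := h.pair hc0 hh hr hd hd'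
  apply h.wgt hs hc0 (by positivity) hd p2 p3
  have a1 := pw_W s u (h.imm.ne x) (h.imm.ne y) p2 p1
  have a2 := pw_Wtau s u (h.imm.ne x) (h.imm.ne y) p2 p1
  have n1 := b1_nonneg s γ u x y
  have n2 := b1_nonneg s γ u y x
  unfold pp
  set X := ‖Dg γ u y - Dg γ u x‖
  set Y := ‖Dg γ u x‖ * ‖Dg γ γ y - Dg γ γ x‖
  calc _ ≤ (2 * X ^ 2 + 2 * Y ^ 2) / ‖γ y - γ x‖ ^ (2 * s - 1) * (‖deriv γ x‖ * ‖deriv γ y‖) := by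
        gcongr; nlinarith [sq_nonneg (X - Y)]
    _ = 2 * (X ^ 2 / ‖γ y - γ x‖ ^ (2 * s - 1) * (‖deriv γ x‖ * ‖deriv γ y‖)) +
        2 * (Y ^ 2 / ‖γ y - γ x‖ ^ (2 * s - 1) * (‖deriv γ x‖ * ‖deriv γ y‖)) := by ring
    _ ≤ _ := by linarith

def ql (s h0 : ℝ) (γ u : ℝ → En n) (x y : ℝ) : ℝ :=
  if dT x y ≤ h0 then pp γ u x y / dT x y ^ ((2 * s - 1) / 2) else 0

lemma ql_nonneg (s h0 : ℝ) (γ u : ℝ → En n) (x y : ℝ) : 0 ≤ ql s h0 γ u x y := by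
  unfold ql; split_ifs
  · exact div_nonneg (pp_nonneg _ _ _ _) (Real.rpow_nonneg (dT_nonneg _ _) _)
  · exact le_rfl

lemma half_pow {d : ℝ} (hd : 0 ≤ d) (e : ℝ) : (d ^ (e / 2)) ^ 2 = d ^ e := by
  rw [← Real.rpow_natCast, ← Real.rpow_mul hd]; congr 1; push_cast; ring

lemma meas_ql {A U : ℝ → ℝ → En n} (s h0 : ℝ) (hA : Reg A) (hU : Reg U) :
    Measurable fun q : ℝ × ℝ × ℝ => ql s h0 (A q.1) (U q.1) q.2.1 q.2.2 := by
  have md : Measurable fun q : ℝ × ℝ × ℝ => dT q.2.1 q.2.2 :=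
    dT_meas.comp (by fun_prop : Measurable fun q : ℝ × ℝ × ℝ => (q.2.1, q.2.2))
  have mp : Measurable fun q : ℝ × ℝ × ℝ => pp (A q.1) (U q.1) q.2.1 q.2.2 :=
    ((meas_Dgy hA hU).sub (meas_Dgx hA hU)).norm.add ((meas_Dgx hA hU).norm.mul
      ((meas_Dgy hA hA).sub (meas_Dgx hA hA)).norm)
  exact Measurable.ite (measurableSet_le md measurable_const) (mp.div (md.pow_const _)) measurable_const

lemma Unif.lint_ql (h : Unif γ r0 c0 C0) (hs : 1 / 2 ≤ s) (hc0 : 0 < c0) (hh : h0 ≤ 1) (hr : C0 * h0 ≤ r0)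
    {u : ℝ → En n} (hu : ContDiff ℝ 1 u) :
    lint2 (fun x y => ql s h0 γ u x y ^ 2) ≤ ENNReal.ofReal (48 * (C0 ^ (2 * s - 1) / c0 ^ 2)) * GE s γ u := by
  have C0p : 0 < C0 := hc0.trans_le ((h.lo 0).trans (h.up 0))
  have m1 := slice (meas_b1 s (reg_const h.imm.cd) (reg_const hu))
  have m3 := slice (meas_b3 s (reg_const h.imm.cd) (reg_const hu))
  have st : lint2 (fun x y => ql s h0 γ u x y ^ 2) ≤ lint2 (fun x y => (24 * (C0 ^ (2 * s - 1) / c0 ^ 2)) *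
      (b1 s γ u x y + b1 s γ u y x + b3 s γ u x y + b3 s γ u y x)) := by
    refine lint2_mono_ne fun x hx y hy hne => ?_
    have n0 : 0 ≤ b1 s γ u x y + b1 s γ u y x + b3 s γ u x y + b3 s γ u y x := by
      linarith [b1_nonneg s γ u x y, b1_nonneg s γ u y x, b3_nonneg s γ u x y, b3_nonneg s γ u y x]
    unfold ql; split_ifs with hd
    · rw [div_pow, half_pow (dT_nonneg _ _)]
      refine (h.ppl hs hc0 hh hr (dT_pos hx hy hne) hd u).trans_eq (by ring)
    · simp only [ne_eq, OfNat.ofNat_ne_zero, not_false_eq_true, zero_pow]; positivity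
  refine st.trans ?_
  rw [lint2_mul (by positivity), lint2_4 m1 m3 (b1_nonneg s γ u) (b3_nonneg s γ u), ← mul_assoc,
    show (2 : ℝ≥0∞) = ENNReal.ofReal 2 by simp, ← ENNReal.ofReal_mul (by positivity),
    show 24 * (C0 ^ (2 * s - 1) / c0 ^ 2) * 2 = 48 * (C0 ^ (2 * s - 1) / c0 ^ 2) by ring]
  exact mul_le_mul_right (lint2_b13 s γ u) _

variable {A U : ℝ → ℝ → En n} {g : ℝ → ℝ} {Λ : ℝ}

lemma Good.ptg (hG : Good s A U) (hs : 1 / 2 ≤ s) (hU : ∀ t ∈ Icc (0:ℝ) 1, Unif (A t) r0 c0 C0) (hc0 : 0 < c0)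
    (h00 : 0 < h0) (hh : h0 ≤ 1) (hr : C0 * h0 ≤ r0) {T : ℝ} (hT : T ∈ Icc (0:ℝ) 1) {x y : ℝ} (hx : x ∈ I01)
    (hy : y ∈ I01) (hne : x ≠ y) :
    ENNReal.ofReal (‖deriv (A T) y - deriv (A T) x‖ ^ 2 / dT x y ^ (2 * s - 1)) ≤
      ENNReal.ofReal ((3 * C0 ^ 2 / c0 ^ 2) * (‖deriv (A 1) y - deriv (A 1) x‖ ^ 2 / dT x y ^ (2 * s - 1)) +
        (24 * C0 ^ 2 * (C0 ^ (2 * s - 1) / c0 ^ 2)) * (b1 s (A T) (A T) x y + b1 s (A T) (A T) y x) +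
        (2 * C0) ^ 2 / h0 ^ (2 * s - 1)) +
      ENNReal.ofReal (3 * C0 ^ 2) * (∫⁻ t in I01, ENNReal.ofReal (ql s h0 (A t) (U t) x y)) ^ 2 := by
  have h := hU T hT
  have C0p : 0 < C0 := hc0.trans_le ((h.lo x).trans (h.up x))
  have hd := dT_pos hx hy hne
  have bn : 0 ≤ b1 s (A T) (A T) x y + b1 s (A T) (A T) y x := add_nonneg (b1_nonneg _ _ _ _ _) (b1_nonneg _ _ _ _ _)
  by_cases hl : dT x y ≤ h0
  · obtain ⟨p1, p2, p3⟩ := h.pair hc0 hh hr hd hl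
    have ht := h.wgt hs hc0 (by positivity) hd p2 p3 (pw_tau s (h.imm.ne x) (h.imm.ne y) p2 p1)
    have e : ∀ t, ql s h0 (A t) (U t) x y = pp (A t) (U t) x y / dT x y ^ ((2 * s - 1) / 2) := fun t => if_pos hl
    have cq : Continuous fun t => ql s h0 (A t) (U t) x y := by simp_rw [e]; exact (hG.cpp x y).div_const _
    rw [← ofReal_int01 cq fun t => ql_nonneg _ _ _ _ _ _, ← ENNReal.ofReal_pow (intervalIntegral.integral_nonneg
      (by norm_num) fun t _ => ql_nonneg _ _ _ _ _ _), ← ENNReal.ofReal_mul (by positivity),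
      ← ENNReal.ofReal_add (by positivity) (by positivity)]
    apply ENNReal.ofReal_le_ofReal
    simp_rw [e]
    rw [intervalIntegral.integral_div, div_pow, half_pow hd.le]
    have l2 := hG.log2 x y hT
    have l1 := log_b hc0 ((hU 1 ⟨zero_le_one, le_rfl⟩).lo y) ((hU 1 ⟨zero_le_one, le_rfl⟩).lo x)
    have l0 := dgam_le h.imm h.up x y
    have l3 := abs_norm_sub_norm_le (deriv (A 1) y) (deriv (A 1) x)
    set I := ∫ t in (0:ℝ)..1, pp (A t) (U t) x y
    set τ := ‖Dg (A T) (A T) y - Dg (A T) (A T) x‖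
    set G := ‖deriv (A 1) y - deriv (A 1) x‖
    set K := C0 ^ (2 * s - 1) / c0 ^ 2
    set d := dT x y ^ (2 * s - 1)
    have d0 : 0 < d := by positivity
    have I0 : 0 ≤ I := (abs_nonneg _).trans l2
    have b : ‖deriv (A T) y - deriv (A T) x‖ ≤ C0 * (G / c0 + I + τ) := by
      refine l0.trans ?_
      gcongr
      have l4 : |‖deriv (A 1) y‖ - ‖deriv (A 1) x‖| / c0 ≤ G / c0 := by gcongr
      have := abs_sub_abs_le_abs_sub (Real.log ‖deriv (A T) y‖ - Real.log ‖deriv (A T) x‖)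
        (Real.log ‖deriv (A 1) y‖ - Real.log ‖deriv (A 1) x‖)
      linarith
    have b2 : ‖deriv (A T) y - deriv (A T) x‖ ^ 2 ≤ 3 * C0 ^ 2 * ((G / c0) ^ 2 + I ^ 2 + τ ^ 2) := by
      calc _ ≤ (C0 * (G / c0 + I + τ)) ^ 2 := by gcongr
        _ = C0 ^ 2 * (G / c0 + I + τ) ^ 2 := by ring
        _ ≤ C0 ^ 2 * (3 * ((G / c0) ^ 2 + I ^ 2 + τ ^ 2)) := by
            gcongr; nlinarith [sq_nonneg (G / c0 - I), sq_nonneg (G / c0 - τ), sq_nonneg (I - τ)]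
        _ = _ := by ring
    have l5 : 0 ≤ (2 * C0) ^ 2 / h0 ^ (2 * s - 1) := by positivity
    calc _ ≤ 3 * C0 ^ 2 * ((G / c0) ^ 2 + I ^ 2 + τ ^ 2) / d := by gcongr
      _ = 3 * C0 ^ 2 / c0 ^ 2 * (G ^ 2 / d) + 3 * C0 ^ 2 * (τ ^ 2 / d) + 3 * C0 ^ 2 * (I ^ 2 / d) := by
          field_simp; ring
      _ ≤ 3 * C0 ^ 2 / c0 ^ 2 * (G ^ 2 / d) + 3 * C0 ^ 2 * (K * (8 * (b1 s (A T) (A T) x y + b1 s (A T) (A T) y x)))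
          + 3 * C0 ^ 2 * (I ^ 2 / d) := by gcongr
      _ ≤ _ := by linarith
  · push Not at hl
    refine le_add_right (ENNReal.ofReal_le_ofReal ?_)
    have b : ‖deriv (A T) y - deriv (A T) x‖ ≤ 2 * C0 := (norm_sub_le _ _).trans (by linarith [h.up x, h.up y])
    have : ‖deriv (A T) y - deriv (A T) x‖ ^ 2 / dT x y ^ (2 * s - 1) ≤ (2 * C0) ^ 2 / h0 ^ (2 * s - 1) := by
      have : 0 ≤ 2 * s - 1 := by linarith
      gcongr
    have n1 : 0 ≤ (3 * C0 ^ 2 / c0 ^ 2) * (‖deriv (A 1) y - deriv (A 1) x‖ ^ 2 / dT x y ^ (2 * s - 1)) := by positivity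
    have n2 : 0 ≤ (24 * C0 ^ 2 * (C0 ^ (2 * s - 1) / c0 ^ 2)) * (b1 s (A T) (A T) x y + b1 s (A T) (A T) y x) := by
      positivity
    linarith

lemma gag_comb {F1 F2 : ℝ → ℝ → ℝ} {H Q : ℝ → ℝ → ℝ≥0∞} {a b c d E1 E2 X : ℝ}
    (m1 : Measurable fun p : ℝ × ℝ => F1 p.1 p.2) (m2 : Measurable fun p : ℝ × ℝ => F2 p.1 p.2)
    (n1 : ∀ x y, 0 ≤ F1 x y) (n2 : ∀ x y, 0 ≤ F2 x y) (ha : 0 ≤ a) (hb : 0 ≤ b) (hc : 0 ≤ c) (hd : 0 ≤ d)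
    (e1 : 0 ≤ E1) (e2 : 0 ≤ E2) (x0 : 0 ≤ X)
    (h1 : lint2 F1 ≤ ENNReal.ofReal E1) (h2 : lint2 F2 ≤ ENNReal.ofReal E2)
    (hQ : ∫⁻ x in I01, ∫⁻ y in I01, Q x y ≤ ENNReal.ofReal X)
    (hp : ∀ x ∈ I01, ∀ y ∈ I01, x ≠ y → H x y ≤ ENNReal.ofReal (a * F1 x y + b * F2 x y + c) +
      ENNReal.ofReal d * Q x y) :
    ∫⁻ x in I01, ∫⁻ y in I01, H x y ≤ ENNReal.ofReal (a * E1 + b * E2 + c + d * X) := by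
  have k1 : ∀ x y, 0 ≤ a * F1 x y := fun x y => mul_nonneg ha (n1 x y)
  have k2 : ∀ x y, 0 ≤ b * F2 x y := fun x y => mul_nonneg hb (n2 x y)
  have lF : lint2 (fun x y => a * F1 x y + b * F2 x y + c) ≤ ENNReal.ofReal (a * E1 + b * E2 + c) := by
    rw [lint2_add ((m1.const_mul _).add (m2.const_mul _)) (fun x y => add_nonneg (k1 x y) (k2 x y))
      (fun _ _ => hc), lint2_add (m1.const_mul _) k1 k2, lint2_const, lint2_mul ha, lint2_mul hb,
      ENNReal.ofReal_add (by positivity) hc, ENNReal.ofReal_add (by positivity) (by positivity),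
      ENNReal.ofReal_mul ha, ENNReal.ofReal_mul hb]
    exact add_le_add (add_le_add (mul_le_mul_right h1 _) (mul_le_mul_right h2 _)) le_rfl
  have mF : Measurable fun p : ℝ × ℝ => a * F1 p.1 p.2 + b * F2 p.1 p.2 + c :=
    ((m1.const_mul _).add (m2.const_mul _)).add_const _
  calc _ ≤ ∫⁻ x in I01, ∫⁻ y in I01,
        (ENNReal.ofReal (a * F1 x y + b * F2 x y + c) + ENNReal.ofReal d * Q x y) := by
        refine setLIntegral_mono' measurableSet_Ico fun x hx => ?_
        refine setLIntegral_mono_ae' measurableSet_Ico ?_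
        have : ∀ᵐ y : ℝ, y ≠ x := by rw [ae_iff]; simp
        filter_upwards [this] with y hy hy1
        exact hp x hx y hy1 hy.symm
    _ = lint2 (fun x y => a * F1 x y + b * F2 x y + c) + ENNReal.ofReal d * ∫⁻ x in I01, ∫⁻ y in I01, Q x y := by
        have : ∀ x, ∫⁻ y in I01, (ENNReal.ofReal (a * F1 x y + b * F2 x y + c) + ENNReal.ofReal d * Q x y) =
            (∫⁻ y in I01, ENNReal.ofReal (a * F1 x y + b * F2 x y + c)) + ENNReal.ofReal d * ∫⁻ y in I01, Q x y :=
          fun x => by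
          have mx : Measurable fun y => ENNReal.ofReal (a * F1 x y + b * F2 x y + c) :=
            (mF.comp (by fun_prop : Measurable fun y : ℝ => (x, y))).ennreal_ofReal
          rw [lintegral_add_left mx, lintegral_const_mul' _ _ ENNReal.ofReal_ne_top]
        simp_rw [this]
        rw [lintegral_add_left (meas_inner (F := fun x y => a * F1 x y + b * F2 x y + c) mF),
          lintegral_const_mul' _ _ ENNReal.ofReal_ne_top]
        rfl
    _ ≤ _ := by
        rw [ENNReal.ofReal_add (by positivity) (by positivity), ENNReal.ofReal_mul (p := d) hd]
        exact add_le_add lF (mul_le_mul_right hQ _)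

lemma meas_sym {F : ℝ → ℝ → ℝ} (h : Measurable fun p : ℝ × ℝ => F p.1 p.2) :
    Measurable fun p : ℝ × ℝ => F p.1 p.2 + F p.2 p.1 := h.add (h.comp measurable_swap)

lemma Spd.gag (hS : Spd s A U g Λ) (hs : 1 / 2 ≤ s) (hU : ∀ t ∈ Icc (0:ℝ) 1, Unif (A t) r0 c0 C0) (hc0 : 0 < c0)
    (h00 : 0 < h0) (hh : h0 ≤ 1) (hr : C0 * h0 ≤ r0) {T : ℝ} (hT : T ∈ Icc (0:ℝ) 1) {M B : ℝ} (hM : 0 ≤ M)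
    (hB : 0 ≤ B) (hE : EtpE s (A T) ≤ ENNReal.ofReal M) (hg : gagliardoSqE (s - 1) (deriv (A 1)) ≤ ENNReal.ofReal B) :
    gagliardoSqE (s - 1) (deriv (A T)) ≤ ENNReal.ofReal ((3 * C0 ^ 2 / c0 ^ 2) * B +
      (24 * C0 ^ 2 * (C0 ^ (2 * s - 1) / c0 ^ 2)) * (2 * M) + (2 * C0) ^ 2 / h0 ^ (2 * s - 1) +
      (3 * C0 ^ 2) * (48 * (C0 ^ (2 * s - 1) / c0 ^ 2) * Λ ^ 2)) := by
  have hG := hS.good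
  have C0p : 0 < C0 := hc0.trans_le (((hU T hT).lo 0).trans ((hU T hT).up 0))
  have q1 : 0 ≤ 3 * C0 ^ 2 / c0 ^ 2 := by positivity
  have q2 : 0 ≤ 24 * C0 ^ 2 * (C0 ^ (2 * s - 1) / c0 ^ 2) := by positivity
  have q3 : 0 ≤ (2 * C0) ^ 2 / h0 ^ (2 * s - 1) := by positivity
  have q4 : 0 ≤ 3 * C0 ^ 2 := by positivity
  have q5 : 0 ≤ 48 * (C0 ^ (2 * s - 1) / c0 ^ 2) * Λ ^ 2 := by positivity
  have W := wcs (meas_ql s h0 hG.rA hG.rU) hS.mg hS.g0 (K := 48 * (C0 ^ (2 * s - 1) / c0 ^ 2)) (by positivity)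
    hS.Λ0 hS.gi (fun t ht => ((hU t ⟨ht.1, ht.2.le⟩).lint_ql hs hc0 hh hr (hG.cdU t)).trans (by
      rw [ENNReal.ofReal_mul (p := 48 * (C0 ^ (2 * s - 1) / c0 ^ 2)) (by positivity)]
      exact mul_le_mul_right (hS.gE t) _)) (fun t x y => ql_nonneg _ _ _ _ _ _)
  have es : 2 * (s - 1) + 1 = 2 * s - 1 := by ring
  have mb := slice (meas_b1 s (reg_const (hG.imm T).cd) (reg_const (hG.imm T).cd))
  simp only at mb
  have mg := gag_meas ((hG.imm 1).cd.continuous_deriv le_rfl) (2 * s - 1)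
  unfold gagliardoSqE at hg ⊢
  rw [es] at hg ⊢
  refine gag_comb (F2 := fun x y => b1 s (A T) (A T) x y + b1 s (A T) (A T) y x) mg (meas_sym (F := b1 s (A T) (A T)) mb) (fun x y => div_nonneg (sq_nonneg _)
    (Real.rpow_nonneg (dT_nonneg _ _) _)) (fun x y => add_nonneg (b1_nonneg _ _ _ _ _) (b1_nonneg _ _ _ _ _))
    q1 q2 q3 q4 hB (mul_nonneg zero_le_two hM) q5 hg ?_ W
    (fun x hx y hy hne => hG.ptg hs hU hc0 h00 hh hr hT hx hy hne)
  rw [lint2_2 mb (b1_nonneg _ _ _), ENNReal.ofReal_mul (p := 2) (by norm_num),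
    show (2 : ℝ≥0∞) = ENNReal.ofReal 2 by simp]
  exact mul_le_mul_right hE _
end hsb

section ub
variable {n : ℕ} {s : ℝ}

structure UB (s : ℝ) (γ : ℝ → En n) (M B c0 C0 κ : ℝ) : Prop where
  imm : Imm γ
  gag : gagliardoSqE (s - 1) (deriv γ) ≤ ENNReal.ofReal (M ^ 2)
  b0 : ∀ x, ‖γ x‖ ≤ B
  lo : ∀ x, c0 ≤ ‖deriv γ x‖
  up : ∀ x, ‖deriv γ x‖ ≤ C0
  bil : ∀ x h, |h| ≤ 1 / 2 → κ * |h| ≤ ‖γ (x + h) - γ x‖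

lemma unif_bd (hs : 3 / 2 < s) {γ₀ : ℝ → En n} (h0 : InM s γ₀) (hE : EtpE s γ₀ ≠ ⊤) {R : ℝ} (hR : 0 ≤ R) :
    ∃ M B c0 C0 κ, 0 ≤ M ∧ 0 < c0 ∧ 0 < κ ∧ ∀ P : C1Path s n, P.Γ 1 = γ₀ → pathLen P ≤ R →
      UB s (P.Γ 0) M B c0 C0 κ := by
  have hI := h0.imm
  have cd' : Continuous (deriv γ₀) := hI.cd.continuous_deriv le_rfl
  obtain ⟨C1, C1p, hC1⟩ := per_bdd cd' (deriv_per hI.per)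
  obtain ⟨K, Kp, hK⟩ := per_bdd hI.cd.continuous hI.per
  obtain ⟨c1, c1p, hc1⟩ := cpt_low' (F := fun _ => deriv γ₀) (cd'.comp continuous_snd) (fun _ => deriv_per hI.per)
    (fun _ => hI.ne)
  replace hc1 := hc1 0 ⟨le_rfl, zero_le_one⟩
  set M0 := (EtpE s γ₀).toReal with hM0
  have M00 : 0 ≤ M0 := ENNReal.toReal_nonneg
  have hE0 : EtpE s γ₀ ≤ ENNReal.ofReal M0 := (ENNReal.ofReal_toReal hE).ge
  set B0 := (gagliardoSqE (s - 1) (deriv γ₀)).toReal with hB0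
  have hB00 : gagliardoSqE (s - 1) (deriv γ₀) ≤ ENNReal.ofReal B0 := (ENNReal.ofReal_toReal h0.1.2.2.ne).ge
  have B00 : 0 ≤ B0 := ENNReal.toReal_nonneg
  clear_value M0 B0
  obtain ⟨M1, hM1⟩ : ∃ M1, M1 = 2 * (M0 + 1) + 2 * (3 * (2 * s + 1) * (R + 1) ^ 2) := ⟨_, rfl⟩
  have M1p : 0 < M1 := by rw [hM1]; positivity
  obtain ⟨r0, r0p, H1⟩ := S1 hs M1 M1p
  obtain ⟨C, Cp, H2⟩ := S2 hs r0 r0p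
  obtain ⟨c0, hc0⟩ : ∃ c0, c0 = c1 * Real.exp (-(C * (R + 1))) := ⟨_, rfl⟩
  obtain ⟨C0, hC0⟩ : ∃ C0, C0 = C1 * Real.exp (C * (R + 1)) := ⟨_, rfl⟩
  have c0p : 0 < c0 := by rw [hc0]; positivity
  have C0p : 0 < C0 := by rw [hC0]; positivity
  obtain ⟨κ, κp, H3⟩ := S3 hs r0 c0 C0 M1 r0p c0p C0p M1p
  obtain ⟨h0, hh0⟩ : ∃ h0, h0 = min 1 (r0 / C0) := ⟨_, rfl⟩
  have h00 : 0 < h0 := by rw [hh0]; positivity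
  have h01 : h0 ≤ 1 := hh0 ▸ min_le_left _ _
  have h0r : C0 * h0 ≤ r0 := by
    have : h0 ≤ r0 / C0 := hh0 ▸ min_le_right _ _
    rw [le_div_iff₀ C0p] at this; linarith
  obtain ⟨N, hN⟩ : ∃ N, N = (3 * C0 ^ 2 / c0 ^ 2) * B0 +
      (24 * C0 ^ 2 * (C0 ^ (2 * s - 1) / c0 ^ 2)) * (2 * M1) + (2 * C0) ^ 2 / h0 ^ (2 * s - 1) +
      (3 * C0 ^ 2) * (48 * (C0 ^ (2 * s - 1) / c0 ^ 2) * (R + 1) ^ 2) := ⟨_, rfl⟩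
  have N0 : 0 ≤ N := by rw [hN]; positivity
  have C2p : 0 ≤ 1 / 2 + 1 / (2 * c0) + C * C0 := by positivity
  refine ⟨√N, K + (1 / 2 + 1 / (2 * c0) + C * C0) * (R + 1), c0, C0, κ, by positivity, c0p, κp, fun P hP hL => ?_⟩
  obtain ⟨g, hS0⟩ := P.spd hs
  have hS : Spd s (fun t => P.Γ (cl t)) (fun t => P.V (cl t)) g (R + 1) :=
    ⟨hS0.good, hS0.mg, hS0.g0, hS0.gE, by linarith, hS0.gi.trans (ENNReal.ofReal_le_ofReal (by linarith))⟩
  have z0 : (0:ℝ) ∈ Icc (0:ℝ) 1 := ⟨le_rfl, zero_le_one⟩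
  have e0 : P.Γ 0 = (fun t => P.Γ (cl t)) 0 := by simp only [cl_eq z0]
  have e1 : (fun t => P.Γ (cl t)) 1 = γ₀ := by
    simp only [cl_eq (show (1:ℝ) ∈ Icc (0:ℝ) 1 from ⟨zero_le_one, le_rfl⟩), hP]
  rw [e0]
  generalize (fun t => P.Γ (cl t)) = A at hS e1 ⊢
  generalize (fun t => P.V (cl t)) = U at hS
  clear hS0 e0 hP hL P
  have hG := hS.good
  subst e1
  have E1 : ∀ t ∈ Icc (0:ℝ) 1, EtpE s (A t) ≤ ENNReal.ofReal M1 := fun t ht => by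
    rw [hM1]; exact hS.E (by linarith) M00 hE0 ht
  have R1 : ∀ t ∈ Icc (0:ℝ) 1, Rad (A t) r0 := fun t ht => H1 n _ (hG.imm t) (E1 t ht)
  have W1 : ∀ t ∈ Icc (0:ℝ) 1, ∀ x, ‖Dg (A t) (U t) x‖ ≤ C * g t := fun t ht =>
    H2 n _ _ (hG.imm t) (R1 t ht) (hG.cdU t) (hG.perU t) _ (hS.g0 t) (hS.gE t)
  have Un : ∀ t ∈ Icc (0:ℝ) 1, Unif (A t) r0 c0 C0 := fun t ht =>
    ⟨hG.imm t, R1 t ht, fun x => hc0 ▸ (hS.speed Cp.le c1p W1 hc1 hC1 ht x).1,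
      fun x => hC0 ▸ (hS.speed Cp.le c1p W1 hc1 hC1 ht x).2⟩
  refine ⟨hG.imm 0, ?_, fun x => ?_, (Un 0 z0).lo, (Un 0 z0).up,
    H3 n _ (hG.imm 0) (hG.inj 0) (R1 0 z0) (E1 0 z0) (Un 0 z0).lo (Un 0 z0).up⟩
  · rw [Real.sq_sqrt N0, hN]
    exact hS.gag (by linarith) Un c0p h00 h01 h0r z0 M1p.le B00 (E1 0 z0) hB00
  · have := hG.pos hS C2p (fun t ht => sup_u (hG.imm t) (hG.cdU t) (hG.perU t) c0p (Un t ht).lo (Un t ht).up Cp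
      (hS.g0 t) (hS.gE t) (W1 t ht)) x z0
    have := norm_sub_norm_le (A 0 x) (A 1 x)
    linarith [hK x]

lemma etp_fin (hs : 3 / 2 < s) (P : C1Path s n) : EtpE s (P.Γ 1) ≠ ⊤ := by
  obtain ⟨K, -, h⟩ := (P.good hs).bdd
  have := (h 1).1
  simp only [cl_eq (show (1:ℝ) ∈ Icc (0:ℝ) 1 from ⟨zero_le_one, le_rfl⟩)] at this
  exact (this.trans_lt ENNReal.ofReal_lt_top).ne

lemma gb_unif (hs : 3 / 2 < s) {U : Set (ℝ → En n)} (hU : GBounded s U) {γ₁ : ℝ → En n} (hm : γ₁ ∈ U) :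
    ∃ M B c0 C0 κ, 0 ≤ M ∧ 0 < c0 ∧ 0 < κ ∧ ∀ γ ∈ U, UB s γ M B c0 C0 κ := by
  obtain ⟨hM, γ₀, h0, R, hR⟩ := hU
  have key : ∀ γ ∈ U, ∃ P : C1Path s n, (P.Γ 0 = γ ∧ P.Γ 1 = γ₀) ∧ pathLen P ≤ |R| + 1 := fun γ hγ => by
    by_contra hc
    push Not at hc
    have : ENNReal.ofReal (|R| + 1) ≤ geodDist s γ γ₀ :=
      le_iInf fun P => le_iInf fun hP => ENNReal.ofReal_le_ofReal (hc P hP).le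
    have := this.trans (hR γ hγ)
    rcases ENNReal.ofReal_le_ofReal_iff'.1 this with h | h <;> linarith [le_abs_self R, abs_nonneg R]
  obtain ⟨P, hP, -⟩ := key γ₁ hm
  obtain ⟨M, B, c0, C0, κ, a, b, c, H⟩ := unif_bd hs h0 (hP.2 ▸ etp_fin hs P) (R := |R| + 1) (by positivity)
  refine ⟨M, B, c0, C0, κ, a, b, c, fun γ hγ => ?_⟩
  obtain ⟨P, hP, hL⟩ := key γ hγ
  exact hP.1 ▸ H P hP.2 hL
end ub

section cpct
variable {n : ℕ} {s M B c0 C0 κ : ℝ}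

lemma cpct_seq {β : Type*} [NormedAddCommGroup β] [ProperSpace β] {F : ℕ → ℝ → β} (hc : ∀ k, Continuous (F k))
    (hp : ∀ k, Function.Periodic (F k) 1) {R : ℝ} (hR : ∀ k x, ‖F k x‖ ≤ R) {b : ℝ → ℝ}
    (hb : Tendsto b (𝓝 0) (𝓝 0)) (H : ∀ k x y, ‖F k x - F k y‖ ≤ b |x - y|) :
    ∃ (f : ℝ → β) (φ : ℕ → ℕ), StrictMono φ ∧ Function.Periodic f 1 ∧
      TendstoUniformly (fun k => F (φ k)) f atTop := by
  let G : ℕ → BoundedContinuousFunction (Icc (0:ℝ) 1) β := fun k =>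
    BoundedContinuousFunction.mkOfCompact ⟨fun x => F k x, (hc k).comp continuous_subtype_val⟩
  have hG : ∀ k x, G k x = F k x := fun k x => rfl
  have K := BoundedContinuousFunction.arzela_ascoli (Metric.closedBall (0:β) R) (isCompact_closedBall _ _)
    (range G) (by rintro _ x ⟨k, rfl⟩; simpa [hG] using hR k x)
    (Metric.equicontinuous_of_continuity_modulus b hb _ (by
      rintro x y ⟨_, k, rfl⟩
      rw [dist_eq_norm, Subtype.dist_eq, Real.dist_eq]; exact H k x y))
  obtain ⟨g, -, φ, hφ, hl⟩ := K.tendsto_subseq (x := G) fun k => subset_closure ⟨k, rfl⟩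
  have fm : ∀ x : ℝ, Int.fract x ∈ Icc (0:ℝ) 1 := fun x => ⟨Int.fract_nonneg x, (Int.fract_lt_one x).le⟩
  refine ⟨fun x => g ⟨Int.fract x, fm x⟩, φ, hφ, fun x => by simp [Int.fract_add_one], ?_⟩
  rw [Metric.tendstoUniformly_iff]
  intro ε hε
  filter_upwards [(Metric.tendsto_nhds.1 hl) ε hε] with k hk x
  have : F (φ k) x = G (φ k) ⟨Int.fract x, fm x⟩ := by
    rw [hG]; have := (hp (φ k)).sub_int_mul_eq ⌊x⌋ (x := x); rw [mul_one] at this; exact this.symm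
  rw [this, dist_comm]
  exact (BoundedContinuousFunction.dist_coe_le_dist _).trans_lt hk

lemma UB.hol (hs : 3 / 2 < s) (hM : 0 ≤ M) {γ : ℝ → En n} (h : UB s γ M B c0 C0 κ) (x y : ℝ) :
    ‖(γ x, deriv γ x) - (γ y, deriv γ y)‖ ≤
      2 * morC (s - 3 / 2) * (M + 1) * |x - y| ^ (s - 3 / 2) + 4 * C0 * |x - y| := by
  have C0n : 0 ≤ C0 := (norm_nonneg _).trans (h.up 0)
  have m := morC_pos (show 0 < s - 3 / 2 by linarith)
  have p := Real.rpow_nonneg (abs_nonneg (x - y)) (s - 3 / 2)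
  have q : 0 ≤ 2 * morC (s - 3 / 2) * (M + 1) * |x - y| ^ (s - 3 / 2) := by positivity
  have r : 0 ≤ C0 * |x - y| := by positivity
  rw [Prod.mk_sub_mk, Prod.norm_mk]
  refine max_le ?_ ?_
  · have := cd_lip h.imm.cd h.up y x
    linarith
  · by_cases hl : |x - y| ≤ 1 / 2
    · have := holder1 hs (h.imm.cd.continuous_deriv le_rfl) (deriv_per h.imm.per) (B := M + 1) (by linarith)
        (h.gag.trans (ENNReal.ofReal_le_ofReal (by nlinarith))) hl
      linarith
    · push Not at hl
      have := norm_sub_le (deriv γ x) (deriv γ y)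
      nlinarith [h.up x, h.up y]

lemma C1_cpct (hs : 3 / 2 < s) (hM : 0 ≤ M) {γk : ℕ → ℝ → En n} (h : ∀ k, UB s (γk k) M B c0 C0 κ) :
    ∃ (γ : ℝ → En n) (φ : ℕ → ℕ), StrictMono φ ∧ Function.Periodic γ 1 ∧ ContDiff ℝ 1 γ ∧
      (∀ x, Tendsto (fun k => γk (φ k) x) atTop (𝓝 (γ x))) ∧
      (∀ x, Tendsto (fun k => deriv (γk (φ k)) x) atTop (𝓝 (deriv γ x))) := by
  have hb : Tendsto (fun t : ℝ => 2 * morC (s - 3 / 2) * (M + 1) * |t| ^ (s - 3 / 2) + 4 * C0 * |t|) (𝓝 0) (𝓝 0) := by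
    have : Continuous (fun t : ℝ => 2 * morC (s - 3 / 2) * (M + 1) * |t| ^ (s - 3 / 2) + 4 * C0 * |t|) :=
      (continuous_const.mul (continuous_abs.rpow_const fun _ => Or.inr (by linarith))).add
        (continuous_const.mul continuous_abs)
    have := this.tendsto 0
    simpa [Real.zero_rpow (show s - 3 / 2 ≠ 0 by linarith)] using this
  obtain ⟨f, φ, hφ, hp, hl⟩ := cpct_seq (F := fun k x => (γk k x, deriv (γk k) x)) (R := max B C0) (b := fun t : ℝ =>
      2 * morC (s - 3 / 2) * (M + 1) * |t| ^ (s - 3 / 2) + 4 * C0 * |t|)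
    (fun k => (h k).imm.cd.continuous.prodMk ((h k).imm.cd.continuous_deriv le_rfl))
    (fun k x => Prod.ext ((h k).imm.per x) (deriv_per (h k).imm.per x))
    (fun k x => by rw [Prod.norm_mk]; exact max_le_max ((h k).b0 x) ((h k).up x)) hb
    (fun k x y => by simpa only [abs_abs] using (h k).hol hs hM x y)
  have hl2 : TendstoUniformly (fun k => deriv (γk (φ k))) (fun x => (f x).2) atTop :=
    uniformContinuous_snd.comp_tendstoUniformly hl
  have l1 : ∀ x, Tendsto (fun k => γk (φ k) x) atTop (𝓝 (f x).1) := fun x =>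
    (continuous_fst.tendsto _).comp (hl.tendsto_at x)
  have hd : ∀ x, HasDerivAt (fun x => (f x).1) (f x).2 x := fun x =>
    hasDerivAt_of_tendstoUniformly hl2 (Eventually.of_forall fun k x => cd_hd (h (φ k)).imm.cd x) l1 x
  have de : deriv (fun x => (f x).1) = fun x => (f x).2 := funext fun x => (hd x).deriv
  refine ⟨fun x => (f x).1, φ, hφ, fun x => by simp only [hp x], ?_, l1, fun x => ?_⟩
  · rw [contDiff_one_iff_deriv, de]
    exact ⟨fun x => (hd x).differentiableAt, hl2.continuous (Frequently.of_forall fun k =>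
      (h (φ k)).imm.cd.continuous_deriv le_rfl)⟩
  · rw [de]; exact hl2.tendsto_at x

lemma gag_fatou {e : ℝ} {vk : ℕ → ℝ → En n} {v : ℝ → En n} (hc : ∀ k, Continuous (vk k))
    (hl : ∀ x, Tendsto (fun k => vk k x) atTop (𝓝 (v x))) {K : ℝ≥0∞} (hK : ∀ k, gagliardoSqE e (vk k) ≤ K) :
    gagliardoSqE e v ≤ K := by
  have m := fun k => gag_meas (hc k) (2 * e + 1)
  have pt : ∀ x y, liminf (fun k => ENNReal.ofReal (‖vk k y - vk k x‖ ^ 2 / dT x y ^ (2 * e + 1))) atTop =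
      ENNReal.ofReal (‖v y - v x‖ ^ 2 / dT x y ^ (2 * e + 1)) := fun x y =>
    (ENNReal.tendsto_ofReal ((((hl y).sub (hl x)).norm.pow 2).div_const _)).liminf_eq
  unfold gagliardoSqE at hK ⊢
  simp_rw [← pt]
  calc _ ≤ ∫⁻ x in I01, liminf (fun k => ∫⁻ y in I01,
        ENNReal.ofReal (‖vk k y - vk k x‖ ^ 2 / dT x y ^ (2 * e + 1))) atTop :=
        lintegral_mono fun x => lintegral_liminf_le fun k =>
          ((m k).comp (by fun_prop : Measurable fun y : ℝ => (x, y))).ennreal_ofReal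
    _ ≤ liminf (fun k => ∫⁻ x in I01, ∫⁻ y in I01,
        ENNReal.ofReal (‖vk k y - vk k x‖ ^ 2 / dT x y ^ (2 * e + 1))) atTop :=
        lintegral_liminf_le fun k => meas_inner (F := fun x y => ‖vk k y - vk k x‖ ^ 2 / dT x y ^ (2 * e + 1)) (m k)
    _ ≤ liminf (fun _ : ℕ => K) atTop := liminf_le_liminf (Eventually.of_forall hK)
    _ = K := liminf_const _

lemma lim_InM (hs : 3 / 2 < s) (hc : 0 < c0) (hκ : 0 < κ) {γk : ℕ → ℝ → En n} (h : ∀ k, UB s (γk k) M B c0 C0 κ)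
    {γ : ℝ → En n} (hp : Function.Periodic γ 1) (hd : ContDiff ℝ 1 γ)
    (l0 : ∀ x, Tendsto (fun k => γk k x) atTop (𝓝 (γ x)))
    (l1 : ∀ x, Tendsto (fun k => deriv (γk k) x) atTop (𝓝 (deriv γ x))) :
    InM s γ ∧ gagliardoSqE (s - 1) (deriv γ) ≤ ENNReal.ofReal (M ^ 2) := by
  have g := gag_fatou (fun k => (h k).imm.cd.continuous_deriv le_rfl) l1 fun k => (h k).gag
  refine ⟨⟨⟨hp, hd, g.trans_lt ENNReal.ofReal_lt_top⟩, fun x hx y hy e => ?_, fun x e => ?_⟩, g⟩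
  · by_contra hne
    have := ge_of_tendsto' ((l0 y).sub (l0 x)).norm fun k => low_per (h k).imm.per (h k).bil x y
    rw [e, sub_self, norm_zero] at this
    nlinarith [dT_pos hx hy hne]
  · have := ge_of_tendsto' (l1 x).norm fun k => (h k).lo x
    rw [e, norm_zero] at this; linarith
end cpct

section weak
variable {n : ℕ} {s M B c0 C0 κ : ℝ}

lemma wk_lim {α : Type*} [MeasurableSpace α] {μ : Measure α} {a q : ℕ → α → ℝ} {H : α → ℝ} {D : ℝ}
    (ha : ∀ k, Integrable (a k) μ) (hq : ∀ k, Integrable (q k) μ) (hH : Integrable H μ)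
    (hD : ∀ k, ∫ x, q k x ∂μ ≤ D) (h : ∀ k x, ∀ ε > 0, |a k x| ≤ ε * q k x + ε⁻¹ * H x) (hn : ∀ x, 0 ≤ H x)
    (hq0 : ∀ k x, 0 ≤ q k x) (hl : ∀ x, Tendsto (fun k => a k x) atTop (𝓝 0)) :
    Tendsto (fun k => ∫ x, a k x ∂μ) atTop (𝓝 0) := by
  have D0 : 0 ≤ D := (integral_nonneg (hq0 0)).trans (hD 0)
  rw [Metric.tendsto_atTop]
  intro δ hδ
  obtain ⟨ε, hε⟩ : ∃ ε, ε = δ / (2 * (D + 1)) := ⟨_, rfl⟩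
  have εp : 0 < ε := by rw [hε]; positivity
  have hr : ∀ k, Integrable (fun x => max (|a k x| - ε * q k x) 0) μ := fun k =>
    ((ha k).abs.sub ((hq k).const_mul ε)).pos_part
  have R : Tendsto (fun k => ∫ x, max (|a k x| - ε * q k x) 0 ∂μ) atTop (𝓝 (∫ _, 0 ∂μ)) := by
    refine tendsto_integral_of_dominated_convergence (fun x => ε⁻¹ * H x) (fun k => (hr k).1) (hH.const_mul _)
      (fun k => Eventually.of_forall fun x => ?_) (Eventually.of_forall fun x => ?_)
    · rw [Real.norm_eq_abs, abs_of_nonneg (le_max_right _ _)]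
      exact max_le (by linarith [h k x ε εp]) (mul_nonneg (by positivity) (hn x))
    · refine squeeze_zero (fun k => le_max_right _ _) (fun k => max_le ?_ (abs_nonneg _))
        (by simpa using (hl x).abs)
      linarith [mul_nonneg εp.le (hq0 k x)]
  rw [integral_zero] at R
  obtain ⟨N, hN⟩ := (Metric.tendsto_atTop.1 R) (δ / 2) (by positivity)
  refine ⟨N, fun k hk => ?_⟩
  have h1 := hN k hk
  rw [Real.dist_eq, sub_zero] at h1 ⊢
  have h2 : ∫ x, |a k x| ∂μ ≤ ∫ x, (ε * q k x + max (|a k x| - ε * q k x) 0) ∂μ :=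
    integral_mono (ha k).abs (((hq k).const_mul ε).add (hr k)) fun x => by
      have := le_max_left (|a k x| - ε * q k x) 0
      simp only; linarith
  rw [integral_add ((hq k).const_mul ε) (hr k), integral_const_mul] at h2
  have h3 := abs_integral_le_integral_abs (f := a k) (μ := μ)
  have h4 : ε * ∫ x, q k x ∂μ ≤ ε * D := mul_le_mul_of_nonneg_left (hD k) εp.le
  have h5 : ε * D < δ / 2 := by
    have : ε * (2 * (D + 1)) = δ := by rw [hε]; field_simp
    nlinarith
  have := le_abs_self (∫ x, max (|a k x| - ε * q k x) 0 ∂μ)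
  linarith

lemma Q_int {v : ℝ → En n} (hv : Continuous v) {e K : ℝ} (hK : 0 ≤ K) (hg : gagliardoSqE e v ≤ ENNReal.ofReal K) :
    Integrable (fun p : ℝ × ℝ => ‖v p.2 - v p.1‖ ^ 2 / dT p.1 p.2 ^ (2 * e + 1))
      ((volume.restrict I01).prod (volume.restrict I01)) ∧
    ∫ p : ℝ × ℝ, ‖v p.2 - v p.1‖ ^ 2 / dT p.1 p.2 ^ (2 * e + 1)
      ∂((volume.restrict I01).prod (volume.restrict I01)) ≤ K := by
  have m := gag_meas hv (2 * e + 1)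
  have n0 : ∀ p : ℝ × ℝ, 0 ≤ ‖v p.2 - v p.1‖ ^ 2 / dT p.1 p.2 ^ (2 * e + 1) := fun p =>
    div_nonneg (sq_nonneg _) (Real.rpow_nonneg (dT_nonneg _ _) _)
  have L : ∫⁻ p : ℝ × ℝ, ENNReal.ofReal (‖v p.2 - v p.1‖ ^ 2 / dT p.1 p.2 ^ (2 * e + 1))
      ∂((volume.restrict I01).prod (volume.restrict I01)) ≤ ENNReal.ofReal K := by
    rw [lintegral_prod _ m.ennreal_ofReal.aemeasurable]; exact hg
  refine ⟨⟨m.aestronglyMeasurable, ?_⟩, ?_⟩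
  · rw [hasFiniteIntegral_iff_ofReal (Eventually.of_forall n0)]; exact L.trans_lt ENNReal.ofReal_lt_top
  · rw [integral_eq_lintegral_of_nonneg_ae (Eventually.of_forall n0) m.aestronglyMeasurable]
    exact ENNReal.toReal_le_of_le_ofReal hK L

lemma young {E : Type*} [NormedAddCommGroup E] [InnerProductSpace ℝ E] (a b v : E) {ε : ℝ} (hε : 0 < ε) {d : ℝ}
    (hd : 0 ≤ d) : |⟪a - b, v⟫ / d| ≤ ε * (2 * (‖a‖ ^ 2 / d) + 2 * (‖b‖ ^ 2 / d)) + ε⁻¹ * (‖v‖ ^ 2 / d) := by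
  rw [abs_div, abs_of_nonneg hd]
  have h1 := abs_real_inner_le_norm (a - b) v
  have h2 := norm_sub_le a b
  have h3 : ‖a - b‖ ^ 2 ≤ 2 * ‖a‖ ^ 2 + 2 * ‖b‖ ^ 2 := by
    nlinarith [sq_nonneg (‖a‖ - ‖b‖), norm_nonneg (a - b)]
  have h4 : ‖a - b‖ * ‖v‖ ≤ ε * ‖a - b‖ ^ 2 + ε⁻¹ * ‖v‖ ^ 2 := by
    have e : ε * ε⁻¹ = 1 := mul_inv_cancel₀ hε.ne'
    have i0 : 0 < ε⁻¹ := by positivity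
    have : 0 ≤ ε⁻¹ * (ε * ‖a - b‖ - ‖v‖) ^ 2 := by positivity
    have e2 : ε⁻¹ * (ε * ‖a - b‖ - ‖v‖) ^ 2 = ε * ‖a - b‖ ^ 2 - 2 * (‖a - b‖ * ‖v‖) + ε⁻¹ * ‖v‖ ^ 2 := by
      field_simp; ring
    nlinarith [mul_nonneg (norm_nonneg (a - b)) (norm_nonneg v)]
  have h5 : |⟪a - b, v⟫| ≤ ε * (2 * ‖a‖ ^ 2 + 2 * ‖b‖ ^ 2) + ε⁻¹ * ‖v‖ ^ 2 := by
    have := mul_le_mul_of_nonneg_left h3 hε.le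
    linarith
  calc _ ≤ (ε * (2 * ‖a‖ ^ 2 + 2 * ‖b‖ ^ 2) + ε⁻¹ * ‖v‖ ^ 2) / d := by gcongr
    _ = _ := by ring

lemma in_int {u v : ℝ → En n} (hu : Continuous u) (hv : Continuous v) {e : ℝ} (gu : gagliardoSqE e u < ⊤)
    (gv : gagliardoSqE e v < ⊤) : Integrable (fun p : ℝ × ℝ => ⟪u p.2 - u p.1, v p.2 - v p.1⟫ / dT p.1 p.2 ^ (2 * e + 1))
      ((volume.restrict I01).prod (volume.restrict I01)) := by
  have c : Continuous fun p : ℝ × ℝ => ⟪u p.2 - u p.1, v p.2 - v p.1⟫ := by fun_prop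
  have m := c.measurable.div (dT_meas.pow_const (2 * e + 1))
  have i1 := (Q_int hu ENNReal.toReal_nonneg (ENNReal.ofReal_toReal gu.ne).ge).1
  have i2 := (Q_int hv ENNReal.toReal_nonneg (ENNReal.ofReal_toReal gv.ne).ge).1
  refine ((i1.const_mul 2).add i2).mono' m.aestronglyMeasurable (Eventually.of_forall fun p => ?_)
  have := young (u p.2 - u p.1) 0 (v p.2 - v p.1) one_pos (d := dT p.1 p.2 ^ (2 * e + 1)) (Real.rpow_nonneg (dT_nonneg _ _) _)
  simp only [sub_zero, norm_zero, one_mul, inv_one] at this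
  rw [Real.norm_eq_abs]; refine this.trans_eq ?_; simp

lemma dct1 {vk : ℕ → ℝ → En n} {w v : ℝ → En n} (hc : ∀ k, Continuous (vk k)) (hv : Continuous v) {R : ℝ}
    (hR : ∀ k x, ‖vk k x‖ ≤ R) (hl : ∀ x, Tendsto (fun k => vk k x) atTop (𝓝 (w x))) :
    Tendsto (fun k => ∫ x in I01, ⟪vk k x, v x⟫) atTop (𝓝 (∫ x in I01, ⟪w x, v x⟫)) := by
  refine tendsto_integral_of_dominated_convergence (fun x => R * ‖v x‖)
    (fun k => ((hc k).inner hv).aestronglyMeasurable)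
    (((continuous_const.mul hv.norm).continuousOn.integrableOn_compact isCompact_Icc).mono_set Ico_subset_Icc_self)
    (fun k => Eventually.of_forall fun x => (norm_inner_le_norm _ _).trans
      (mul_le_mul_of_nonneg_right (hR k x) (norm_nonneg _)))
    (Eventually.of_forall fun x => (hl x).inner tendsto_const_nhds)

lemma dct2 {vk : ℕ → ℝ → En n} {w v : ℝ → En n} (hc : ∀ k, Continuous (vk k)) (hw : Continuous w) (hv : Continuous v)
    {e K : ℝ} (hK : 0 ≤ K) (hl : ∀ x, Tendsto (fun k => vk k x) atTop (𝓝 (w x)))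
    (gk : ∀ k, gagliardoSqE e (vk k) ≤ ENNReal.ofReal K) (gw : gagliardoSqE e w ≤ ENNReal.ofReal K)
    (gv : gagliardoSqE e v < ⊤) :
    Tendsto (fun k => ∫ x in I01, ∫ y in I01, ⟪vk k y - vk k x, v y - v x⟫ / dT x y ^ (2 * e + 1)) atTop
      (𝓝 (∫ x in I01, ∫ y in I01, ⟪w y - w x, v y - v x⟫ / dT x y ^ (2 * e + 1))) := by
  have I1 := fun k => in_int (hc k) hv ((gk k).trans_lt ENNReal.ofReal_lt_top) gv
  have I2 := in_int hw hv (gw.trans_lt ENNReal.ofReal_lt_top) gv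
  have e1 := fun k => integral_prod _ (I1 k)
  have e2 := integral_prod _ I2
  simp only at e1 e2
  simp_rw [← e1]
  rw [← e2]
  have Qk := fun k => Q_int (hc k) hK (gk k)
  have Qw := Q_int hw hK gw
  have Qv := Q_int hv ENNReal.toReal_nonneg (ENNReal.ofReal_toReal gv.ne).ge
  have dn : ∀ p : ℝ × ℝ, 0 ≤ dT p.1 p.2 ^ (2 * e + 1) := fun p => Real.rpow_nonneg (dT_nonneg _ _) _
  have W := wk_lim (fun k => (I1 k).sub I2) (fun k => ((Qk k).1.const_mul 2).add (Qw.1.const_mul 2)) Qv.1 (D := 4 * K)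
    (fun k => by
      simp only [Pi.add_apply]
      rw [integral_add ((Qk k).1.const_mul 2) (Qw.1.const_mul 2), integral_const_mul, integral_const_mul]
      linarith [(Qk k).2, Qw.2])
    (fun k p ε hε => by
      have := young (vk k p.2 - vk k p.1) (w p.2 - w p.1) (v p.2 - v p.1) hε (dn p)
      rw [inner_sub_left, sub_div] at this
      exact this)
    (fun p => div_nonneg (sq_nonneg _) (dn p))
    (fun k p => add_nonneg (mul_nonneg zero_le_two (div_nonneg (sq_nonneg _) (dn p)))
      (mul_nonneg zero_le_two (div_nonneg (sq_nonneg _) (dn p))))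
    (fun p => by
      have : Tendsto (fun k => ⟪vk k p.2 - vk k p.1, v p.2 - v p.1⟫ / dT p.1 p.2 ^ (2 * e + 1) -
          ⟪w p.2 - w p.1, v p.2 - v p.1⟫ / dT p.1 p.2 ^ (2 * e + 1)) atTop (𝓝 (_ - _)) :=
        ((((hl p.2).sub (hl p.1)).inner tendsto_const_nhds).div_const _).sub tendsto_const_nhds
      rw [sub_self] at this
      exact this)
  simp only [Pi.sub_apply] at W
  simp_rw [fun k => integral_sub (I1 k) I2] at W
  simpa using W.add_const (∫ p : ℝ × ℝ, ⟪w p.2 - w p.1, v p.2 - v p.1⟫ / dT p.1 p.2 ^ (2 * e + 1)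
    ∂((volume.restrict I01).prod (volume.restrict I01)))

lemma alaoglu (hs : 3 / 2 < s) (hM : 0 ≤ M) (hc : 0 < c0) (hκ : 0 < κ) {γk : ℕ → ℝ → En n}
    (h : ∀ k, UB s (γk k) M B c0 C0 κ) : ∃ (γ : ℝ → En n) (φ : ℕ → ℕ), InM s γ ∧ StrictMono φ ∧
      WeakHsTendsto s (fun k => γk (φ k)) γ := by
  obtain ⟨γ, φ, hφ, hp, hd, l0, l1⟩ := C1_cpct hs hM h
  obtain ⟨hI, hg⟩ := lim_InM hs hc hκ (fun k => h (φ k)) hp hd l0 l1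
  refine ⟨γ, φ, hI, hφ, fun v hv => ?_⟩
  have cv := hv.2.1.continuous_deriv le_rfl
  have ck := fun k => (h (φ k)).imm.cd.continuous_deriv le_rfl
  exact ((dct1 (fun k => (h (φ k)).imm.cd.continuous) hv.2.1.continuous (fun k => (h (φ k)).b0) l0).add
    (dct1 ck cv (fun k => (h (φ k)).up) l1)).add
    (dct2 ck (hd.continuous_deriv le_rfl) cv (sq_nonneg M) l1 (fun k => (h (φ k)).gag) hg hv.2.2)
end weak

/-- Banach–Alaoglu property: every sequence contained in a
`G`-bounded subset of `𝓜` has a subsequence converging weakly in `H^s(𝕋,ℝⁿ)` to some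
`γ ∈ 𝓜`; i.e. `G`-bounded sets are relatively compact in the weak topology of `H^s`,
with all weak limit points lying in `𝓜`. -/
theorem statement16 (s : ℝ) (hs : s ∈ Set.Ioo (3 / 2 : ℝ) 2) (n : ℕ) (hn : 2 ≤ n)
    (U : Set (ℝ → En n)) (hU : GBounded s U)
    (γk : ℕ → ℝ → En n) (hmem : ∀ k, γk k ∈ U) :
    ∃ (γ : ℝ → En n) (φ : ℕ → ℕ), InM s γ ∧ StrictMono φ ∧
      WeakHsTendsto s (fun k => γk (φ k)) γ := by
  obtain ⟨M, B, c0, C0, κ, hM, hc, hκ, H⟩ := gb_unif hs.1 hU (hmem 0)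
  exact alaoglu hs.1 hM hc hκ fun k => H _ (hmem k)
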